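/- For any ρ > 0 and all integers k ≥ 3 and 1 ≤ ℓ < k/2 there exists ξ > 0 such that the following holds for sufficiently large n divisible by k−ℓ: if H = (V,E) is an (ℓ,ξ)-extremal k-uniform hypergraph on n vertices with δ_{k−2}(H) > δ_{k−2}(X_{k,ℓ}(n)), then there exist a non-empty ℓ-path Q in H with ends L₀ and L₁ and a partition A* ∪ B* of (V ∖ V(Q)) ∪ L₀ ∪ L₁ with L₀, L₁ ⊆ B* such that: (i) |B*| = (2k−2ℓ−1)|A*| + ℓ; (ii) d(v, B*^(k−1)) ≥ (1−ρ)·C(|B*|, k−1) for every v ∈ A*; (iii) d(v, A*^(1)B*^(k−2)) ≥ (1−ρ)·|A*|·C(|B*|, k−2) for every v ∈ B*; (iv) d(L₀, A*^(1)B*^(k−ℓ−1)) ≥ (1−ρ)·|A*|·C(|B*|, k−ℓ−1) and d(L₁, A*^(1)B*^(k−ℓ−1)) ≥ (1−ρ)·|A*|·C(|B*|, k−ℓ−1). -/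

import Mathlib

open Finset

/-- `E` is the edge set of a `k`-uniform hypergraph on vertex set `Fin n`:
every edge is a `k`-element set of vertices. -/
def Uniform (n k : ℕ) (E : Finset (Finset (Fin n))) : Prop :=
  ∀ e ∈ E, e.card = k

/-- The degree `d(S)` of a vertex set `S`: the number of edges containing `S`. -/
def deg {n : ℕ} (E : Finset (Finset (Fin n))) (S : Finset (Fin n)) : ℕ :=
  (E.filter fun e => S ⊆ e).card

/-- The minimum `s`-degree `δ_s(H)`: the minimum of `d(S)` over all `s`-element
vertex sets `S`. -/
noncomputable def minDeg (n : ℕ) (E : Finset (Finset (Fin n))) (s : ℕ) : ℕ :=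
  sInf {d | ∃ S : Finset (Fin n), S.card = s ∧ deg E S = d}

/-- `d(L, X^(i) Y^(j))`: the number of edges of the form `L ∪ I ∪ J` with
`I ∈ X^(i)`, `J ∈ Y^(j)` (take `Y = ∅`, `j = 0` when `Y^(j)` is omitted). -/
def degIn {n : ℕ} (E : Finset (Finset (Fin n))) (L X Y : Finset (Fin n)) (i j : ℕ) : ℕ :=
  (E.filter fun e =>
    L ⊆ e ∧ e \ L ⊆ X ∪ Y ∧ ((e \ L) ∩ X).card = i ∧ ((e \ L) ∩ Y).card = j).card

/-- The `i`-th edge of an ℓ-cycle given by the cyclic ordering `f` of the `n`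
vertices: `k` cyclically consecutive vertices starting at position `i * (k - ℓ)`. -/
def cycEdge (n k ℓ : ℕ) (f : ℕ → Fin n) (i : ℕ) : Finset (Fin n) :=
  (Finset.range k).image fun j => f ((i * (k - ℓ) + j) % n)

/-- `H = (Fin n, E)` contains a Hamiltonian ℓ-cycle: there is a cyclic ordering of
all `n` vertices such that each of the `n / (k - ℓ)` windows of `k` consecutive
vertices (consecutive windows overlapping in `ℓ` vertices) is an edge, and two
consecutive edges share exactly `ℓ` vertices. -/
def HasHamCycle (n k ℓ : ℕ) (E : Finset (Finset (Fin n))) : Prop :=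
  ∃ f : ℕ → Fin n, Set.InjOn f (Set.Iio n) ∧
    (∀ i < n / (k - ℓ), cycEdge n k ℓ f i ∈ E) ∧
    (∀ i < n / (k - ℓ),
      (cycEdge n k ℓ f i ∩ cycEdge n k ℓ f ((i + 1) % (n / (k - ℓ)))).card = ℓ)

/-- The `i`-th edge of an ℓ-path given by the linear ordering `f`. -/
def pathEdge (n k ℓ : ℕ) (f : ℕ → Fin n) (i : ℕ) : Finset (Fin n) :=
  (Finset.range k).image fun j => f (i * (k - ℓ) + j)

/-- `f` is (the linear ordering of the vertices of) an ℓ-path with `t` edges all of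
which belong to `E`: the path has `t * (k - ℓ) + ℓ` vertices, every edge consists of
`k` consecutive vertices and two consecutive edges intersect in exactly `ℓ` vertices. -/
def IsPath (n k ℓ t : ℕ) (E : Finset (Finset (Fin n))) (f : ℕ → Fin n) : Prop :=
  Set.InjOn f (Set.Iio (t * (k - ℓ) + ℓ)) ∧ ∀ i < t, pathEdge n k ℓ f i ∈ E

/-- The vertex set of the ℓ-path described by `f` with `t` edges. -/
def pathVerts (n k ℓ t : ℕ) (f : ℕ → Fin n) : Finset (Fin n) :=
  (Finset.range (t * (k - ℓ) + ℓ)).image f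

/-- The first end (first `ℓ` vertices) of the ℓ-path described by `f`. -/
def pathEnd0 (n ℓ : ℕ) (f : ℕ → Fin n) : Finset (Fin n) :=
  (Finset.range ℓ).image f

/-- The last end (last `ℓ` vertices) of the ℓ-path described by `f` with `t` edges. -/
def pathEnd1 (n k ℓ t : ℕ) (f : ℕ → Fin n) : Finset (Fin n) :=
  (Finset.Ico (t * (k - ℓ)) (t * (k - ℓ) + ℓ)).image f

/-- The extremal hypergraph `X_{k,ℓ}(n)` on `Fin n`.  If `n` is an odd multiple of
`k - ℓ`, take `A` to be the first `⌊n / (2(k-ℓ))⌋` vertices and all `k`-sets meeting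
`A` as edges.  If `n` is an even multiple of `k - ℓ`, take `A` to be the first
`n / (2(k-ℓ)) - 1` vertices, fix the `ℓ + 1` following vertices (which lie in
`B = V ∖ A`), and take as edges all `k`-sets meeting `A` together with all `k`-subsets
of `B` containing all `ℓ + 1` fixed vertices. -/
def Xedges (n k ℓ : ℕ) : Finset (Finset (Fin n)) :=
  if Odd (n / (k - ℓ)) then
    (Finset.powersetCard k (Finset.univ : Finset (Fin n))).filter fun e =>
      ∃ v ∈ e, (v : ℕ) < n / (2 * (k - ℓ))
  else
    (Finset.powersetCard k (Finset.univ : Finset (Fin n))).filter fun e =>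
      (∃ v ∈ e, (v : ℕ) < n / (2 * (k - ℓ)) - 1) ∨
      ((∀ v ∈ e, n / (2 * (k - ℓ)) - 1 ≤ (v : ℕ)) ∧
        ∀ w : Fin n, n / (2 * (k - ℓ)) - 1 ≤ (w : ℕ) → (w : ℕ) < n / (2 * (k - ℓ)) + ℓ →
          w ∈ e)

/-- `e(B)`: the number of edges lying entirely inside `B`. -/
def edgesIn {n : ℕ} (E : Finset (Finset (Fin n))) (B : Finset (Fin n)) : ℕ :=
  (E.filter fun e => e ⊆ B).card

/-- `(A, B)` is an `(ℓ,ξ)`-extremal partition of the vertex set: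
`|A| = ⌈n/(2(k-ℓ))⌉ - 1`, `|B| = ⌊(2(k-ℓ)-1)n/(2(k-ℓ)) + 1⌋` and
`e(B) ≤ ξ · C(n,k)`. -/
def IsExtremalPartition (n k ℓ : ℕ) (E : Finset (Finset (Fin n))) (ξ : ℝ)
    (A B : Finset (Fin n)) : Prop :=
  Disjoint A B ∧ A ∪ B = Finset.univ ∧
  A.card = ⌈(n : ℝ) / (2 * ((k - ℓ : ℕ) : ℝ))⌉₊ - 1 ∧
  B.card = ⌊(2 * ((k - ℓ : ℕ) : ℝ) - 1) * (n : ℝ) / (2 * ((k - ℓ : ℕ) : ℝ)) + 1⌋₊ ∧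
  (edgesIn E B : ℝ) ≤ ξ * (n.choose k : ℝ)

/-- `H` is `(ℓ,ξ)`-extremal. -/
def IsExtremal (n k ℓ : ℕ) (E : Finset (Finset (Fin n))) (ξ : ℝ) : Prop :=
  ∃ A B, IsExtremalPartition n k ℓ E ξ A B

/-- `(A, B)` is a minimal `(ℓ,ξ)`-extremal partition: among all `(ℓ,ξ)`-extremal
partitions it minimises `e(B)`. -/
def IsMinExtremalPartition (n k ℓ : ℕ) (E : Finset (Finset (Fin n))) (ξ : ℝ)
    (A B : Finset (Fin n)) : Prop :=
  IsExtremalPartition n k ℓ E ξ A B ∧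
  ∀ A' B' : Finset (Fin n), IsExtremalPartition n k ℓ E ξ A' B' →
    edgesIn E B ≤ edgesIn E B'

open scoped Classical in
/-- `A_ε`: the set of vertices `v` with `d(v, B^(k-1)) ≥ (1-ε)·C(|B|, k-1)`. -/
noncomputable def Aeps (n k : ℕ) (E : Finset (Finset (Fin n))) (B : Finset (Fin n)) (ε : ℝ) :
    Finset (Fin n) :=
  Finset.univ.filter fun v =>
    (1 - ε) * (B.card.choose (k - 1) : ℝ) ≤ (degIn E {v} B ∅ (k - 1) 0 : ℝ)

open scoped Classical in
/-- `B_ε`: the set of vertices `v` with `d(v, B^(k-1)) ≤ ε·C(|B|, k-1)`. -/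
noncomputable def Beps (n k : ℕ) (E : Finset (Finset (Fin n))) (B : Finset (Fin n)) (ε : ℝ) :
    Finset (Fin n) :=
  Finset.univ.filter fun v =>
    (degIn E {v} B ∅ (k - 1) 0 : ℝ) ≤ ε * (B.card.choose (k - 1) : ℝ)

/-- `V_ε = V ∖ (A_ε ∪ B_ε)`. -/
noncomputable def Veps (n k : ℕ) (E : Finset (Finset (Fin n))) (B : Finset (Fin n)) (ε : ℝ) :
    Finset (Fin n) :=
  Finset.univ \ (Aeps n k E B ε ∪ Beps n k E B ε)

/-- `L` is an ε-typical ℓ-set: `L ⊆ B_ε`, `|L| = ℓ` and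
`d(L, B^(k-ℓ)) ≤ ε·C(|B|, k-ℓ)`. -/
def IsTypical (n k ℓ : ℕ) (E : Finset (Finset (Fin n))) (B : Finset (Fin n)) (ε : ℝ)
    (L : Finset (Fin n)) : Prop :=
  L.card = ℓ ∧ L ⊆ Beps n k E B ε ∧
    (degIn E L B ∅ (k - ℓ) 0 : ℝ) ≤ ε * (B.card.choose (k - ℓ) : ℝ)

namespace ExtremalPath

/-- The probability that a uniformly random function `ι → V` satisfies `P`. -/
noncomputable def pr {V : Type*} [Fintype V] (ι : Type*) [Fintype ι] (P : (ι → V) → Prop) : ℝ :=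
  ({x | P x}.ncard : ℝ) / (Fintype.card V : ℝ) ^ Fintype.card ι

section Pr

variable {V : Type*} [Fintype V] {ι κ : Type*} [Fintype ι] [Fintype κ]

lemma pr_nonneg (P : (ι → V) → Prop) : 0 ≤ pr ι P := by unfold pr; positivity

lemma pr_mono {P Q : (ι → V) → Prop} (h : ∀ x, P x → Q x) : pr ι P ≤ pr ι Q := by
  unfold pr
  gcongr
  · exact Set.toFinite _
  · exact h _

lemma pr_congr {P Q : (ι → V) → Prop} (h : ∀ x, P x ↔ Q x) : pr ι P = pr ι Q :=
  le_antisymm (pr_mono fun x => (h x).1) (pr_mono fun x => (h x).2)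

lemma pr_or (P Q : (ι → V) → Prop) : pr ι (fun x => P x ∨ Q x) ≤ pr ι P + pr ι Q := by
  unfold pr
  rw [← add_div]
  gcongr
  exact_mod_cast Set.ncard_union_le {x | P x} {x | Q x}

lemma pr_exists {α : Type*} (s : Finset α) (P : α → (ι → V) → Prop) :
    pr ι (fun x => ∃ a ∈ s, P a x) ≤ ∑ a ∈ s, pr ι (P a) := by
  classical
  induction s using Finset.induction_on with
  | empty => simp [pr]
  | insert a s ha ih =>
    rw [Finset.sum_insert ha]
    calc pr ι (fun x => ∃ b ∈ insert a s, P b x)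
        ≤ pr ι (fun x => P a x ∨ ∃ b ∈ s, P b x) := pr_mono (by simp)
      _ ≤ _ := (pr_or _ _).trans (by gcongr)

lemma exists_of_pr_lt {P Q : (ι → V) → Prop} (h : pr ι Q < pr ι P) : ∃ x, P x ∧ ¬ Q x := by
  by_contra! hc
  exact absurd (pr_mono hc) (not_le.2 h)

lemma pr_sub_le (P Q : (ι → V) → Prop) : pr ι P - pr ι Q ≤ pr ι (fun x => P x ∧ ¬ Q x) := by
  have : pr ι P ≤ pr ι (fun x => (P x ∧ ¬ Q x) ∨ Q x) := pr_mono (by tauto)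
  linarith [pr_or (fun x => P x ∧ ¬ Q x) Q]

lemma pr_equiv (e : ι ≃ κ) (P : (ι → V) → Prop) :
    pr κ (fun x => P (x ∘ e)) = pr ι P := by
  unfold pr
  rw [Fintype.card_congr e]
  congr 2
  exact Set.ncard_congr' ((Equiv.arrowCongr e (Equiv.refl V)).symm.subtypeEquiv
    (fun x => by simp [Equiv.arrowCongr, Function.comp_def]))

lemma pr_sum [DecidableEq ι] [Nonempty V] (P : (ι → V) → (κ → V) → Prop) :
    pr (ι ⊕ κ) (fun z : ι ⊕ κ → V => P (z ∘ Sum.inl) (z ∘ Sum.inr)) =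
      (∑ x : ι → V, pr κ (P x)) / (Fintype.card V : ℝ) ^ Fintype.card ι := by
  classical
  unfold pr
  rw [← Finset.sum_div, div_div, Fintype.card_sum, pow_add, mul_comm (_ ^ _)]
  congr 1
  have h1 : {z : ι ⊕ κ → V | P (z ∘ Sum.inl) (z ∘ Sum.inr)}.ncard =
      {z : (ι → V) × (κ → V) | P z.1 z.2}.ncard :=
    Set.ncard_congr' ((Equiv.sumArrowEquivProdArrow ι κ V).subtypeEquiv (fun x => by
      simp [Equiv.sumArrowEquivProdArrow]))
  rw [h1, Set.ncard_eq_toFinset_card']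
  have h2 : ∀ x : ι → V, {y | P x y}.ncard = (univ.filter (P x)).card := fun x => by
    rw [Set.ncard_eq_toFinset_card']; simp
  simp only [h2, Finset.card_filter]
  rw [← Nat.cast_sum]
  congr 1
  rw [← Fintype.sum_prod_type' (fun x y => if P x y then 1 else 0), ← Finset.card_filter]
  simp

lemma pr_le_one [Nonempty V] (P : (ι → V) → Prop) : pr ι P ≤ 1 := by
  classical
  unfold pr
  rw [div_le_one (by positivity)]
  have : {x | P x}.ncard ≤ Nat.card (ι → V) := Set.ncard_le_card _
  simp only [Nat.card_eq_fintype_card, Fintype.card_fun] at this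
  exact_mod_cast this

lemma exists_le_pr_of_sum [DecidableEq ι] [Nonempty V] (P : (ι → V) → (κ → V) → Prop) :
    ∃ x, pr (ι ⊕ κ) (fun z : ι ⊕ κ → V => P (z ∘ Sum.inl) (z ∘ Sum.inr)) ≤ pr κ (P x) := by
  classical
  by_contra! h
  have h1 := pr_sum P
  set p := pr (ι ⊕ κ) (fun z : ι ⊕ κ → V => P (z ∘ Sum.inl) (z ∘ Sum.inr))
  have h2 : ∑ x : ι → V, pr κ (P x) < ∑ x : ι → V, p :=
    Finset.sum_lt_sum_of_nonempty univ_nonempty (fun x _ => h x)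
  rw [eq_div_iff (by positivity)] at h1
  simp at h2
  linarith

lemma pr_markov [DecidableEq ι] [Nonempty V] (P : (ι → V) → (κ → V) → Prop) (β : ℝ) :
    pr ι (fun x => β < pr κ (P x)) * β ≤
      pr (ι ⊕ κ) (fun z : ι ⊕ κ → V => P (z ∘ Sum.inl) (z ∘ Sum.inr)) := by
  classical
  rw [pr_sum, pr, div_mul_eq_mul_div]
  gcongr
  rw [Set.ncard_eq_toFinset_card', ← nsmul_eq_mul]
  refine (Finset.card_nsmul_le_sum _ (fun x => pr κ (P x)) β ?_).trans
    (Finset.sum_le_sum_of_subset_of_nonneg (subset_univ _) fun _ _ _ => pr_nonneg _)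
  intro x hx
  simp at hx
  exact hx.le

lemma pr_inl [Nonempty V] (P : (ι → V) → Prop) :
    pr (ι ⊕ κ) (fun z : ι ⊕ κ → V => P (z ∘ Sum.inl)) = pr ι P := by
  classical
  rw [pr_sum (ι := ι) (κ := κ) (fun x _ => P x), pr]
  congr 1
  have : ∀ x : ι → V, pr κ (fun _ : κ → V => P x) = if P x then 1 else 0 := by
    intro x
    have hV : (Fintype.card V : ℝ) ^ Fintype.card κ ≠ 0 := by positivity
    split_ifs with h <;> simp [pr, h, Set.ncard_univ, Nat.card_eq_fintype_card, hV]
  simp only [this]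
  rw [Set.ncard_eq_toFinset_card']
  simp

lemma pr_comp [Nonempty V] (f : κ → ι) (hf : Function.Injective f) (P : (κ → V) → Prop) :
    pr ι (fun x => P (x ∘ f)) = pr κ P := by
  classical
  let e : κ ⊕ {i // i ∉ Set.range f} ≃ ι :=
    ((Equiv.ofInjective f hf).sumCongr (Equiv.refl _)).trans (Equiv.Set.sumCompl (Set.range f))
  rw [← pr_inl (κ := {i // i ∉ Set.range f}) P, ← pr_equiv e]
  rfl

lemma pr_coord [Nonempty V] (i : ι) (P : (ι → V) → Prop) (c : ℕ)
    (h : ∀ x : ι → V, {v | ∃ z, P z ∧ z i = v ∧ ∀ j, j ≠ i → z j = x j}.ncard ≤ c) :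
    pr ι P ≤ c / Fintype.card V := by
  classical
  let e : {j // j ≠ i} ⊕ Unit ≃ ι :=
    ((Equiv.refl _).sumCongr ⟨fun _ => ⟨i, by simp⟩, fun _ => (), fun _ => rfl,
      fun j => Subtype.ext (not_not.1 j.2).symm⟩).trans (Equiv.sumCompl (fun j => j ≠ i))
  rw [← pr_equiv e.symm]
  have h0 : ∀ z : {j // j ≠ i} ⊕ Unit → V, z ∘ e.symm =
      fun j => if h : j ≠ i then z (Sum.inl ⟨j, h⟩) else z (Sum.inr ()) := by
    intro z; funext j
    split_ifs with h
    · have : e.symm j = Sum.inl ⟨j, h⟩ := by rw [Equiv.symm_apply_eq]; rfl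
      simp [this]
    · have : e.symm j = Sum.inr () := by
        rw [Equiv.symm_apply_eq]; push Not at h; rw [h]; rfl
      simp [this]
  have h1 := pr_sum (V := V) (ι := {j // j ≠ i}) (κ := Unit)
    (fun x y => P (fun j => if h : j ≠ i then x ⟨j, h⟩ else y ()))
  have h2 : pr ({j // j ≠ i} ⊕ Unit) (fun z : _ → V => P (z ∘ e.symm)) =
      pr ({j // j ≠ i} ⊕ Unit) (fun z : {j // j ≠ i} ⊕ Unit → V =>
        P (fun j => if h : j ≠ i then (z ∘ Sum.inl) ⟨j, h⟩ else (z ∘ Sum.inr) ())) :=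
    pr_congr fun z => by rw [h0]; rfl
  rw [h2, h1, div_le_iff₀ (by positivity)]
  have h3 : ∀ x : {j // j ≠ i} → V,
      pr Unit (fun y : Unit → V => P (fun j => if h : j ≠ i then x ⟨j, h⟩ else y ())) ≤
        c / Fintype.card V := by
    intro x
    simp only [pr, Fintype.card_unit, pow_one]
    gcongr
    refine le_trans ?_ (h (fun j => if h : j ≠ i then x ⟨j, h⟩ else Classical.arbitrary V))
    refine Set.ncard_le_ncard_of_injOn (fun y => y ()) ?_ ?_ (Set.toFinite _)
    · intro y hy
      refine ⟨_, hy, by simp, fun j hj => by simp [hj]⟩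
    · intro y _ y' _ hyy
      funext u; exact hyy
  refine (Finset.sum_le_sum fun x _ => h3 x).trans ?_
  simp [mul_comm]

lemma pr_mem_le [Nonempty V] (i : ι) (W : Finset V) :
    pr ι (fun x => x i ∈ W) ≤ (W.card : ℝ) / Fintype.card V := by
  refine pr_coord i _ _ fun x => ?_
  rw [← Set.ncard_coe_finset]
  refine Set.ncard_le_ncard ?_ (Set.toFinite _)
  rintro v ⟨z, hz, rfl, -⟩
  exact hz

lemma pr_exists_mem_le [Nonempty V] (W : Finset V) :
    pr ι (fun x => ∃ i, x i ∈ W) ≤ Fintype.card ι * ((W.card : ℝ) / Fintype.card V) := by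
  have := pr_exists (univ : Finset ι) (fun i (x : ι → V) => x i ∈ W)
  simp only [mem_univ, true_and] at this
  refine this.trans ((Finset.sum_le_sum fun i _ => pr_mem_le i W).trans ?_)
  simp

lemma pr_eq_le [Nonempty V] {i j : ι} (hij : i ≠ j) :
    pr ι (fun x : ι → V => x i = x j) ≤ 1 / Fintype.card V := by
  have := pr_coord i (fun x : ι → V => x i = x j) 1 fun x => by
    refine (Set.ncard_le_ncard (t := {x j}) ?_ (Set.toFinite _)).trans (by simp)
    rintro v ⟨z, hz, rfl, h⟩
    simp [hz, h j hij.symm]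
  simpa using this

lemma pr_not_injective_le [Nonempty V] :
    pr ι (fun x : ι → V => ¬ Function.Injective x) ≤
      (Fintype.card ι : ℝ) ^ 2 * (1 / Fintype.card V) := by
  classical
  have h1 : pr ι (fun x : ι → V => ¬ Function.Injective x) ≤
      pr ι (fun x : ι → V => ∃ p ∈ (univ : Finset (ι × ι)).filter (fun p => p.1 ≠ p.2),
        x p.1 = x p.2) := by
    refine pr_mono fun x hx => ?_
    simp only [Function.Injective, not_forall] at hx
    obtain ⟨a, b, hab, hne⟩ := hx
    exact ⟨(a, b), by simpa using hne, hab⟩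
  refine h1.trans ((pr_exists _ _).trans
    ((Finset.sum_le_sum (g := fun _ => (1 : ℝ) / Fintype.card V) fun p hp =>
      pr_eq_le (by simpa using hp)).trans ?_))
  rw [Finset.sum_const, nsmul_eq_mul]
  gcongr
  have : ((univ : Finset (ι × ι)).filter (fun p => p.1 ≠ p.2)).card ≤ Fintype.card ι ^ 2 := by
    refine (Finset.card_filter_le _ _).trans ?_
    simp [sq]
  exact_mod_cast this

lemma pr_pi (Z : ι → Finset V) :
    pr ι (fun x => ∀ i, x i ∈ Z i) = ∏ i, ((Z i).card : ℝ) / Fintype.card V := by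
  classical
  rw [Finset.prod_div_distrib, Finset.prod_const, pr, Finset.card_univ, ← Nat.cast_prod,
    ← Fintype.card_piFinset, ← Set.ncard_coe_finset]
  congr
  ext x
  simp

end Pr

section Degree

variable {n k : ℕ} {E : Finset (Finset (Fin n))}

lemma deg_eq_card_pairs (hE : Uniform n k E) (hk : 2 ≤ k) {S : Finset (Fin n)}
    (hS : S.card = k - 2) :
    deg E S = ((powersetCard 2 Sᶜ).filter fun P => S ∪ P ∈ E).card := by
  unfold deg
  refine Finset.card_nbij' (fun e => e \ S) (fun P => S ∪ P) ?_ ?_ ?_ ?_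
  · intro e he
    simp only [coe_filter, Set.mem_ofPred_eq, mem_powersetCard] at he ⊢
    refine ⟨⟨?_, ?_⟩, ?_⟩
    · intro v hv; simp at hv ⊢; exact hv.2
    · rw [card_sdiff_of_subset he.2, hE e he.1, hS]; omega
    · rw [union_sdiff_of_subset he.2]; exact he.1
  · intro P hP
    simp only [coe_filter, Set.mem_ofPred_eq, mem_powersetCard] at hP ⊢
    exact ⟨hP.2, subset_union_left⟩
  · intro e he
    simp only [coe_filter, Set.mem_ofPred_eq] at he
    exact union_sdiff_of_subset he.2
  · intro P hP
    simp only [coe_filter, Set.mem_ofPred_eq, mem_powersetCard] at hP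
    exact union_sdiff_cancel_left (disjoint_left.2 fun v hv hv' => by
      have := hP.1.1 hv'; simp at this; exact this hv)

lemma two_mul_deg_le (hE : Uniform n k E) (hk : 2 ≤ k) {S : Finset (Fin n)}
    (hS : S.card = k - 2) :
    2 * deg E S ≤
      ((univ : Finset (Fin n × Fin n)).filter fun p => S ∪ {p.1, p.2} ∈ E).card := by
  classical
  rw [deg_eq_card_pairs hE hk hS]
  have key : ∀ u v : Fin n, S ∪ {u, v} ∈ E → u ≠ v ∧ u ∉ S ∧ v ∉ S := by
    intro u v h
    have h1 := hE _ h
    have h2 : ∀ T : Finset (Fin n), T.card ≤ 1 → S ∪ {u, v} ⊆ S ∪ T → False := by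
      intro T hT hs
      have := card_le_card hs
      have := card_union_le S T
      omega
    refine ⟨?_, ?_, ?_⟩
    · rintro rfl
      exact h2 {u} (by simp) (by simp)
    · intro hu
      refine h2 {v} (by simp) ?_
      intro w; simp; rintro (rfl | rfl | h) <;> simp [*]
    · intro hu
      refine h2 {u} (by simp) ?_
      intro w; simp; rintro (rfl | rfl | h) <;> simp [*]
  refine mul_card_image_le_card_of_maps_to
    (f := fun p : Fin n × Fin n => ({p.1, p.2} : Finset (Fin n)))
    (t := (powersetCard 2 Sᶜ).filter fun P => S ∪ P ∈ E) ?_ 2 ?_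
  · intro p hp
    obtain ⟨h1, h2, h3⟩ := key p.1 p.2 (by simpa using hp)
    simp only [mem_filter, mem_powersetCard]
    refine ⟨⟨?_, card_pair h1⟩, by simpa using hp⟩
    intro w; simp; rintro (rfl | rfl) <;> assumption
  · intro P hP
    simp only [mem_filter, mem_powersetCard] at hP
    obtain ⟨u, v, huv, rfl⟩ := card_eq_two.1 hP.1.2
    rw [← card_pair (show (u, v) ≠ (v, u) by simp [huv])]
    refine card_le_card ?_
    intro p; simp only [mem_insert, mem_singleton, mem_filter, mem_univ, true_and]
    rintro (rfl | rfl)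
    · exact ⟨hP.2, rfl⟩
    · exact ⟨by rw [pair_comm]; exact hP.2, pair_comm _ _⟩

lemma two_mul_missing_le (hE : Uniform n k E) (hk : 2 ≤ k) {S A B : Finset (Fin n)}
    (hS : S.card = k - 2) (hAB : Disjoint A B) (hU : A ∪ B = univ) (ha : A.card + k ≤ n)
    (hdeg : (n - (k - 2)).choose 2 ≤ deg E S + (n - (k - 2) - A.card).choose 2) :
    2 * ((A ×ˢ B).filter fun p => S ∪ {p.1, p.2} ∉ E).card ≤
      ((B ×ˢ B).filter fun p => S ∪ {p.1, p.2} ∈ E).card + 2 * k * n := by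
  classical
  have hD := two_mul_deg_le hE hk hS
  set Q : Fin n × Fin n → Prop := fun p => S ∪ {p.1, p.2} ∈ E with hQ
  have hsplit : ((univ : Finset (Fin n × Fin n)).filter Q).card ≤
      ((A ×ˢ A).card + ((A ×ˢ B).filter Q).card) +
        (((B ×ˢ A).filter Q).card + ((B ×ˢ B).filter Q).card) := by
    refine le_trans (card_le_card ?_) ((card_union_le _ _).trans (add_le_add
      (card_union_le (A ×ˢ A) ((A ×ˢ B).filter Q))
      (card_union_le ((B ×ˢ A).filter Q) ((B ×ˢ B).filter Q))))
    intro p hp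
    have h1 : p.1 ∈ A ∪ B := by simp [hU]
    have h2 : p.2 ∈ A ∪ B := by simp [hU]
    simp only [mem_union, mem_filter, mem_product, mem_univ, true_and] at h1 h2 hp ⊢
    tauto
  have hsym : ((B ×ˢ A).filter Q).card = ((A ×ˢ B).filter Q).card := by
    refine card_nbij' Prod.swap Prod.swap ?_ ?_ (fun _ _ => rfl) (fun _ _ => rfl)
    · rintro ⟨u, v⟩; simp only [coe_filter, mem_product, Set.mem_ofPred_eq, hQ, Prod.swap]
      rw [pair_comm]; tauto
    · rintro ⟨u, v⟩; simp only [coe_filter, mem_product, Set.mem_ofPred_eq, hQ, Prod.swap]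
      rw [pair_comm]; tauto
  have hmiss := card_filter_add_card_filter_not (s := A ×ˢ B) Q
  have hB : A.card + B.card = n := by
    rw [← card_union_of_disjoint hAB, hU, card_univ, Fintype.card_fin]
  rw [card_product] at hmiss hsplit
  obtain ⟨d, hd⟩ : ∃ d, n = (k - 2) + A.card + d + 2 := ⟨n - (k - 2) - A.card - 2, by omega⟩
  have e1 : n - (k - 2) = A.card + d + 2 := by omega
  have e2 : A.card + d + 2 - A.card = d + 2 := by omega
  rw [e1, e2] at hdeg
  have c1 : ∀ m : ℕ, 2 * (m + 2).choose 2 = (m + 2) * (m + 1) := by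
    intro m; rw [Nat.choose_two_right, Nat.mul_div_cancel' (Nat.even_mul_pred_self _).two_dvd]; rfl
  have c2 := c1 (A.card + d)
  have c3 := c1 d
  obtain ⟨j, hj⟩ : ∃ j, k = j + 2 := ⟨k - 2, by omega⟩
  have hb : B.card = j + d + 2 := by omega
  have hn : n = j + A.card + d + 2 := by omega
  rw [hb] at hmiss
  have h3 : 2 * k * n = 2 * (j + 2) * (j + A.card + d + 2) := by rw [← hj, ← hn]
  rw [h3]
  change 2 * ((A ×ˢ B).filter fun p => ¬ Q p).card ≤ ((B ×ˢ B).filter Q).card + _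
  nlinarith

end Degree

section Image

variable {n : ℕ} {ι κ : Type*} [Fintype ι] [Fintype κ]

/-- The set of values of a finite family of vertices. -/
def im (x : ι → Fin n) : Finset (Fin n) := univ.image x

@[simp] lemma mem_im {x : ι → Fin n} {v : Fin n} : v ∈ im x ↔ ∃ i, x i = v := by simp [im]

lemma apply_mem_im (x : ι → Fin n) (i : ι) : x i ∈ im x := mem_im.2 ⟨i, rfl⟩

lemma im_comp_equiv (e : ι ≃ κ) (x : κ → Fin n) : im (x ∘ e) = im x := by
  ext v
  simp only [mem_im, Function.comp]
  exact e.exists_congr_left.trans (by simp)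

lemma im_sum (x : ι ⊕ κ → Fin n) : im x = im (x ∘ Sum.inl) ∪ im (x ∘ Sum.inr) := by
  ext v; simp

lemma card_im_le (x : ι → Fin n) : (im x).card ≤ Fintype.card ι := card_image_le

lemma card_im_iff {x : ι → Fin n} : (im x).card = Fintype.card ι ↔ Function.Injective x := by
  classical
  rw [im, ← card_univ, card_image_iff]; simp [Set.injOn_univ]

lemma im_comp_subset (x : ι → Fin n) (f : κ → ι) : im (x ∘ f) ⊆ im x := by
  intro v; simp only [mem_im]; rintro ⟨i, rfl⟩; exact ⟨f i, rfl⟩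

lemma im_subset {x : ι → Fin n} {W : Finset (Fin n)} : im x ⊆ W ↔ ∀ i, x i ∈ W := by
  constructor
  · exact fun h i => h (apply_mem_im x i)
  · intro h v hv; obtain ⟨i, rfl⟩ := mem_im.1 hv; exact h i

lemma injective_of_card {x : ι → Fin n} {R : Finset (Fin n)}
    (h : (R ∪ im x).card = R.card + Fintype.card ι) :
    Function.Injective x ∧ Disjoint R (im x) := by
  have h1 := card_union_add_card_inter R (im x)
  have h2 := card_im_le x
  refine ⟨card_im_iff.1 (by omega), ?_⟩
  rw [disjoint_iff_inter_eq_empty, ← card_eq_zero]; omega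

end Image

section Density

variable {n : ℕ}

/-- Normalised number of ways to extend `R` to an edge inside `B ∪ R`. -/
noncomputable def dB (k : ℕ) (E : Finset (Finset (Fin n))) (B R : Finset (Fin n)) : ℝ :=
  pr (Fin (k - R.card)) (fun x => (∀ i, x i ∈ B) ∧ R ∪ im x ∈ E)

variable {k : ℕ} {E : Finset (Finset (Fin n))} {A B R : Finset (Fin n)}

lemma dB_eq (ι : Type*) [Fintype ι] (h : Fintype.card ι + R.card = k) :
    pr ι (fun x => (∀ i, x i ∈ B) ∧ R ∪ im x ∈ E) = dB k E B R := by
  unfold dB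
  have e : ι ≃ Fin (k - R.card) := Fintype.equivFinOfCardEq (by omega)
  rw [← pr_equiv e]
  refine pr_congr fun x => ?_
  rw [im_comp_equiv]
  simp only [Function.comp]
  rw [e.forall_congr_left]
  simp

lemma dB_nonneg : 0 ≤ dB k E B R := pr_nonneg _

/-- Standing assumptions: a partition `A ∪ B` of the vertex set with `n = (k - ℓ)(2|A| + c)` and
the `(k-2)`-degree condition it is compared with. -/
structure Ctx (k ℓ c n : ℕ) (E : Finset (Finset (Fin n))) (A B : Finset (Fin n)) : Prop where
  hk : 3 ≤ k
  hl : 1 ≤ ℓ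
  hlk : 2 * ℓ < k
  unif : Uniform n k E
  disj : Disjoint A B
  cover : A ∪ B = univ
  hc : c = 1 ∨ c = 2
  hn : n = (k - ℓ) * (2 * A.card + c)
  hbig : 1000 * k ^ 3 ≤ n
  hdeg : ∀ S : Finset (Fin n), S.card = k - 2 →
    (n - (k - 2)).choose 2 + 1 + (if c = 2 ∧ ℓ = 1 then 1 else 0) ≤
      deg E S + (n - (k - 2) - A.card).choose 2

variable {ℓ c : ℕ}

namespace Ctx

variable (H : Ctx k ℓ c n E A B)
include H

lemma npos : 0 < n := lt_of_lt_of_le (by have := H.hk; positivity) H.hbig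

lemma nonempty : Nonempty (Fin n) := ⟨⟨0, H.npos⟩⟩

lemma four_mul_card_le : 4 * A.card ≤ n := by
  have h := H.hn
  have : 2 ≤ k - ℓ := by have := H.hl; have := H.hlk; omega
  nlinarith [Nat.mul_le_mul_right (2 * A.card + c) this]

lemma card_add : A.card + B.card = n := by
  rw [← card_union_of_disjoint H.disj, H.cover, card_univ, Fintype.card_fin]

lemma k_le : 1000 * k ≤ n := by
  have := H.hk
  have h : k * 1 ≤ k * k ^ 2 := Nat.mul_le_mul_left _ (Nat.one_le_pow _ _ (by omega))
  have := H.hbig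
  nlinarith

lemma le_card : n ≤ 4 * k * A.card := by
  have h := H.hn
  have h1 := H.k_le
  have h2 : (k - ℓ) * (2 * A.card + c) ≤ k * (2 * A.card + 2) :=
    Nat.mul_le_mul (Nat.sub_le _ _) (by rcases H.hc with h | h <;> omega)
  nlinarith

lemma missing_pairs {S : Finset (Fin n)} (hS : S.card = k - 2) :
    2 * ((A ×ˢ B).filter fun p => S ∪ {p.1, p.2} ∉ E).card ≤
      ((B ×ˢ B).filter fun p => S ∪ {p.1, p.2} ∈ E).card + 2 * k * n := by
  have := H.hk
  refine two_mul_missing_le H.unif (by omega) hS H.disj H.cover ?_ ?_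
  · have := H.k_le; have := H.four_mul_card_le; omega
  · have := H.hdeg S hS; omega

omit H in
lemma pr_two (P : Fin n → Fin n → Prop) :
    pr (Fin 2) (fun z : Fin 2 → Fin n => P (z 0) (z 1)) =
      ({p : Fin n × Fin n | P p.1 p.2}.ncard : ℝ) / n ^ 2 := by
  unfold pr
  simp only [Fintype.card_fin]
  congr 2
  exact Set.ncard_congr' ((finTwoArrowEquiv (Fin n)).subtypeEquiv (fun x => by simp))

lemma missing_pr {S : Finset (Fin n)} (hS : S.card = k - 2) :
    2 * pr (Fin 2) (fun z : Fin 2 → Fin n => z 0 ∈ A ∧ z 1 ∈ B ∧ S ∪ im z ∉ E) ≤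
      pr (Fin 2) (fun z : Fin 2 → Fin n => (∀ i, z i ∈ B) ∧ S ∪ im z ∈ E) + 2 * k / n := by
  classical
  have h2 : ∀ z : Fin 2 → Fin n, im z = {z 0, z 1} := by
    intro z; ext v; simp [eq_comm]
  simp only [h2, Fin.forall_fin_two]
  rw [pr_two (fun u v => u ∈ A ∧ v ∈ B ∧ S ∪ {u, v} ∉ E),
    pr_two (fun u v => (u ∈ B ∧ v ∈ B) ∧ S ∪ {u, v} ∈ E)]
  have hm := H.missing_pairs hS
  have hn : (0 : ℝ) < n := by exact_mod_cast H.npos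
  rw [← Set.ncard_coe_finset, ← Set.ncard_coe_finset] at hm
  simp only [coe_filter, mem_product, and_assoc] at hm ⊢
  have : (2 : ℝ) * k / n = 2 * k * n / n ^ 2 := by field_simp
  rw [this, ← add_div, ← mul_div_assoc]
  gcongr
  exact_mod_cast hm

end Ctx

end Density

section Missing

variable {k ℓ c n : ℕ} {E : Finset (Finset (Fin n))} {A B R : Finset (Fin n)}

lemma exists_sumEquiv {ι : Type*} [Fintype ι] (i₀ : ι) {j : ℕ} (h : Fintype.card ι = j + 2) :
    ∃ e : Fin j ⊕ Fin 2 ≃ ι, e (Sum.inr 0) = i₀ := by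
  classical
  have e0 : Fin j ⊕ Fin 2 ≃ ι := Fintype.equivOfCardEq (by simp [h])
  exact ⟨e0.trans (Equiv.swap (e0 (Sum.inr 0)) i₀), by simp⟩

namespace Ctx

variable (H : Ctx k ℓ c n E A B)
include H

lemma pr_degenerate_le (j : ℕ) (hj : j + R.card ≤ k) :
    pr (Fin j) (fun y : Fin j → Fin n => ¬ (Function.Injective y ∧ Disjoint R (im y))) ≤
      (k : ℝ) ^ 2 / n := by
  have := H.nonempty
  have h1 : pr (Fin j) (fun y : Fin j → Fin n => ¬ (Function.Injective y ∧ Disjoint R (im y))) ≤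
      pr (Fin j) (fun y : Fin j → Fin n => ¬ Function.Injective y ∨ ∃ i, y i ∈ R) := by
    refine pr_mono fun y hy => ?_
    by_contra! hc
    refine hy ⟨hc.1, disjoint_right.2 fun v hv => ?_⟩
    obtain ⟨i, rfl⟩ := mem_im.1 hv
    exact hc.2 i
  have h2 := pr_not_injective_le (V := Fin n) (ι := Fin j)
  have h3 := pr_exists_mem_le (ι := Fin j) R
  have h4 := pr_or (fun y : Fin j → Fin n => ¬ Function.Injective y) (fun y => ∃ i, y i ∈ R)
  simp only [Fintype.card_fin] at h2 h3
  have hn : (0 : ℝ) < n := by exact_mod_cast H.npos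
  calc _ ≤ (j : ℝ) ^ 2 * (1 / n) + j * (R.card / n) := by linarith
    _ = (j * (j + R.card)) / n := by ring
    _ ≤ (k : ℝ) ^ 2 / n := by
      have a1 : ((j : ℝ) + R.card) ≤ k := by exact_mod_cast hj
      have a2 : (j : ℝ) ≤ k := by exact_mod_cast (by omega : j ≤ k)
      rw [sq]
      gcongr

lemma missing_le {ι : Type*} [Fintype ι] (i₀ : ι) (hι : 2 ≤ Fintype.card ι)
    (hR : Fintype.card ι + R.card = k) :
    pr ι (fun x => x i₀ ∈ A ∧ (∀ i, i ≠ i₀ → x i ∈ B) ∧ R ∪ im x ∉ E) ≤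
      dB k E B R / 2 + 3 * k ^ 2 / n := by
  classical
  have := H.nonempty
  have hn : (0 : ℝ) < n := by exact_mod_cast H.npos
  obtain ⟨j, hj⟩ : ∃ j, Fintype.card ι = j + 2 := ⟨Fintype.card ι - 2, by omega⟩
  obtain ⟨e, he⟩ := exists_sumEquiv i₀ hj
  set P : (Fin j → Fin n) → (Fin 2 → Fin n) → Prop := fun y z =>
    (∀ i, y i ∈ B) ∧ z 0 ∈ A ∧ z 1 ∈ B ∧ (R ∪ im y) ∪ im z ∉ E with hP
  set Q : (Fin j → Fin n) → (Fin 2 → Fin n) → Prop := fun y z =>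
    (∀ i, y i ∈ B) ∧ (∀ i, z i ∈ B) ∧ (R ∪ im y) ∪ im z ∈ E with hQ
  have e1 : pr ι (fun x => x i₀ ∈ A ∧ (∀ i, i ≠ i₀ → x i ∈ B) ∧ R ∪ im x ∉ E) =
      pr (Fin j ⊕ Fin 2) (fun z : Fin j ⊕ Fin 2 → Fin n => P (z ∘ Sum.inl) (z ∘ Sum.inr)) := by
    rw [← pr_equiv e]
    refine pr_congr fun x => ?_
    simp only [hP]
    rw [← im_comp_equiv e x, im_sum, ← union_assoc, ← he]
    have : (∀ i, i ≠ e (Sum.inr 0) → x i ∈ B) ↔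
        (∀ i, x (e (Sum.inl i)) ∈ B) ∧ x (e (Sum.inr 1)) ∈ B := by
      rw [e.symm.forall_congr_left]
      simp [Sum.forall, Fin.forall_fin_two]
    rw [this]
    simp only [Function.comp]
    tauto
  have e2 : dB k E B R =
      pr (Fin j ⊕ Fin 2) (fun z : Fin j ⊕ Fin 2 → Fin n => Q (z ∘ Sum.inl) (z ∘ Sum.inr)) := by
    rw [← dB_eq (Fin j ⊕ Fin 2) (by simp; omega)]
    refine pr_congr fun x => ?_
    simp only [hQ]
    rw [im_sum, ← union_assoc]
    simp only [Sum.forall, Function.comp]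
    tauto
  set D : (Fin j → Fin n) → Prop := fun y => ¬ (Function.Injective y ∧ Disjoint R (im y)) with hD
  have hd := H.pr_degenerate_le (R := R) j (by omega)
  have key : ∀ y : Fin j → Fin n,
      2 * pr (Fin 2) (P y) ≤ pr (Fin 2) (Q y) + 2 * k / n + 2 * (if D y then 1 else 0) := by
    intro y
    have q0 := pr_nonneg (Q y)
    have q1 : (0 : ℝ) ≤ 2 * k / n := by positivity
    by_cases h : D y
    · have := pr_le_one (P y)
      simp only [h, if_true]; linarith
    · simp only [h, if_false]
      by_cases hy : ∀ i, y i ∈ B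
      · simp only [hD, not_not] at h
        have hc : (R ∪ im y).card = k - 2 := by
          rw [card_union_of_disjoint h.2, card_im_iff.2 h.1]; simp; omega
        have := H.missing_pr hc
        simp only [hP, hQ, hy, implies_true, true_and]
        linarith
      · have : pr (Fin 2) (P y) = 0 := by simp [hP, hy, pr]
        linarith
  have e3 : (∑ y : Fin j → Fin n, (if D y then (1 : ℝ) else 0)) / (n : ℝ) ^ j = pr (Fin j) D := by
    rw [pr, Finset.sum_boole, Set.ncard_eq_toFinset_card']
    simp
  have hs := Finset.sum_le_sum (s := univ) fun y _ => key y
  rw [e1, e2, pr_sum, pr_sum]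
  simp only [Fintype.card_fin]
  rw [← Finset.mul_sum, Finset.sum_add_distrib, Finset.sum_add_distrib, ← Finset.mul_sum,
    Finset.sum_const, card_univ, Fintype.card_fun, Fintype.card_fin, Fintype.card_fin,
    nsmul_eq_mul] at hs
  have hp : (0 : ℝ) < (n : ℝ) ^ j := by positivity
  have hs2 := div_le_div_of_nonneg_right hs hp.le
  rw [add_div, add_div, mul_div_assoc, mul_div_assoc 2 (∑ y, if D y then (1 : ℝ) else 0), e3, Nat.cast_pow,
    mul_div_cancel_left₀ _ hp.ne'] at hs2
  have hk2 : (k : ℝ) / n ≤ k ^ 2 / n := by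
    gcongr
    have : (1 : ℝ) ≤ k := by exact_mod_cast (by have := H.hk; omega)
    nlinarith
  have a1 : (2 : ℝ) * k / n = 2 * (k / n) := by ring
  have a2 : (3 : ℝ) * k ^ 2 / n = 3 * (k ^ 2 / n) := by ring
  rw [a1] at hs2
  rw [a2]
  have hp0 := pr_nonneg D
  linarith

end Ctx

end Missing

section Sizes

/-- The threshold below which an `s`-set is called light. -/
noncomputable def eps (τ : ℝ) (ℓ s : ℕ) : ℝ := τ * (τ / 8) ^ (ℓ - s)

/-- `R` has few extensions to an edge inside `B ∪ R`. -/
def Light {n : ℕ} (k ℓ : ℕ) (τ : ℝ) (E : Finset (Finset (Fin n))) (B R : Finset (Fin n)) : Prop :=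
  dB k E B R ≤ eps τ ℓ R.card

/-- The standing assumptions together with the hierarchy of constants. -/
structure Par (k ℓ c n : ℕ) (E : Finset (Finset (Fin n))) (A B : Finset (Fin n))
    (τ η ζ : ℝ) : Prop extends Ctx k ℓ c n E A B where
  hτ : 0 < τ
  hτ' : 64 * k * τ ≤ (1 / 2) ^ (2 * k)
  hη : 0 < η
  hη' : 100 * k * η ≤ eps τ ℓ 0
  hζ : 0 < ζ
  hζ' : 100 * k * ζ ≤ η * eps τ ℓ 0
  hdB : dB k E B ∅ ≤ ζ
  hnζ : 1000 * k ^ 3 ≤ ζ * n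

variable {k ℓ c n : ℕ} {E : Finset (Finset (Fin n))} {A B R : Finset (Fin n)} {τ η ζ : ℝ}

/-- Normalised number of non-edges formed by `v` and `k - 1` vertices of `B`. -/
noncomputable def nonB (k : ℕ) (E : Finset (Finset (Fin n))) (B : Finset (Fin n)) (v : Fin n) : ℝ :=
  pr (Fin (k - 1)) (fun x => (∀ i, x i ∈ B) ∧ {v} ∪ im x ∉ E)

open scoped Classical in
/-- The vertices `v` for which `{v}` is light. -/
noncomputable def Bs (k ℓ : ℕ) (τ : ℝ) (E : Finset (Finset (Fin n))) (B : Finset (Fin n)) :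
    Finset (Fin n) := univ.filter fun v => Light k ℓ τ E B {v}

open scoped Classical in
/-- The vertices forming an edge with almost all `(k-1)`-subsets of `B`. -/
noncomputable def As (k ℓ : ℕ) (τ : ℝ) (E : Finset (Finset (Fin n))) (B : Finset (Fin n)) :
    Finset (Fin n) := univ.filter fun v => ¬ Light k ℓ τ E B {v} ∧ nonB k E B v ≤ τ

lemma mem_Bs {v : Fin n} : v ∈ Bs k ℓ τ E B ↔ Light k ℓ τ E B {v} := by simp [Bs]

lemma mem_As {v : Fin n} :
    v ∈ As k ℓ τ E B ↔ ¬ Light k ℓ τ E B {v} ∧ nonB k E B v ≤ τ := by simp [As]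

lemma disjoint_As_Bs : Disjoint (As k ℓ τ E B) (Bs k ℓ τ E B) :=
  disjoint_left.2 fun _ h h' => (mem_As.1 h).1 (mem_Bs.1 h')

lemma Ctx.markov (H : Ctx k ℓ c n E A B) {ι : Type*} [Fintype ι]
    (hι : Fintype.card ι + R.card ≤ k) (β : ℝ) :
    pr ι (fun x => (∀ i, x i ∈ B) ∧ (R ∪ im x).card = R.card + Fintype.card ι ∧
      β < dB k E B (R ∪ im x)) * β ≤ dB k E B R := by
  classical
  have := H.nonempty
  rcases le_or_gt β 0 with hβ | hβ
  · exact (mul_nonpos_of_nonneg_of_nonpos (pr_nonneg _) hβ).trans dB_nonneg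
  set κ := Fin (k - R.card - Fintype.card ι) with hκ
  have h1 := pr_markov (ι := ι) (κ := κ) (V := Fin n)
    (fun x y => (∀ i, x i ∈ B) ∧ (∀ i, y i ∈ B) ∧ (R ∪ im x) ∪ im y ∈ E) β
  have h2 : pr (ι ⊕ κ) (fun z : ι ⊕ κ → Fin n => (∀ i, (z ∘ Sum.inl) i ∈ B) ∧
      (∀ i, (z ∘ Sum.inr) i ∈ B) ∧ (R ∪ im (z ∘ Sum.inl)) ∪ im (z ∘ Sum.inr) ∈ E) =
      dB k E B R := by
    rw [← dB_eq (ι ⊕ κ) (by simp [hκ]; omega)]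
    refine pr_congr fun x => ?_
    rw [im_sum, ← union_assoc]
    simp only [Sum.forall, Function.comp]
    tauto
  rw [h2] at h1
  refine le_trans ?_ h1
  gcongr
  refine pr_mono fun x hx => ?_
  obtain ⟨hx1, hx2, hx3⟩ := hx
  rw [← dB_eq κ (by simp [hκ, hx2]; omega)] at hx3
  simpa [hx1] using hx3

lemma pr_unit (W : Finset (Fin n)) :
    pr Unit (fun x : Unit → Fin n => x () ∈ W) = (W.card : ℝ) / n := by
  have := pr_pi (ι := Unit) (fun _ => W)
  rw [pr_congr (Q := fun x : Unit → Fin n => ∀ i, x i ∈ W) fun x => ⟨fun h _ => h, fun h => h ()⟩]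
  simpa using this

lemma im_unit (x : Unit → Fin n) : im x = {x ()} := by
  simp [im, univ_unique]

namespace Par

variable (H : Par k ℓ c n E A B τ η ζ)
include H

lemma npos' : (0 : ℝ) < n := by exact_mod_cast H.toCtx.npos

lemma k3 : (3 : ℝ) ≤ k := by exact_mod_cast H.hk

lemma τ_lt : τ < 1 / 64 := by
  have h1 := H.hτ'
  have h2 := H.k3
  have h3 : ((1 : ℝ) / 2) ^ (2 * k) ≤ 1 := pow_le_one₀ (by norm_num) (by norm_num)
  have := H.hτ
  nlinarith

lemma eps_pos (s : ℕ) : 0 < eps τ ℓ s := by have := H.hτ; unfold eps; positivity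

lemma eps_le (s : ℕ) : eps τ ℓ s ≤ τ := by
  have := H.hτ
  have := H.τ_lt
  unfold eps
  exact mul_le_of_le_one_right H.hτ.le (pow_le_one₀ (by positivity) (by linarith))

lemma eps_mono {s t : ℕ} (h : s ≤ t) : eps τ ℓ s ≤ eps τ ℓ t := by
  have := H.hτ
  have := H.τ_lt
  unfold eps
  gcongr ?_ * ?_
  exact pow_le_pow_of_le_one (by positivity) (by linarith) (by omega)

omit H in
lemma eps_self : eps τ ℓ ℓ = τ := by simp [eps]

lemma eps_pred {s t : ℕ} (h : s < t) (ht : t ≤ ℓ) : 8 * eps τ ℓ s ≤ τ * eps τ ℓ t := by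
  refine (mul_le_mul_of_nonneg_left (H.eps_mono (Nat.le_sub_one_of_lt h)) (by norm_num)).trans ?_
  unfold eps
  rw [show ℓ - (t - 1) = ℓ - t + 1 by omega, pow_succ]
  linarith

lemma empty_light : Light k ℓ τ E B ∅ := by
  unfold Light
  refine H.hdB.trans ?_
  simp only [card_empty]
  have h1 := H.hζ'; have h2 := H.hη'; have h3 := H.eps_pos 0; have h4 := H.k3
  have h5 := H.eps_le 0; have h6 := H.τ_lt; have := H.hζ; have := H.hη
  have : η ≤ 1 := by nlinarith
  nlinarith

lemma B_ge : 3 * (n : ℝ) ≤ 4 * B.card := by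
  have h1 := H.toCtx.card_add; have h2 := H.toCtx.four_mul_card_le
  exact_mod_cast (by omega : 3 * n ≤ 4 * B.card)

lemma dB_add_nonB (v : Fin n) : (1 / 2 : ℝ) ^ k ≤ dB k E B {v} + nonB k E B v := by
  have hn := H.npos'
  have h1 : ((B.card : ℝ) / n) ^ (k - 1) = pr (Fin (k - 1)) (fun x => ∀ i, x i ∈ B) := by
    rw [pr_pi (ι := Fin (k - 1)) (fun _ => B)]; simp [div_pow]
  have h2 : pr (Fin (k - 1)) (fun x => ∀ i, x i ∈ B) ≤ dB k E B {v} + nonB k E B v := by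
    rw [← dB_eq (Fin (k - 1)) (by simp; have := H.hk; omega)]
    refine le_trans (pr_mono fun x hx => ?_) (pr_or _ _)
    by_cases h : {v} ∪ im x ∈ E
    · exact Or.inl ⟨hx, h⟩
    · exact Or.inr ⟨hx, h⟩
  refine le_trans ?_ h2
  rw [← h1]
  have h3 : (1 / 2 : ℝ) ≤ B.card / n := by
    rw [le_div_iff₀ hn]; have := H.B_ge; linarith
  calc (1 / 2 : ℝ) ^ k ≤ (1 / 2) ^ (k - 1) :=
        pow_le_pow_of_le_one (by norm_num) (by norm_num) (by omega)
    _ ≤ _ := by gcongr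

lemma card_B_diff : 100 * k * ((B \ Bs k ℓ τ E B).card : ℝ) ≤ η * n := by
  have hn := H.npos'
  have h1 := H.toCtx.markov (R := ∅) (ι := Unit) (by simp; have := H.hk; omega) (eps τ ℓ 1)
  have h2 : pr Unit (fun x : Unit → Fin n => x () ∈ B \ Bs k ℓ τ E B) ≤
      pr Unit (fun x : Unit → Fin n => (∀ i, x i ∈ B) ∧
        (∅ ∪ im x).card = (∅ : Finset (Fin n)).card + Fintype.card Unit ∧
        eps τ ℓ 1 < dB k E B (∅ ∪ im x)) := by
    refine pr_mono fun x hx => ?_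
    have hi := im_unit x
    simp only [mem_sdiff, mem_Bs, Light, not_le, card_singleton] at hx
    exact ⟨fun _ => hx.1, by simp [hi], by simpa [hi] using hx.2⟩
  rw [pr_unit] at h2
  have h3 : ((B \ Bs k ℓ τ E B).card : ℝ) / n * eps τ ℓ 0 ≤ ζ := by
    refine le_trans ?_ (h1.trans H.hdB)
    gcongr
    · exact (H.eps_pos 0).le
    · exact pr_nonneg _
    · exact H.eps_mono (Nat.zero_le 1)
  rw [div_mul_eq_mul_div, div_le_iff₀ hn] at h3
  have h4 := H.hζ'
  have h5 := H.eps_pos 0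
  refine le_of_mul_le_mul_right ?_ h5
  have : 100 * (k : ℝ) * (((B \ Bs k ℓ τ E B).card : ℝ) * eps τ ℓ 0) ≤ 100 * k * (ζ * n) := by
    gcongr
  nlinarith

lemma three_le : 3 * (k : ℝ) ^ 2 / n ≤ ζ / 2 := by
  have hn := H.npos'
  have := H.hnζ
  have h3 := H.k3
  rw [div_le_iff₀ hn]
  nlinarith [sq_nonneg (k : ℝ)]

lemma card_A_diff : 100 * k * ((A \ As k ℓ τ E B).card : ℝ) ≤ η * n := by
  classical
  have hn := H.npos'
  have := H.toCtx.nonempty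
  have hτ := H.hτ
  have h1 := pr_markov (ι := Unit) (κ := Fin (k - 1)) (V := Fin n)
    (fun x y => x () ∈ A ∧ (∀ i, y i ∈ B) ∧ im x ∪ im y ∉ E) τ
  have h2 := H.toCtx.missing_le (R := ∅) (ι := Unit ⊕ Fin (k - 1)) (Sum.inl ())
    (by simp; have := H.hk; omega) (by simp; have := H.hk; omega)
  have h3 : pr Unit (fun x : Unit → Fin n => x () ∈ A \ As k ℓ τ E B) ≤
      pr Unit (fun x : Unit → Fin n => τ < pr (Fin (k - 1))
        (fun y => x () ∈ A ∧ (∀ i, y i ∈ B) ∧ im x ∪ im y ∉ E)) := by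
    refine pr_mono fun x hx => ?_
    have hi := im_unit x
    simp only [mem_sdiff, mem_As, not_and, not_le] at hx
    simp only [hi, hx.1, true_and]
    change τ < nonB k E B (x ())
    by_contra! hc
    have hl : Light k ℓ τ E B {x ()} := by
      by_contra hl
      exact absurd hc (not_le.2 (hx.2 hl))
    have h5 := H.dB_add_nonB (x ())
    have h6 : dB k E B {x ()} ≤ τ := hl.trans (H.eps_le _)
    have h7 := H.hτ'
    have h8 : (1 / 2 : ℝ) ^ (2 * k) ≤ (1 / 2) ^ k :=
      pow_le_pow_of_le_one (by norm_num) (by norm_num) (by omega)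
    have := H.k3
    nlinarith
  rw [pr_unit] at h3
  have h4 : ((A \ As k ℓ τ E B).card : ℝ) / n * τ ≤ ζ := by
    refine (mul_le_mul_of_nonneg_right h3 hτ.le).trans (h1.trans ?_)
    refine le_trans (pr_mono fun z hz => ?_) (h2.trans ?_)
    · refine ⟨hz.1, ?_, ?_⟩
      · rintro (i | i) hi
        · exact absurd rfl hi
        · exact hz.2.1 i
      · rw [im_sum, empty_union]; exact hz.2.2
    · have := H.three_le
      have := H.hdB
      linarith
  rw [div_mul_eq_mul_div, div_le_iff₀ hn] at h4
  have h6 := H.hζ'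
  have h5 := H.eps_pos 0
  have h7 := H.eps_le 0
  refine le_of_mul_le_mul_right ?_ h5
  have : 100 * (k : ℝ) * (((A \ As k ℓ τ E B).card : ℝ) * eps τ ℓ 0) ≤ 100 * k * (ζ * n) := by
    refine mul_le_mul_of_nonneg_left (le_trans ?_ h4) (by positivity)
    gcongr
  nlinarith

lemma B_sdiff_subset : Bs k ℓ τ E B \ B ⊆ A \ As k ℓ τ E B := by
  intro v hv
  simp only [mem_sdiff] at hv ⊢
  have h1 : v ∈ A ∪ B := by simp [H.cover]
  refine ⟨(mem_union.1 h1).resolve_right hv.2, fun h => disjoint_left.1 disjoint_As_Bs h hv.1⟩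

lemma A_sdiff_subset : As k ℓ τ E B \ A ⊆ B \ Bs k ℓ τ E B := by
  intro v hv
  simp only [mem_sdiff] at hv ⊢
  have h1 : v ∈ A ∪ B := by simp [H.cover]
  refine ⟨(mem_union.1 h1).resolve_left hv.2, fun h => disjoint_left.1 disjoint_As_Bs hv.1 h⟩

end Par

end Sizes

section Gadgets

variable {k ℓ c n : ℕ} {E : Finset (Finset (Fin n))} {A B R : Finset (Fin n)} {τ η ζ : ℝ}

/-- A light `ℓ`-set of vertices of `Bs`. -/
structure IsEnd (k ℓ : ℕ) (τ : ℝ) (E : Finset (Finset (Fin n))) (B L : Finset (Fin n)) : Prop where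
  card : L.card = ℓ
  light : Light k ℓ τ E B L
  sub : L ⊆ Bs k ℓ τ E B

namespace Par

variable (H : Par k ℓ c n E A B τ η ζ)
include H

lemma ζ_le : 300 * ζ ≤ eps τ ℓ 0 := by
  have h1 := H.hζ'; have h2 := H.hη'; have h3 := H.eps_pos 0; have h4 := H.k3
  have h5 := H.eps_le 0; have h6 := H.τ_lt; have := H.hζ; have := H.hη
  have : η ≤ 1 := by nlinarith
  nlinarith

lemma pr_hit_le {ι : Type*} [Fintype ι] (hι : Fintype.card ι ≤ 2 * k) {W : Finset (Fin n)}
    (hW : (W.card : ℝ) ≤ η * n) :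
    pr ι (fun x => ∃ i, x i ∈ W ∪ ((B \ Bs k ℓ τ E B) ∪ (A \ As k ℓ τ E B))) ≤
      eps τ ℓ 0 / 20 := by
  classical
  have := H.toCtx.nonempty
  have hn := H.npos'
  refine (pr_exists_mem_le _).trans ?_
  rw [Fintype.card_fin]
  have h1 : ((W ∪ ((B \ Bs k ℓ τ E B) ∪ (A \ As k ℓ τ E B))).card : ℝ) ≤
      W.card + ((B \ Bs k ℓ τ E B).card + (A \ As k ℓ τ E B).card) := by
    exact_mod_cast (card_union_le _ _).trans (add_le_add_right (card_union_le _ _) _)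
  have h2 := H.card_B_diff
  have h3 := H.card_A_diff
  have h4 := H.k3
  have h5 : ((W ∪ ((B \ Bs k ℓ τ E B) ∪ (A \ As k ℓ τ E B))).card : ℝ) ≤ 2 * (η * n) := by
    have : 0 < η * n := mul_pos H.hη hn
    nlinarith
  have h6 : (Fintype.card ι : ℝ) ≤ 2 * k := by exact_mod_cast hι
  calc _ ≤ (2 * k : ℝ) * (2 * (η * n) / n) := by gcongr
    _ = 4 * k * η := by field_simp; ring
    _ ≤ _ := by have := H.hη'; have := H.eps_pos 0; linarith

lemma pr_heavy_le {ι κ : Type*} [Fintype ι] [Fintype κ] (f : κ → ι) (hf : Function.Injective f)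
    (hR : Light k ℓ τ E B R) (hκ : R.card + Fintype.card κ = ℓ) {s : ℕ} (hs : R.card < s)
    (hsl : s ≤ ℓ) :
    pr ι (fun x => (∀ i, x i ∈ B) ∧ (R ∪ im (x ∘ f)).card = ℓ ∧
      ¬ Light k ℓ τ E B (R ∪ im (x ∘ f))) ≤ eps τ ℓ s / 8 := by
  classical
  have := H.toCtx.nonempty
  have h1 := H.toCtx.markov (R := R) (ι := κ) (by have := H.hlk; omega) τ
  have h2 : pr ι (fun x => (∀ i, x i ∈ B) ∧ (R ∪ im (x ∘ f)).card = ℓ ∧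
      ¬ Light k ℓ τ E B (R ∪ im (x ∘ f))) ≤
      pr κ (fun x => (∀ i, x i ∈ B) ∧ (R ∪ im x).card = R.card + Fintype.card κ ∧
      τ < dB k E B (R ∪ im x)) := by
    rw [← pr_comp f hf]
    refine pr_mono fun x hx => ⟨fun i => hx.1 _, by rw [hx.2.1, hκ], ?_⟩
    have := hx.2.2
    rw [Light, not_le, hx.2.1, eps_self] at this
    exact this
  have hτ := H.hτ
  have h3 := H.eps_pred hs hsl
  have h4 : dB k E B R ≤ eps τ ℓ R.card := hR
  refine h2.trans (le_of_mul_le_mul_right ?_ hτ)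
  linarith

lemma exists_edge {s : ℕ} (hRs : R.card = s) (hsl : s ≤ ℓ)
    (hR : ¬ Light k ℓ τ E B R) {R₀ R₁ : Finset (Fin n)} (h₀ : R₀ ⊆ R) (h₁ : R₁ ⊆ R)
    (hd : Disjoint R₀ R₁) (hl₀ : Light k ℓ τ E B R₀) (hl₁ : Light k ℓ τ E B R₁)
    (hc₀ : R₀.card < s) (hc₁ : R₁.card < s) (hb₀ : R₀ ⊆ Bs k ℓ τ E B) (hb₁ : R₁ ⊆ Bs k ℓ τ E B)
    (hk : s + 2 * ℓ ≤ k + (R₀.card + R₁.card)) {W : Finset (Fin n)} (hW : (W.card : ℝ) ≤ η * n) :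
    ∃ e ∈ E, ∃ L₀ L₁, R ⊆ e ∧ e \ R ⊆ Bs k ℓ τ E B ∧ Disjoint (e \ R) W ∧ L₀ ⊆ e ∧ L₁ ⊆ e ∧
      Disjoint L₀ L₁ ∧ IsEnd k ℓ τ E B L₀ ∧ IsEnd k ℓ τ E B L₁ := by
  classical
  set p := ℓ - R₀.card with hp
  set q := ℓ - R₁.card with hq
  set ι := Fin p ⊕ (Fin q ⊕ Fin (k - s - p - q)) with hι
  have hcard : Fintype.card ι + R.card = k := by simp [hι]; omega
  set f₀ : Fin p → ι := Sum.inl with hf₀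
  set f₁ : Fin q → ι := Sum.inr ∘ Sum.inl with hf₁
  have hi₀ : Function.Injective f₀ := Sum.inl_injective
  have hi₁ : Function.Injective f₁ := Sum.inr_injective.comp Sum.inl_injective
  set W' := W ∪ ((B \ Bs k ℓ τ E B) ∪ (A \ As k ℓ τ E B)) with hW'
  have b0 := H.pr_hit_le (ι := ι) (by omega) hW
  have b1 := H.pr_heavy_le (ι := ι) f₀ hi₀ hl₀ (by simp; omega) hc₀ hsl
  have b2 := H.pr_heavy_le (ι := ι) f₁ hi₁ hl₁ (by simp; omega) hc₁ hsl
  have g : eps τ ℓ s < dB k E B R := by rw [← hRs]; exact not_le.1 hR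
  rw [← dB_eq ι hcard] at g
  have hm := H.eps_mono (Nat.zero_le s)
  have hpos := H.eps_pos s
  obtain ⟨x, ⟨hxB, hxE⟩, hx⟩ := exists_of_pr_lt (lt_of_le_of_lt ((pr_or _ _).trans
    (add_le_add b0 ((pr_or _ _).trans (add_le_add b1 b2)))) (lt_trans (by linarith) g))
  simp only [not_or, not_exists, not_and, not_not] at hx
  obtain ⟨hx0, hx1, hx2⟩ := hx
  have hinj := injective_of_card (x := x) (R := R) (by rw [H.unif _ hxE]; omega)
  have hBs : ∀ i, x i ∈ Bs k ℓ τ E B ∧ x i ∉ W := by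
    intro i
    have h1 := hx0 i
    have h2 := hxB i
    simp only [mem_union, mem_sdiff, not_or, not_and, not_not] at h1
    exact ⟨h1.2.1 h2, h1.1⟩
  have hRd : ∀ i, x i ∉ R := fun i h => disjoint_left.1 hinj.2 h (apply_mem_im x i)
  have card_aux : ∀ {j : ℕ} (f : Fin j → ι) (_ : Function.Injective f) (S : Finset (Fin n)),
      S ⊆ R → S.card + j = ℓ → (S ∪ im (x ∘ f)).card = ℓ := by
    intro j f hf S hS hj
    rw [card_union_of_disjoint, card_im_iff.2 (hinj.1.comp hf)]
    · simpa using hj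
    · exact hinj.2.mono hS (im_comp_subset x f)
  have hk0 := card_aux f₀ hi₀ R₀ h₀ (by omega)
  have hk1 := card_aux f₁ hi₁ R₁ h₁ (by omega)
  have hsub : ∀ {j : ℕ} (f : Fin j → ι), im (x ∘ f) ⊆ Bs k ℓ τ E B := by
    intro j f
    rw [im_subset]; exact fun i => (hBs _).1
  have hsd : (R ∪ im x) \ R = im x := union_sdiff_cancel_left hinj.2
  refine ⟨R ∪ im x, hxE, R₀ ∪ im (x ∘ f₀), R₁ ∪ im (x ∘ f₁), subset_union_left, ?_, ?_,
    union_subset_union h₀ (im_comp_subset _ _), union_subset_union h₁ (im_comp_subset _ _), ?_,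
    ⟨hk0, hx1 hxB hk0, union_subset hb₀ (hsub _)⟩, ⟨hk1, hx2 hxB hk1, union_subset hb₁ (hsub _)⟩⟩
  · rw [hsd, im_subset]; exact fun i => (hBs i).1
  · rw [hsd]
    refine disjoint_left.2 fun v hv => ?_
    obtain ⟨i, rfl⟩ := mem_im.1 hv
    exact (hBs i).2
  · simp only [disjoint_union_left, disjoint_union_right]
    refine ⟨⟨hd, ?_⟩, ?_, ?_⟩
    · exact hinj.2.symm.mono (im_comp_subset _ _) h₁
    · exact hinj.2.mono h₀ (im_comp_subset _ _)
    · refine disjoint_left.2 fun v hv hv' => ?_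
      obtain ⟨i, rfl⟩ := mem_im.1 hv
      obtain ⟨j, hj⟩ := mem_im.1 hv'
      have := hinj.1 hj
      simp [hf₀, hf₁] at this

lemma k_sq_div_le : (k : ℝ) ^ 2 / n ≤ ζ / 6 := by
  have := H.three_le
  rw [mul_div_assoc] at this
  linarith

lemma exists_cherry (h1 : 1 ≤ R.card) (hsl : R.card ≤ ℓ) (hR : ¬ Light k ℓ τ E B R)
    {W : Finset (Fin n)} (hW : (W.card : ℝ) ≤ η * n) :
    ∃ K T₀ T₁ L₀ L₁ : Finset (Fin n), R ⊆ K ∧ K.card = ℓ ∧ K \ R ⊆ Bs k ℓ τ E B ∧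
      Disjoint (K \ R) W ∧ K ∪ T₀ ∈ E ∧ K ∪ T₁ ∈ E ∧ Disjoint K T₀ ∧ Disjoint K T₁ ∧
      Disjoint T₀ T₁ ∧ T₀ ⊆ Bs k ℓ τ E B ∧ T₁ ⊆ Bs k ℓ τ E B ∧ Disjoint T₀ W ∧ Disjoint T₁ W ∧
      L₀ ⊆ T₀ ∧ L₁ ⊆ T₁ ∧ IsEnd k ℓ τ E B L₀ ∧ IsEnd k ℓ τ E B L₁ := by
  classical
  have := H.toCtx.nonempty
  have hn := H.npos'
  have hlk := H.hlk
  set ι := Fin (ℓ - R.card) with hι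
  set κ := Fin ℓ ⊕ Fin (k - 2 * ℓ) with hκ
  have hcard : Fintype.card (ι ⊕ κ) + R.card = k := by simp [hι, hκ]; omega
  set f : Fin ℓ → ι ⊕ κ := Sum.inr ∘ Sum.inl with hf
  have hfi : Function.Injective f := Sum.inr_injective.comp Sum.inl_injective
  have b0 := H.pr_hit_le (ι := ι ⊕ κ) (by omega) hW
  have b1 := H.pr_heavy_le (ι := ι ⊕ κ) f hfi H.empty_light (by simp) (s := R.card)
    (by rw [card_empty]; omega) hsl
  have g : eps τ ℓ R.card < dB k E B R := not_le.1 hR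
  rw [← dB_eq (ι ⊕ κ) hcard] at g
  have hm := H.eps_mono (Nat.zero_le R.card)
  have hpos := H.eps_pos R.card
  have b := (pr_or _ _).trans (add_le_add b0 b1)
  have g2 := pr_sub_le (V := Fin n) (ι := ι ⊕ κ) (fun x => (∀ i, x i ∈ B) ∧ R ∪ im x ∈ E)
    (fun x => (∃ i, x i ∈ W ∪ ((B \ Bs k ℓ τ E B) ∪ (A \ As k ℓ τ E B))) ∨
      ((∀ i, x i ∈ B) ∧ (∅ ∪ im (x ∘ f)).card = ℓ ∧ ¬ Light k ℓ τ E B (∅ ∪ im (x ∘ f))))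
  set G : (ι → Fin n) → (κ → Fin n) → Prop := fun u t =>
    R ∪ im u ∪ im t ∈ E ∧ (∀ i, u i ∈ Bs k ℓ τ E B \ W) ∧ (∀ i, t i ∈ Bs k ℓ τ E B \ W) ∧
      IsEnd k ℓ τ E B (im (t ∘ Sum.inl)) with hG
  have g3 : eps τ ℓ R.card / 2 ≤ pr (ι ⊕ κ)
      (fun z : ι ⊕ κ → Fin n => G (z ∘ Sum.inl) (z ∘ Sum.inr)) := by
    refine le_trans (by linarith) (g2.trans (pr_mono fun x hx => ?_))
    obtain ⟨⟨hxB, hxE⟩, hx⟩ := hx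
    simp only [not_or, not_exists, not_and, not_not] at hx
    obtain ⟨hx0, hx1⟩ := hx
    have hinj := injective_of_card (x := x) (R := R) (by rw [H.unif _ hxE]; omega)
    have hBs : ∀ i, x i ∈ Bs k ℓ τ E B \ W := by
      intro i
      have h1 := hx0 i
      have h2 := hxB i
      simp only [mem_union, mem_sdiff, not_or, not_and, not_not] at h1 ⊢
      exact ⟨h1.2.1 h2, h1.1⟩
    have hcf : (im (x ∘ f)).card = ℓ := by
      rw [card_im_iff.2 (hinj.1.comp hfi)]; simp
    rw [empty_union] at hx1
    refine ⟨by rw [union_assoc, ← im_sum]; exact hxE, fun i => hBs _, fun i => hBs _,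
      hcf, hx1 hxB hcf, ?_⟩
    rw [im_subset]
    exact fun i => (mem_sdiff.1 (hBs _)).1
  obtain ⟨u, hu⟩ := exists_le_pr_of_sum G
  have g4 := g3.trans hu
  obtain ⟨t₀, ht₀⟩ : ∃ t, G u t := by
    by_contra! hc
    have : pr κ (G u) = 0 := by simp [pr, hc]
    linarith
  obtain ⟨t₁, ht₁, hd⟩ : ∃ t, G u t ∧ ¬ ∃ i, t i ∈ im t₀ := by
    refine exists_of_pr_lt (lt_of_le_of_lt (pr_exists_mem_le _) (lt_of_lt_of_le ?_ g4))
    have c1 : (Fintype.card κ : ℝ) ≤ k := by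
      exact_mod_cast (by simp [hκ]; omega : Fintype.card κ ≤ k)
    have c2 : ((im t₀).card : ℝ) ≤ k := le_trans (by exact_mod_cast card_im_le t₀) c1
    rw [Fintype.card_fin]
    calc _ ≤ (k : ℝ) * (k / n) := by gcongr
      _ = (k : ℝ) ^ 2 / n := by ring
      _ ≤ ζ / 6 := H.k_sq_div_le
      _ < _ := by have := H.ζ_le; have := H.hζ; linarith
  have split : ∀ t, G u t → (R ∪ im u).card = ℓ ∧ Disjoint (R ∪ im u) (im t) ∧
      Disjoint R (im u) := by
    intro t ht
    have h2 := H.unif _ ht.1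
    have h3 := card_union_add_card_inter (R ∪ im u) (im t)
    have h4 := card_union_add_card_inter R (im u)
    have h5 := card_im_le t
    have h6 := card_im_le u
    simp only [hι, hκ, Fintype.card_sum, Fintype.card_fin] at h5 h6
    refine ⟨by omega, ?_, ?_⟩
    · rw [disjoint_iff_inter_eq_empty, ← card_eq_zero]; omega
    · rw [disjoint_iff_inter_eq_empty, ← card_eq_zero]; omega
  obtain ⟨s1, s2, s3⟩ := split t₀ ht₀
  obtain ⟨-, s4, -⟩ := split t₁ ht₁
  have sub : ∀ {α : Type} [Fintype α] (y : α → Fin n), (∀ i, y i ∈ Bs k ℓ τ E B \ W) →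
      im y ⊆ Bs k ℓ τ E B ∧ Disjoint (im y) W := by
    intro α _ y hy
    refine ⟨im_subset.2 fun i => (mem_sdiff.1 (hy i)).1, disjoint_left.2 fun v hv => ?_⟩
    obtain ⟨i, rfl⟩ := mem_im.1 hv
    exact (mem_sdiff.1 (hy i)).2
  have hsd : (R ∪ im u) \ R = im u := union_sdiff_cancel_left s3
  refine ⟨R ∪ im u, im t₀, im t₁, im (t₀ ∘ Sum.inl), im (t₁ ∘ Sum.inl), subset_union_left, s1,
    ?_, ?_, ht₀.1, ht₁.1, s2, s4, ?_, (sub t₀ ht₀.2.2.1).1, (sub t₁ ht₁.2.2.1).1,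
    (sub t₀ ht₀.2.2.1).2, (sub t₁ ht₁.2.2.1).2, im_comp_subset _ _, im_comp_subset _ _,
    ht₀.2.2.2, ht₁.2.2.2⟩
  · rw [hsd]; exact (sub u ht₀.2.1).1
  · rw [hsd]; exact (sub u ht₀.2.1).2
  · refine disjoint_left.2 fun v hv hv' => hd ?_
    obtain ⟨i, rfl⟩ := mem_im.1 hv'
    exact ⟨i, hv⟩

end Par

end Gadgets

section Connector

variable {k ℓ c n : ℕ} {E : Finset (Finset (Fin n))} {A B R : Finset (Fin n)} {τ η ζ : ℝ}

namespace Par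

variable (H : Par k ℓ c n E A B τ η ζ)
include H

lemma pr_AB_ge {κ : Type*} [Fintype κ] (hκ : Fintype.card κ ≤ 2 * k) :
    16 * τ ≤ pr (Unit ⊕ κ)
      (fun x : Unit ⊕ κ → Fin n => x (Sum.inl ()) ∈ A ∧ ∀ i, x (Sum.inr i) ∈ B) := by
  have hn := H.npos'
  have h1 := pr_pi (ι := Unit ⊕ κ) (V := Fin n) (Sum.elim (fun _ => A) (fun _ => B))
  have h2 : pr (Unit ⊕ κ)
      (fun x : Unit ⊕ κ → Fin n => x (Sum.inl ()) ∈ A ∧ ∀ i, x (Sum.inr i) ∈ B) =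
      ((A.card : ℝ) / n) * ((B.card : ℝ) / n) ^ Fintype.card κ := by
    rw [pr_congr (Q := fun x : Unit ⊕ κ → Fin n =>
      ∀ i, x i ∈ (Sum.elim (fun _ => A) (fun _ => B) : Unit ⊕ κ → Finset (Fin n)) i) ?_, h1]
    · simp [Fintype.prod_sum_type]
      rw [pow_add, div_pow]
      field_simp
    · intro x
      exact ⟨fun h => by rintro (⟨⟩ | i); exacts [h.1, h.2 i],
        fun h => ⟨h (.inl ()), fun i => h (.inr i)⟩⟩
  rw [h2]
  have h3 : (1 / 2 : ℝ) ≤ B.card / n := by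
    rw [le_div_iff₀ hn]; have := H.B_ge; linarith
  have hk := H.k3
  have h4 : 1 / (4 * k : ℝ) ≤ A.card / n := by
    rw [div_le_div_iff₀ (by positivity) hn]
    have : (n : ℝ) ≤ 4 * k * A.card := by exact_mod_cast H.toCtx.le_card
    linarith
  calc 16 * τ = 1 / (4 * k : ℝ) * (64 * k * τ) := by field_simp; ring
    _ ≤ 1 / (4 * k : ℝ) * (1 / 2) ^ (2 * k) := by gcongr; exact H.hτ'
    _ ≤ (A.card / n) * (1 / 2) ^ Fintype.card κ := by
      gcongr ?_ * ?_
      exact pow_le_pow_of_le_one (by norm_num) (by norm_num) hκ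
    _ ≤ _ := by gcongr

lemma exists_connector {L₀ L₁ W : Finset (Fin n)} (hL₀ : IsEnd k ℓ τ E B L₀)
    (hL₁ : IsEnd k ℓ τ E B L₁) (hW : (W.card : ℝ) ≤ η * n) :
    ∃ (a : Fin n) (K X Y : Finset (Fin n)), a ∈ As k ℓ τ E B ∧ a ∈ K ∧ K.card = ℓ ∧
      K.erase a ⊆ Bs k ℓ τ E B ∧ X ⊆ Bs k ℓ τ E B ∧ Y ⊆ Bs k ℓ τ E B ∧
      Disjoint K W ∧ Disjoint X W ∧ Disjoint Y W ∧ Disjoint K X ∧ Disjoint K Y ∧ Disjoint X Y ∧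
      L₀ ∪ (K ∪ X) ∈ E ∧ L₁ ∪ (K ∪ Y) ∈ E := by
  classical
  have := H.toCtx.nonempty
  have hn := H.npos'
  have hlk := H.hlk
  have hl := H.hl
  set κ := Fin (ℓ - 1) ⊕ (Fin (k - 2 * ℓ) ⊕ Fin (k - 2 * ℓ)) with hκ
  set ι₀ := Unit ⊕ (Fin (ℓ - 1) ⊕ Fin (k - 2 * ℓ)) with hι₀
  set ι := Unit ⊕ κ with hι
  have hcκ : Fintype.card κ + 1 ≤ 2 * k := by simp [hκ]; omega
  have hcι : Fintype.card ι ≤ 2 * k := by simp only [hι, Fintype.card_sum, Fintype.card_unit]; omega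
  have hc₀ : Fintype.card ι₀ + ℓ = k := by simp [hι₀]; omega
  set fX : ι₀ → ι := Sum.map id (Sum.map id Sum.inl) with hfX
  set fY : ι₀ → ι := Sum.map id (Sum.map id Sum.inr) with hfY
  have hiX : Function.Injective fX :=
    Function.injective_id.sumMap (Function.injective_id.sumMap Sum.inl_injective)
  have hiY : Function.Injective fY :=
    Function.injective_id.sumMap (Function.injective_id.sumMap Sum.inr_injective)
  have g := H.pr_AB_ge (κ := κ) (by omega)
  have b0 := H.pr_hit_le (ι := ι) hcι hW
  have b1 := pr_not_injective_le (V := Fin n) (ι := ι)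
  have mis : ∀ (f : ι₀ → ι) (_ : Function.Injective f) (L : Finset (Fin n)),
      IsEnd k ℓ τ E B L → pr ι (fun x => x (f (Sum.inl ())) ∈ A ∧
        (∀ i, i ≠ Sum.inl () → x (f i) ∈ B) ∧ L ∪ im (x ∘ f) ∉ E) ≤ τ := by
    intro f hf L hL
    have h1 := H.toCtx.missing_le (R := L) (ι := ι₀) (Sum.inl ()) (by omega)
      (by rw [hL.card]; exact hc₀)
    have h2 : dB k E B L ≤ eps τ ℓ L.card := hL.light
    rw [hL.card, eps_self] at h2
    rw [← pr_comp f hf] at h1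
    have := H.three_le
    have := H.ζ_le
    have := H.eps_le 0
    have := H.hζ
    exact le_trans h1 (by linarith)
  have b2 := mis fX hiX L₀ hL₀
  have b3 := mis fY hiY L₁ hL₁
  have b1' : (Fintype.card ι : ℝ) ^ 2 * (1 / (Fintype.card (Fin n) : ℝ)) ≤ ζ := by
    have c1 : (Fintype.card ι : ℝ) ≤ 2 * k := by exact_mod_cast hcι
    rw [Fintype.card_fin]
    calc _ ≤ (2 * k : ℝ) ^ 2 * (1 / n) := by gcongr
      _ = 4 * ((k : ℝ) ^ 2 / n) := by ring
      _ ≤ ζ := by have := H.k_sq_div_le; have := H.hζ; linarith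
  have b := (pr_or _ _).trans (add_le_add b0 ((pr_or _ _).trans
    (add_le_add b1 ((pr_or _ _).trans (add_le_add b2 b3)))))
  obtain ⟨x, ⟨hxA, hxB⟩, hx⟩ := exists_of_pr_lt (lt_of_le_of_lt b (lt_of_lt_of_le (by
    have := H.ζ_le
    have := H.eps_le 0
    have := H.hζ
    have := H.hτ
    linarith) g))
  simp only [not_or, not_exists, not_not, not_and] at hx
  obtain ⟨hx0, hinj, hx1, hx2⟩ := hx
  have e1 := hx1 hxA (by
    rintro (i | i | i) h
    · exact absurd rfl h
    · exact hxB _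
    · exact hxB _)
  have e2 := hx2 hxA (by
    rintro (i | i | i) h
    · exact absurd rfl h
    · exact hxB _
    · exact hxB _)
  have hW' : ∀ i, x i ∉ W := fun i h => hx0 i (mem_union_left _ h)
  have hBs : ∀ i, x (Sum.inr i) ∈ Bs k ℓ τ E B := by
    intro i
    have h1 := hx0 (Sum.inr i)
    simp only [mem_union, mem_sdiff, not_or, not_and, not_not] at h1
    exact h1.2.1 (hxB i)
  have hAs : x (Sum.inl ()) ∈ As k ℓ τ E B := by
    have h1 := hx0 (Sum.inl ())
    simp only [mem_union, mem_sdiff, not_or, not_and, not_not] at h1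
    exact h1.2.2 hxA
  set fK : Unit ⊕ Fin (ℓ - 1) → ι := Sum.map id Sum.inl with hfK
  have hiK : Function.Injective fK := Function.injective_id.sumMap Sum.inl_injective
  have imdisj : ∀ {α β : Type} [Fintype α] [Fintype β] (f : α → ι) (f' : β → ι),
      (∀ a b, f a ≠ f' b) → Disjoint (im (x ∘ f)) (im (x ∘ f')) := by
    intro α β _ _ f f' h
    refine disjoint_left.2 fun v hv hv' => ?_
    obtain ⟨i, rfl⟩ := mem_im.1 hv
    obtain ⟨j, hj⟩ := mem_im.1 hv'
    exact h i j (hinj hj.symm)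
  have imW : ∀ {α : Type} [Fintype α] (f : α → ι), Disjoint (im (x ∘ f)) W := by
    intro α _ f
    refine disjoint_left.2 fun v hv => ?_
    obtain ⟨i, rfl⟩ := mem_im.1 hv
    exact hW' _
  refine ⟨x (Sum.inl ()), im (x ∘ fK), im (x ∘ Sum.inr ∘ Sum.inr ∘ Sum.inl),
    im (x ∘ Sum.inr ∘ Sum.inr ∘ Sum.inr), hAs, mem_im.2 ⟨Sum.inl (), rfl⟩, ?_, ?_,
    im_subset.2 fun i => hBs _, im_subset.2 fun i => hBs _, imW _, imW _, imW _,
    imdisj _ _ ?_, imdisj _ _ ?_, imdisj _ _ ?_, ?_, ?_⟩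
  · rw [card_im_iff.2 (hinj.comp hiK)]; simp; omega
  · intro v hv
    obtain ⟨hv1, hv2⟩ := mem_erase.1 hv
    obtain ⟨i | i, rfl⟩ := mem_im.1 hv2
    · exact absurd rfl hv1
    · exact hBs _
  · rintro (a | a) b h
    · exact Sum.inl_ne_inr h
    · exact Sum.inl_ne_inr (Sum.inr_injective h)
  · rintro (a | a) b h
    · exact Sum.inl_ne_inr h
    · exact Sum.inl_ne_inr (Sum.inr_injective h)
  · intro a b h
    exact Sum.inl_ne_inr (Sum.inr_injective (Sum.inr_injective h))
  · convert e1 using 2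
    ext v
    simp only [mem_union, mem_im]
    constructor
    · rintro (⟨i | i, h⟩ | ⟨i, h⟩)
      exacts [⟨.inl i, h⟩, ⟨.inr (.inl i), h⟩, ⟨.inr (.inr i), h⟩]
    · rintro ⟨i | i | i, h⟩
      exacts [.inl ⟨.inl i, h⟩, .inl ⟨.inr i, h⟩, .inr ⟨i, h⟩]
  · convert e2 using 2
    ext v
    simp only [mem_union, mem_im]
    constructor
    · rintro (⟨i | i, h⟩ | ⟨i, h⟩)
      exacts [⟨.inl i, h⟩, ⟨.inr (.inl i), h⟩, ⟨.inr (.inr i), h⟩]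
    · rintro ⟨i | i | i, h⟩
      exacts [.inl ⟨.inl i, h⟩, .inl ⟨.inr i, h⟩, .inr ⟨i, h⟩]

end Par

end Connector

section Paths

variable {k ℓ n : ℕ} {E : Finset (Finset (Fin n))}

/-- There is an ℓ-path with `t` edges, vertex set `U` and ends `L₀`, `L₁`. -/
def HasPath (k ℓ : ℕ) (E : Finset (Finset (Fin n))) (t : ℕ) (U L₀ L₁ : Finset (Fin n)) : Prop :=
  ∃ f : ℕ → Fin n, IsPath n k ℓ t E f ∧ pathVerts n k ℓ t f = U ∧ pathEnd0 n ℓ f = L₀ ∧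
    pathEnd1 n k ℓ t f = L₁

lemma image_Ico_getD {α : Type*} [DecidableEq α] (l₁ l₂ l₃ : List α) (v : α) :
    (Ico l₁.length (l₁.length + l₂.length)).image (fun j => (l₁ ++ (l₂ ++ l₃)).getD j v) =
      l₂.toFinset := by
  ext w
  simp only [mem_image, mem_Ico, List.mem_toFinset]
  constructor
  · rintro ⟨j, ⟨h1, h2⟩, rfl⟩
    rw [List.getD_append_right _ _ _ _ h1, List.getD_append _ _ _ _ (by omega),
      List.getD_eq_getElem _ _ (by omega)]
    exact List.getElem_mem _
  · intro h
    obtain ⟨i, hi, rfl⟩ := List.getElem_of_mem h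
    refine ⟨l₁.length + i, ⟨by omega, by omega⟩, ?_⟩
    rw [List.getD_append_right _ _ _ _ (by omega), Nat.add_sub_cancel_left,
      List.getD_append _ _ _ _ hi, List.getD_eq_getElem _ _ hi]

lemma pathEdge_eq (f : ℕ → Fin n) (i : ℕ) :
    pathEdge n k ℓ f i = (Ico (i * (k - ℓ)) (i * (k - ℓ) + k)).image f := by
  unfold pathEdge
  ext v
  simp only [mem_image, mem_range, mem_Ico]
  constructor
  · rintro ⟨j, hj, rfl⟩; exact ⟨_, ⟨by omega, by omega⟩, rfl⟩
  · rintro ⟨j, hj, rfl⟩; exact ⟨j - i * (k - ℓ), by omega, by congr 1; omega⟩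

lemma hasPath_edge {e L₀ L₁ : Finset (Fin n)} (he : e ∈ E) (hk : e.card = k) (hl : ℓ ≤ k)
    (h₀ : L₀ ⊆ e) (h₁ : L₁ ⊆ e) (hd : Disjoint L₀ L₁) (hc₀ : L₀.card = ℓ) (hc₁ : L₁.card = ℓ)
    (hne : e.Nonempty) : HasPath k ℓ E 1 e L₀ L₁ := by
  obtain ⟨v, -⟩ := hne
  set M := e \ (L₀ ∪ L₁) with hM
  set l := L₀.toList ++ (M.toList ++ L₁.toList) with hl'
  have hun : L₀ ∪ (M ∪ L₁) = e := by
    ext x; simp only [hM, mem_union, mem_sdiff]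
    constructor
    · rintro (h | h | h); exacts [h₀ h, h.1, h₁ h]
    · tauto
  have hnd : l.Nodup := by
    simp only [hl', List.nodup_append', nodup_toList, true_and]
    refine ⟨fun x hx hx' => ?_, fun x hx hx' => ?_⟩
    · simp [hM] at hx hx'; tauto
    · simp only [List.mem_append, mem_toList, hM, mem_sdiff, mem_union] at hx hx'
      have := disjoint_left.1 hd hx
      tauto
  have hfin : l.toFinset = e := by
    rw [hl', List.toFinset_append, List.toFinset_append]
    simpa using hun
  have hlen : l.length = k := by
    rw [← hk, ← hfin, List.toFinset_card_of_nodup hnd]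
  have hL₀ : L₀.toList.length = ℓ := by simp [hc₀]
  have hL₁ : L₁.toList.length = ℓ := by simp [hc₁]
  have hML : M.toList.length + ℓ + ℓ = k := by
    rw [← hlen, hl']; simp only [List.length_append]; omega
  have hall : (Ico 0 k).image (fun j => l.getD j v) = e := by
    have := image_Ico_getD [] l [] v
    simpa [hlen, hfin] using this
  refine ⟨fun j => l.getD j v, ⟨?_, ?_⟩, ?_, ?_, ?_⟩
  · intro i hi j hj hij
    simp only [Set.mem_Iio] at hi hj
    simp only at hij
    rw [List.getD_eq_getElem _ _ (by omega), List.getD_eq_getElem _ _ (by omega)] at hij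
    exact (hnd.getElem_inj_iff).1 hij
  · intro i hi
    obtain rfl : i = 0 := by omega
    rw [pathEdge_eq, zero_mul, zero_add, hall]
    exact he
  · unfold pathVerts
    rw [show 1 * (k - ℓ) + ℓ = k by omega, range_eq_Ico, hall]
  · have := image_Ico_getD [] L₀.toList (M.toList ++ L₁.toList) v
    unfold pathEnd0
    rw [range_eq_Ico]
    simpa [hL₀] using this
  · have := image_Ico_getD (L₀.toList ++ M.toList) L₁.toList [] v
    unfold pathEnd1
    simp only [List.append_nil, List.append_assoc, toList_toFinset, List.length_append] at this
    rw [hL₀, hL₁] at this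
    rw [show 1 * (k - ℓ) = ℓ + M.toList.length by omega]
    exact this

lemma HasPath.append {t t' : ℕ} {U U' L₀ L₁ L₂ : Finset (Fin n)} (hlk : 2 * ℓ ≤ k) (ht : 1 ≤ t)
    (h : HasPath k ℓ E t U L₀ L₁) (h' : HasPath k ℓ E t' U' L₁ L₂) (hU : U ∩ U' = L₁) :
    HasPath k ℓ E (t + t') (U ∪ U') L₀ L₂ := by
  obtain ⟨f, ⟨hf, hfE⟩, hfU, hf0, hf1⟩ := h
  obtain ⟨g, ⟨hg, hgE⟩, hgU, hg0, hg1⟩ := h'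
  obtain ⟨m, hm⟩ : ∃ m, m = k - ℓ := ⟨_, rfl⟩
  unfold pathVerts at hfU hgU
  unfold pathEnd0 at hf0 hg0
  unfold pathEnd1 at hf1 hg1
  rw [← hm] at hf hg hfU hgU hf1 hg1
  have hlm : ℓ ≤ m := by omega
  have htm : m ≤ t * m := Nat.le_mul_of_pos_left _ ht
  set q : ℕ → Fin n := fun j => if j < t * m then f j else g (j - t * m) with hq
  have q1 : ∀ j, j < t * m → q j = f j := fun j h => by simp [hq, h]
  have q2 : ∀ j, q (t * m + j) = g j := fun j => by simp [hq]
  have q2' : ∀ a b, (Ico (t * m + a) (t * m + b)).image q = (Ico a b).image g := by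
    intro a b
    ext v
    simp only [mem_image, mem_Ico]
    constructor
    · rintro ⟨j, hj, rfl⟩
      refine ⟨j - t * m, by omega, ?_⟩
      rw [← q2]; congr 1; omega
    · rintro ⟨j, hj, rfl⟩
      exact ⟨t * m + j, by omega, q2 j⟩
  have q1' : ∀ a b, b ≤ t * m → (Ico a b).image q = (Ico a b).image f := by
    intro a b hb
    refine image_congr fun j hj => q1 j ?_
    simp only [coe_Ico, Set.mem_Ico] at hj
    omega
  have q3 : (Ico (t * m) (t * m + ℓ)).image q = (Ico (t * m) (t * m + ℓ)).image f := by
    have h1 : (Ico (t * m) (t * m + ℓ)).image f = L₁ := hf1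
    have h2 := q2' 0 ℓ
    rw [add_zero, ← range_eq_Ico] at h2
    rw [h1, h2]; exact hg0
  have q4 : ∀ a, a ≤ t * m → (Ico a (t * m + ℓ)).image q = (Ico a (t * m + ℓ)).image f := by
    intro a ha
    rw [← Ico_union_Ico_eq_Ico ha (by omega : t * m ≤ t * m + ℓ), image_union, image_union, q3,
      q1' _ _ le_rfl]
  have hfU' : ∀ j, j < t * m → f j ∈ U ∧ f j ∉ L₁ := by
    intro j hj
    refine ⟨by rw [← hfU]; exact mem_image_of_mem _ (mem_range.2 (by omega)), fun hc => ?_⟩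
    rw [← hf1] at hc
    obtain ⟨i, hi, hij⟩ := mem_image.1 hc
    rw [mem_Ico] at hi
    have := hf (by simp only [Set.mem_Iio]; omega) (by simp only [Set.mem_Iio]; omega) hij
    omega
  have hgU' : ∀ j, j < t' * m + ℓ → g j ∈ U' := fun j hj => by
    rw [← hgU]; exact mem_image_of_mem _ (mem_range.2 hj)
  have cross : ∀ i j, i < t * m → j < t' * m + ℓ → f i ≠ g j := by
    intro i j hi hj he
    refine (hfU' i hi).2 ?_
    rw [← hU]
    exact mem_inter.2 ⟨(hfU' i hi).1, he ▸ hgU' j hj⟩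
  have hsum : (t + t') * m = t * m + t' * m := by ring
  refine ⟨q, ⟨?_, ?_⟩, ?_, ?_, ?_⟩
  · intro i hi j hj hij
    simp only [Set.mem_Iio, ← hm, hsum] at hi hj
    by_cases h1 : i < t * m <;> by_cases h2 : j < t * m
    · rw [q1 i h1, q1 j h2] at hij
      exact hf (by simp only [Set.mem_Iio]; omega) (by simp only [Set.mem_Iio]; omega) hij
    · obtain ⟨j, rfl⟩ := Nat.exists_eq_add_of_le (not_lt.1 h2)
      rw [q1 i h1, q2] at hij
      exact absurd hij (cross _ _ h1 (by omega))
    · obtain ⟨i, rfl⟩ := Nat.exists_eq_add_of_le (not_lt.1 h1)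
      rw [q1 j h2, q2] at hij
      exact absurd hij.symm (cross _ _ h2 (by omega))
    · obtain ⟨i, rfl⟩ := Nat.exists_eq_add_of_le (not_lt.1 h1)
      obtain ⟨j, rfl⟩ := Nat.exists_eq_add_of_le (not_lt.1 h2)
      rw [q2, q2] at hij
      rw [hg (by simp only [Set.mem_Iio]; omega) (by simp only [Set.mem_Iio]; omega) hij]
  · intro i hi
    rw [pathEdge_eq, ← hm]
    by_cases h1 : i < t
    · have e1 := hfE i h1
      rw [pathEdge_eq, ← hm] at e1
      by_cases h2 : i + 1 < t
      · rw [q1' _ _ ?_]; · exact e1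
        have : (i + 2) * m ≤ t * m := Nat.mul_le_mul_right _ h2
        rw [add_mul] at this
        omega
      · obtain rfl : i + 1 = t := by omega
        have e2 : i * m + k = (i + 1) * m + ℓ := by rw [add_mul]; omega
        rw [e2] at e1 ⊢
        rw [q4 _ (Nat.mul_le_mul_right _ (by omega))]
        exact e1
    · obtain ⟨i, rfl⟩ := Nat.exists_eq_add_of_le (not_lt.1 h1)
      have e1 := hgE i (by omega)
      rw [pathEdge_eq, ← hm] at e1
      rw [add_mul, add_assoc, q2']
      exact e1
  · unfold pathVerts
    rw [← hm]
    rw [range_eq_Ico] at hfU hgU ⊢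
    rw [hsum, add_assoc, ← Ico_union_Ico_eq_Ico (Nat.zero_le (t * m)) (by omega), image_union]
    have h2 := q2' 0 (t' * m + ℓ)
    rw [add_zero, hgU] at h2
    rw [h2, ← hfU, ← Ico_union_Ico_eq_Ico (Nat.zero_le (t * m)) (by omega : t * m ≤ t * m + ℓ),
      image_union, q1' _ _ le_rfl]
    have h3 : (Ico (t * m) (t * m + ℓ)).image f ⊆ U' := by
      have h1 : (Ico (t * m) (t * m + ℓ)).image f = L₁ := hf1
      rw [h1, ← hU]; exact inter_subset_right
    rw [union_assoc, union_eq_right.2 h3]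
  · unfold pathEnd0
    rw [range_eq_Ico] at hf0 ⊢
    rw [q1' _ _ (by omega), hf0]
  · unfold pathEnd1
    rw [← hm]
    rw [hsum, add_assoc, q2', hg1]

lemma HasPath.sub₀ {t : ℕ} {U L₀ L₁ : Finset (Fin n)} (h : HasPath k ℓ E t U L₀ L₁) :
    L₀ ⊆ U := by
  obtain ⟨f, -, rfl, rfl, rfl⟩ := h
  exact image_subset_image (range_subset_range.2 (by omega))

lemma HasPath.sub₁ {t : ℕ} {U L₀ L₁ : Finset (Fin n)} (h : HasPath k ℓ E t U L₀ L₁) :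
    L₁ ⊆ U := by
  obtain ⟨f, -, rfl, rfl, rfl⟩ := h
  refine image_subset_image fun j hj => ?_
  rw [mem_Ico] at hj; exact mem_range.2 hj.2

lemma HasPath.card {t : ℕ} {U L₀ L₁ : Finset (Fin n)} (h : HasPath k ℓ E t U L₀ L₁) :
    U.card = t * (k - ℓ) + ℓ := by
  obtain ⟨f, hf, rfl, rfl, rfl⟩ := h
  unfold pathVerts
  rw [card_image_of_injOn, card_range]
  simpa using hf.1

lemma HasPath.disjoint {t : ℕ} {U L₀ L₁ : Finset (Fin n)} (hlk : 2 * ℓ ≤ k) (ht : 1 ≤ t)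
    (h : HasPath k ℓ E t U L₀ L₁) : Disjoint L₀ L₁ := by
  obtain ⟨f, hf, rfl, rfl, rfl⟩ := h
  have htm : k - ℓ ≤ t * (k - ℓ) := Nat.le_mul_of_pos_left _ ht
  refine disjoint_left.2 fun v hv hv' => ?_
  obtain ⟨i, hi, rfl⟩ := mem_image.1 hv
  obtain ⟨j, hj, hij⟩ := mem_image.1 hv'
  rw [mem_Ico] at hj
  rw [mem_range] at hi
  have := hf.1 (by simp only [Set.mem_Iio]; omega) (by simp only [Set.mem_Iio]; omega) hij
  omega

end Paths

section Tasks

variable {k ℓ c n : ℕ} {E : Finset (Finset (Fin n))} {A B R : Finset (Fin n)} {τ η ζ : ℝ}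

/-- There is an ℓ-path with vertex set `U`, with good ends, whose number of edges exceeds twice
the number of its vertices outside `Bs` by `d`. -/
def Pth (k ℓ : ℕ) (τ : ℝ) (E : Finset (Finset (Fin n))) (B : Finset (Fin n)) (d : ℤ)
    (U : Finset (Fin n)) : Prop :=
  ∃ (t : ℕ) (L₀ L₁ : Finset (Fin n)), 1 ≤ t ∧ HasPath k ℓ E t U L₀ L₁ ∧ IsEnd k ℓ τ E B L₀ ∧
    IsEnd k ℓ τ E B L₁ ∧ d = t - 2 * ((U \ Bs k ℓ τ E B).card : ℤ)

/-- Every small set disjoint from `Z` is avoided by a short path of surplus `d` that covers the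
vertices of `Z` outside `Bs`. -/
def Task (k ℓ : ℕ) (τ η : ℝ) (E : Finset (Finset (Fin n))) (B : Finset (Fin n)) (d : ℤ)
    (Z : Finset (Fin n)) : Prop :=
  ∀ W : Finset (Fin n), (W.card : ℝ) ≤ η * n → Disjoint Z W →
    ∃ U, Pth k ℓ τ E B d U ∧ Disjoint U W ∧ U.card ≤ 2 * k ∧ Z \ Bs k ℓ τ E B ⊆ U

namespace Par

variable (H : Par k ℓ c n E A B τ η ζ)
include H

lemma hasPath_one {e L₀ L₁ : Finset (Fin n)} (he : e ∈ E)
    (h₀ : L₀ ⊆ e) (h₁ : L₁ ⊆ e) (hd : Disjoint L₀ L₁) (hc₀ : L₀.card = ℓ) (hc₁ : L₁.card = ℓ) :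
    HasPath k ℓ E 1 e L₀ L₁ := by
  have hc := H.unif e he
  have := H.hlk
  have := H.hk
  exact hasPath_edge he hc (by omega) h₀ h₁ hd hc₀ hc₁ (card_pos.1 (by omega))

lemma pth_two {e₀ e₁ L₀ L₁ : Finset (Fin n)} (he₀ : e₀ ∈ E) (he₁ : e₁ ∈ E)
    (hK : (e₀ ∩ e₁).card = ℓ) (h₀ : L₀ ⊆ e₀ \ e₁) (h₁ : L₁ ⊆ e₁ \ e₀)
    (hL₀ : IsEnd k ℓ τ E B L₀) (hL₁ : IsEnd k ℓ τ E B L₁) :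
    Pth k ℓ τ E B (2 - 2 * (((e₀ ∪ e₁) \ Bs k ℓ τ E B).card : ℤ)) (e₀ ∪ e₁) := by
  have hlk := H.hlk
  have d₀ : Disjoint L₀ (e₀ ∩ e₁) :=
    disjoint_left.2 fun v hv hv' => (mem_sdiff.1 (h₀ hv)).2 (mem_inter.1 hv').2
  have d₁ : Disjoint (e₀ ∩ e₁) L₁ :=
    disjoint_left.2 fun v hv' hv => (mem_sdiff.1 (h₁ hv)).2 (mem_inter.1 hv').1
  have p₀ := H.hasPath_one he₀ (h₀.trans sdiff_subset) inter_subset_left d₀ hL₀.card hK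
  have p₁ := H.hasPath_one he₁ inter_subset_right (h₁.trans sdiff_subset) d₁ hK hL₁.card
  exact ⟨2, L₀, L₁, by norm_num, p₀.append (by omega) le_rfl p₁ rfl, hL₀, hL₁, rfl⟩

lemma card_union_le_two_mul {e₀ e₁ : Finset (Fin n)} (he₀ : e₀ ∈ E) (he₁ : e₁ ∈ E) :
    (e₀ ∪ e₁).card ≤ 2 * k := by
  have := card_union_le e₀ e₁
  rw [H.unif e₀ he₀, H.unif e₁ he₁] at this
  omega

lemma task_cherry (h1 : 1 ≤ R.card) (hsl : R.card ≤ ℓ) (hR : ¬ Light k ℓ τ E B R) :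
    Task k ℓ τ η E B (2 - 2 * ((R \ Bs k ℓ τ E B).card : ℤ)) R := by
  intro W hW hRW
  obtain ⟨K, T₀, T₁, L₀, L₁, hRK, hK, hKB, hKW, he₀, he₁, hd₀, hd₁, hd, hT₀, hT₁, hW₀, hW₁,
    hL₀, hL₁, hE₀, hE₁⟩ := H.exists_cherry h1 hsl hR hW
  have hKint : (K ∪ T₀) ∩ (K ∪ T₁) = K := by
    rw [← union_inter_distrib_left, disjoint_iff_inter_eq_empty.1 hd, union_empty]
  have hs₀ : L₀ ⊆ (K ∪ T₀) \ (K ∪ T₁) := fun v hv => by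
    simp only [mem_sdiff, mem_union, not_or]
    exact ⟨.inr (hL₀ hv), disjoint_right.1 hd₀ (hL₀ hv), disjoint_left.1 hd (hL₀ hv)⟩
  have hs₁ : L₁ ⊆ (K ∪ T₁) \ (K ∪ T₀) := fun v hv => by
    simp only [mem_sdiff, mem_union, not_or]
    exact ⟨.inr (hL₁ hv), disjoint_right.1 hd₁ (hL₁ hv), disjoint_right.1 hd (hL₁ hv)⟩
  have hP := H.pth_two he₀ he₁ (by rw [hKint, hK]) hs₀ hs₁ hE₀ hE₁
  have hsd : (K ∪ T₀ ∪ (K ∪ T₁)) \ Bs k ℓ τ E B = R \ Bs k ℓ τ E B := by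
    ext v
    simp only [mem_sdiff, mem_union]
    constructor
    · rintro ⟨(h | h) | (h | h), hv⟩
      · exact ⟨by_contra fun hc => hv (hKB (mem_sdiff.2 ⟨h, hc⟩)), hv⟩
      · exact absurd (hT₀ h) hv
      · exact ⟨by_contra fun hc => hv (hKB (mem_sdiff.2 ⟨h, hc⟩)), hv⟩
      · exact absurd (hT₁ h) hv
    · exact fun ⟨h, hv⟩ => ⟨.inl (.inl (hRK h)), hv⟩
  rw [hsd] at hP
  have hKW' : Disjoint K W := disjoint_left.2 fun v hv => by
    by_cases h : v ∈ R
    · exact disjoint_left.1 hRW h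
    · exact disjoint_left.1 hKW (mem_sdiff.2 ⟨hv, h⟩)
  refine ⟨_, hP, ?_, H.card_union_le_two_mul he₀ he₁, ?_⟩
  · simp only [disjoint_union_left]
    exact ⟨⟨hKW', hW₀⟩, hKW', hW₁⟩
  · exact fun v hv => mem_union_left _ (mem_union_left _ (hRK (mem_sdiff.1 hv).1))

lemma task_vertex_cherry {u : Fin n} (hu : u ∉ Bs k ℓ τ E B) : Task k ℓ τ η E B 0 {u} := by
  have := H.task_cherry (R := {u}) (by simp) (by simpa using H.hl) (fun h => hu (mem_Bs.2 h))
  rw [sdiff_eq_self_of_disjoint (disjoint_singleton_left.2 hu)] at this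
  simpa using this

lemma task_vertex_edge {u : Fin n} (hu : u ∉ Bs k ℓ τ E B) : Task k ℓ τ η E B (-1) {u} := by
  intro W hW hRW
  have hlk := H.hlk
  obtain ⟨e, he, L₀, L₁, hRe, heB, heW, h₀, h₁, hd, hE₀, hE₁⟩ :=
    H.exists_edge (R := {u}) (s := 1) (by simp) H.hl (fun h => hu (mem_Bs.2 h))
      (empty_subset _) (empty_subset _) (disjoint_empty_left _) H.empty_light H.empty_light (by simp)
      (by simp) (empty_subset _) (empty_subset _) (by simp; omega) hW
  have hsd : e \ Bs k ℓ τ E B = {u} := by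
    ext v
    simp only [mem_sdiff, mem_singleton]
    constructor
    · rintro ⟨h, hv⟩
      by_contra hc
      exact hv (heB (mem_sdiff.2 ⟨h, by simpa using hc⟩))
    · rintro rfl
      exact ⟨hRe (mem_singleton_self _), hu⟩
  refine ⟨e, ⟨1, L₀, L₁, le_rfl, H.hasPath_one he h₀ h₁ hd hE₀.card hE₁.card, hE₀, hE₁,
    by rw [hsd]; simp⟩, ?_, by rw [H.unif e he]; omega, ?_⟩
  · refine disjoint_left.2 fun v hv => ?_
    by_cases h : v ∈ ({u} : Finset (Fin n))
    · exact disjoint_left.1 hRW h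
    · exact disjoint_left.1 heW (mem_sdiff.2 ⟨hv, h⟩)
  · exact sdiff_subset.trans hRe

lemma task_edge {e : Finset (Fin n)} (he : e ∈ E) (heB : e ⊆ Bs k ℓ τ E B) :
    Task k ℓ τ η E B 1 e := by
  intro W hW heW
  have hlk := H.hlk
  have hc := H.unif e he
  suffices h : ∃ e' ∈ E, ∃ L₀ L₁, e' ⊆ Bs k ℓ τ E B ∧ Disjoint e' W ∧ L₀ ⊆ e' ∧ L₁ ⊆ e' ∧
      Disjoint L₀ L₁ ∧ IsEnd k ℓ τ E B L₀ ∧ IsEnd k ℓ τ E B L₁ by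
    obtain ⟨e', he', L₀, L₁, h1, h2, h₀, h₁, hd, hE₀, hE₁⟩ := h
    refine ⟨e', ⟨1, L₀, L₁, le_rfl, H.hasPath_one he' h₀ h₁ hd hE₀.card hE₁.card, hE₀, hE₁, ?_⟩,
      h2, by rw [H.unif e' he']; omega, ?_⟩
    · rw [sdiff_eq_empty_iff_subset.2 h1]; simp
    · rw [sdiff_eq_empty_iff_subset.2 heB]; exact empty_subset _
  by_cases hh : ∃ s, ∃ R ⊆ e, R.card = s ∧ 1 ≤ s ∧ s ≤ ℓ ∧ ¬ Light k ℓ τ E B R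
  · classical
    obtain ⟨R, hRe, hRs, hs1, hsl, hR⟩ := Nat.find_spec hh
    have hmin : ∀ R' ⊆ e, R'.card < Nat.find hh → 1 ≤ R'.card → Light k ℓ τ E B R' := by
      intro R' hR' h1 h2
      by_contra hc
      exact Nat.find_min hh h1 ⟨R', hR', rfl, h2, by omega, hc⟩
    obtain ⟨r, hr⟩ : R.Nonempty := card_pos.1 (by omega)
    have hrL : Light k ℓ τ E B {r} := mem_Bs.1 (heB (hRe hr))
    have hs2 : 2 ≤ Nat.find hh := by
      by_contra hlt
      have h1 : R.card = 1 := by omega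
      obtain ⟨r', rfl⟩ := card_eq_one.1 h1
      rw [mem_singleton] at hr
      exact hR (hr ▸ hrL)
    have hce : (R.erase r).card = Nat.find hh - 1 := by rw [card_erase_of_mem hr, hRs]
    obtain ⟨e', he', L₀, L₁, hRe', h1, h2, h₀, h₁, hd, hE₀, hE₁⟩ :=
      H.exists_edge hRs hsl hR (R₀ := {r}) (R₁ := R.erase r) (singleton_subset_iff.2 hr)
        (erase_subset _ _) (by simp) hrL
        (hmin _ ((erase_subset _ _).trans hRe) (by omega) (by omega)) (by simpa using hs2)
        (by omega) (singleton_subset_iff.2 (heB (hRe hr)))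
        ((erase_subset _ _).trans (hRe.trans heB)) (by rw [hce]; simp; omega) hW
    refine ⟨e', he', L₀, L₁, fun v hv => ?_, disjoint_left.2 fun v hv => ?_, h₀, h₁, hd, hE₀, hE₁⟩
    · by_cases h : v ∈ R
      · exact heB (hRe h)
      · exact h1 (mem_sdiff.2 ⟨hv, h⟩)
    · by_cases h : v ∈ R
      · exact disjoint_left.1 heW (hRe h)
      · exact disjoint_left.1 h2 (mem_sdiff.2 ⟨hv, h⟩)
  · have hl : ∀ L ⊆ e, L.card = ℓ → IsEnd k ℓ τ E B L := fun L hL hcL =>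
      ⟨hcL, by_contra fun h => hh ⟨ℓ, L, hL, hcL, H.hl, le_rfl, h⟩, hL.trans heB⟩
    obtain ⟨L₀, h₀, hc₀⟩ := exists_subset_card_eq (s := e) (n := ℓ) (by omega)
    obtain ⟨L₁, h₁, hc₁⟩ := exists_subset_card_eq (s := e \ L₀) (n := ℓ)
      (by rw [card_sdiff_of_subset h₀]; omega)
    exact ⟨e, he, L₀, L₁, heB, heW, h₀, h₁.trans sdiff_subset,
      disjoint_left.2 fun v hv hv' => (mem_sdiff.1 (h₁ hv')).2 hv, hl _ h₀ hc₀,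
      hl _ (h₁.trans sdiff_subset) hc₁⟩

lemma task_two_edges (hh : ∀ R ⊆ Bs k ℓ τ E B, 1 ≤ R.card → R.card ≤ ℓ → Light k ℓ τ E B R)
    {e₀ e₁ : Finset (Fin n)} (he₀ : e₀ ∈ E) (he₁ : e₁ ∈ E) (h₀ : e₀ ⊆ Bs k ℓ τ E B)
    (h₁ : e₁ ⊆ Bs k ℓ τ E B) (hK : (e₀ ∩ e₁).card = ℓ) :
    Task k ℓ τ η E B 2 (e₀ ∪ e₁) := by
  intro W hW heW
  have hlk := H.hlk
  have hl : ∀ L ⊆ Bs k ℓ τ E B, L.card = ℓ → IsEnd k ℓ τ E B L := fun L hL hcL =>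
      ⟨hcL, hh L hL (by rw [hcL]; exact H.hl) hcL.le, hL⟩
  obtain ⟨L₀, hs₀, hc₀⟩ := exists_subset_card_eq (s := e₀ \ e₁) (n := ℓ) (by
    have := card_sdiff_add_card_inter e₀ e₁
    rw [H.unif e₀ he₀] at this; omega)
  obtain ⟨L₁, hs₁, hc₁⟩ := exists_subset_card_eq (s := e₁ \ e₀) (n := ℓ) (by
    have := card_sdiff_add_card_inter e₁ e₀
    rw [H.unif e₁ he₁, inter_comm] at this; omega)
  have hP := H.pth_two he₀ he₁ hK hs₀ hs₁ (hl _ (hs₀.trans (sdiff_subset.trans h₀)) hc₀)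
    (hl _ (hs₁.trans (sdiff_subset.trans h₁)) hc₁)
  rw [sdiff_eq_empty_iff_subset.2 (union_subset h₀ h₁)] at hP
  exact ⟨_, by simpa using hP, heW, H.card_union_le_two_mul he₀ he₁, sdiff_subset⟩

lemma pth_join {d₁ d₂ : ℤ} {U₁ U₂ W : Finset (Fin n)} (h₁ : Pth k ℓ τ E B d₁ U₁)
    (h₂ : Pth k ℓ τ E B d₂ U₂) (hd : Disjoint U₁ U₂)
    (hW : ((U₁ ∪ U₂ ∪ W).card : ℝ) ≤ η * n) :
    ∃ U, Pth k ℓ τ E B (d₁ + d₂) U ∧ U₁ ⊆ U ∧ U₂ ⊆ U ∧ U.card ≤ U₁.card + U₂.card + 2 * k ∧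
      Disjoint (U \ (U₁ ∪ U₂)) W := by
  obtain ⟨t₁, L₀, L₁, ht₁, p₁, hL₀, hL₁, rfl⟩ := h₁
  obtain ⟨t₂, M₀, M₁, ht₂, p₂, hM₀, hM₁, rfl⟩ := h₂
  have hlk := H.hlk
  obtain ⟨a, K, X, Y, haA, haK, hK, hKB, hXB, hYB, hKW, hXW, hYW, hKX, hKY, hXY, he₁, he₂⟩ :=
    H.exists_connector hL₁ hM₀ hW
  have hLU := p₁.sub₁
  have hMU := p₂.sub₀
  simp only [disjoint_union_right] at hKW hXW hYW
  have dLK : Disjoint L₁ K := (hKW.1.1.mono_right hLU).symm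
  have dKM : Disjoint K M₀ := hKW.1.2.mono_right hMU
  have q₁ := H.hasPath_one he₁ subset_union_left
    (subset_union_left.trans subset_union_right) dLK hL₁.card hK
  have q₂ := H.hasPath_one he₂ (subset_union_left.trans subset_union_right)
    subset_union_left dKM hK hM₀.card
  have g₁ := p₁.append (by omega) ht₁ q₁ (by
    ext v
    simp only [mem_inter, mem_union]
    constructor
    · rintro ⟨hv, h | h | h⟩
      · exact h
      · exact absurd hv (disjoint_left.1 hKW.1.1 h)
      · exact absurd hv (disjoint_left.1 hXW.1.1 h)
    · exact fun h => ⟨hLU h, .inl h⟩)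
  have g₂ := g₁.append (by omega) (by omega) q₂ (by
    ext v
    simp only [mem_inter, mem_union]
    constructor
    · rintro ⟨h1, h2 | h2 | h2⟩
      · have hv := hMU h2
        rcases h1 with h1 | h1 | h1 | h1
        · exact absurd hv (disjoint_left.1 hd h1)
        · exact absurd hv (disjoint_left.1 hd (hLU h1))
        · exact h1
        · exact absurd hv (disjoint_left.1 hXW.1.2 h1)
      · exact h2
      · rcases h1 with h1 | h1 | h1 | h1
        · exact absurd h1 (disjoint_left.1 hYW.1.1 h2)
        · exact absurd (hLU h1) (disjoint_left.1 hYW.1.1 h2)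
        · exact h1
        · exact absurd h2 (disjoint_left.1 hXY h1)
    · exact fun h => ⟨.inr (.inr (.inl h)), .inr (.inl h)⟩)
  have g₃ := g₂.append (by omega) (by omega) p₂ (by
    ext v
    simp only [mem_inter, mem_union]
    constructor
    · rintro ⟨(h | h | h | h) | h | h | h, hv⟩
      · exact absurd hv (disjoint_left.1 hd h)
      · exact absurd hv (disjoint_left.1 hd (hLU h))
      · exact absurd hv (disjoint_left.1 hKW.1.2 h)
      · exact absurd hv (disjoint_left.1 hXW.1.2 h)
      · exact h
      · exact absurd hv (disjoint_left.1 hKW.1.2 h)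
      · exact absurd hv (disjoint_left.1 hYW.1.2 h)
    · exact fun h => ⟨.inr (.inl h), hMU h⟩)
  set U := U₁ ∪ (L₁ ∪ (K ∪ X)) ∪ (M₀ ∪ (K ∪ Y)) ∪ U₂ with hU
  have haB : a ∉ Bs k ℓ τ E B := disjoint_left.1 disjoint_As_Bs haA
  have hsd : U \ Bs k ℓ τ E B =
      insert a ((U₁ \ Bs k ℓ τ E B) ∪ (U₂ \ Bs k ℓ τ E B)) := by
    ext v
    simp only [hU, mem_sdiff, mem_insert, mem_union]
    constructor
    · rintro ⟨h, hv⟩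
      have hK' : v ∈ K → v = a := fun h => by_contra fun hc => hv (hKB (mem_erase.2 ⟨hc, h⟩))
      have hX' : v ∉ X := fun h => hv (hXB h)
      have hY' : v ∉ Y := fun h => hv (hYB h)
      have hL' : v ∈ L₁ → v ∈ U₁ := fun h => hLU h
      have hM' : v ∈ M₀ → v ∈ U₂ := fun h => hMU h
      tauto
    · rintro (rfl | h | h)
      · exact ⟨by tauto, haB⟩
      · exact ⟨by tauto, h.2⟩
      · exact ⟨by tauto, h.2⟩
  have hcd : (U \ Bs k ℓ τ E B).card =
      (U₁ \ Bs k ℓ τ E B).card + (U₂ \ Bs k ℓ τ E B).card + 1 := by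
    rw [hsd, card_insert_of_notMem, card_union_of_disjoint]
    · exact hd.mono sdiff_subset sdiff_subset
    · simp only [mem_union, mem_sdiff, not_or, not_and]
      exact ⟨fun h => absurd h (disjoint_left.1 hKW.1.1 haK),
        fun h => absurd h (disjoint_left.1 hKW.1.2 haK)⟩
  refine ⟨U, ⟨_, L₀, M₁, by omega, g₃, hL₀, hM₁, ?_⟩, ?_, subset_union_right, ?_, ?_⟩
  · rw [hcd]; push_cast; ring
  · exact subset_union_left.trans (subset_union_left.trans subset_union_left)
  · have c1 := H.unif _ he₁
    have c2 := H.unif _ he₂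
    have := card_union_le U₁ (L₁ ∪ (K ∪ X))
    have := card_union_le (U₁ ∪ (L₁ ∪ (K ∪ X))) (M₀ ∪ (K ∪ Y))
    have := card_union_le (U₁ ∪ (L₁ ∪ (K ∪ X)) ∪ (M₀ ∪ (K ∪ Y))) U₂
    rw [hU]
    omega
  · refine disjoint_left.2 fun v hv hvW => ?_
    simp only [hU, mem_sdiff, mem_union, not_or] at hv
    obtain ⟨((h | h | h | h) | h | h | h) | h, h₁, h₂⟩ := hv
    exacts [h₁ h, h₁ (hLU h), disjoint_left.1 hKW.2 h hvW, disjoint_left.1 hXW.2 h hvW,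
      h₂ (hMU h), disjoint_left.1 hKW.2 h hvW, disjoint_left.1 hYW.2 h hvW, h₂ h]

lemma pth_chain (l : List (ℤ × Finset (Fin n)))
    (hl : ∀ p ∈ l, Task k ℓ τ η E B p.1 p.2 ∧ p.2.card ≤ 2 * k)
    (hp : l.Pairwise fun p q => Disjoint p.2 q.2) {d : ℤ} {U : Finset (Fin n)}
    (hU : Pth k ℓ τ E B d U) (hd : ∀ p ∈ l, Disjoint p.2 U)
    (hc : (U.card + 4 * k * l.length : ℝ) ≤ η * n) :
    ∃ U', Pth k ℓ τ E B (d + (l.map Prod.fst).sum) U' ∧ U ⊆ U' ∧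
      U'.card ≤ U.card + 4 * k * l.length ∧ ∀ p ∈ l, p.2 \ Bs k ℓ τ E B ⊆ U' := by
  induction l generalizing d U with
  | nil => exact ⟨U, by simpa using hU, Subset.rfl, by simp, by simp⟩
  | cons p l ih =>
    set Z := l.toFinset.biUnion Prod.snd with hZ
    have hZc : Z.card ≤ 2 * k * l.length := by
      refine (card_biUnion_le_card_mul _ _ (2 * k) fun q hq => ?_).trans ?_
      · exact (hl q (List.mem_cons_of_mem _ (List.mem_toFinset.1 hq))).2
      · rw [mul_comm]; exact Nat.mul_le_mul_left _ (List.toFinset_card_le l)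
    have hqZ : ∀ q ∈ l, q.2 ⊆ Z := fun q hq =>
      subset_biUnion_of_mem Prod.snd (List.mem_toFinset.2 hq)
    rw [List.pairwise_cons] at hp
    have hpZ : Disjoint p.2 Z := by
      rw [hZ, disjoint_biUnion_right]
      exact fun q hq => hp.1 q (List.mem_toFinset.1 hq)
    have hcc := card_union_le U Z
    rw [List.length_cons] at hc
    push_cast at hc
    obtain ⟨U₁, hU₁, hU₁W, hU₁c, hpU₁⟩ := (hl p List.mem_cons_self).1 (U ∪ Z) (by
      have : ((U ∪ Z).card : ℝ) ≤ U.card + 2 * k * l.length := by exact_mod_cast by omega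
      have : (0 : ℝ) ≤ 2 * k * l.length := by positivity
      have : (0 : ℝ) ≤ k := by positivity
      linarith) (disjoint_union_right.2 ⟨hd p List.mem_cons_self, hpZ⟩)
    rw [disjoint_union_right] at hU₁W
    obtain ⟨U₂, hU₂, hs, hs₁, hU₂c, hU₂W⟩ := H.pth_join hU hU₁ hU₁W.1.symm (W := Z) (by
      have h1 := card_union_le (U ∪ U₁) Z
      have h2 := card_union_le U U₁
      have : ((U ∪ U₁ ∪ Z).card : ℝ) ≤ U.card + 2 * k + 2 * k * l.length := by
        exact_mod_cast by omega
      have : (0 : ℝ) ≤ 2 * k * l.length := by positivity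
      have : (0 : ℝ) ≤ k := by positivity
      linarith)
    have hU₂c' : U₂.card ≤ U.card + 4 * k := by omega
    obtain ⟨U', hU', hsub, hcard, hcov⟩ := ih (fun q hq => hl q (List.mem_cons_of_mem _ hq)) hp.2
      hU₂ (fun q hq => by
        refine disjoint_left.2 fun v hv hv' => ?_
        by_cases hvU : v ∈ U ∪ U₁
        · rcases mem_union.1 hvU with h | h
          · exact disjoint_left.1 (hd q (List.mem_cons_of_mem _ hq)) hv h
          · exact disjoint_left.1 hU₁W.2 h (hqZ q hq hv)
        · exact disjoint_left.1 hU₂W (mem_sdiff.2 ⟨hv', hvU⟩) (hqZ q hq hv)) (by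
        have : (U₂.card : ℝ) ≤ U.card + 4 * k := by exact_mod_cast hU₂c'
        linarith)
    refine ⟨U', ?_, hs.trans hsub, ?_, ?_⟩
    · rw [List.map_cons, List.sum_cons, ← add_assoc]; exact hU'
    · rw [List.length_cons, mul_add]; omega
    · intro q hq
      rcases List.mem_cons.1 hq with rfl | hq
      · exact hpU₁.trans (hs₁.trans hsub)
      · exact hcov q hq

end Par

end Tasks

section Matching

variable {k ℓ c n : ℕ} {E : Finset (Finset (Fin n))} {A B R : Finset (Fin n)} {τ η ζ : ℝ}

lemma Ctx.pairs_ge (H : Ctx k ℓ c n E A B) {D S : Finset (Fin n)} {q : ℕ}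
    (hD : D.card = B.card + q) (hS : S.card = k - 2) (hSD : S ⊆ D) :
    (B.card - (k - 2) + q).choose 2 + 1 + (if c = 2 ∧ ℓ = 1 then 1 else 0) ≤
      ((powersetCard 2 (D \ S)).filter fun P => S ∪ P ∈ E).card +
        (B.card - (k - 2)).choose 2 := by
  have hk := H.hk
  have h1 := H.hdeg S hS
  rw [deg_eq_card_pairs H.unif (by omega) hS] at h1
  have hsub : powersetCard 2 (D \ S) ⊆ powersetCard 2 Sᶜ :=
    powersetCard_mono fun v hv => mem_compl.2 (mem_sdiff.1 hv).2
  have h2 : ((powersetCard 2 Sᶜ).filter fun P => S ∪ P ∈ E).card ≤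
      ((powersetCard 2 (D \ S)).filter fun P => S ∪ P ∈ E).card +
        (powersetCard 2 Sᶜ \ powersetCard 2 (D \ S)).card := by
    refine (card_le_card fun P hP => ?_).trans (card_union_le _ _)
    simp only [mem_filter, mem_union, mem_sdiff] at hP ⊢
    tauto
  have h3 := card_sdiff_add_card_eq_card hsub
  rw [card_powersetCard, card_powersetCard, card_compl, Fintype.card_fin, hS,
    card_sdiff_of_subset hSD, hS, hD] at h3
  have h4 := H.card_add
  have h5 := H.four_mul_card_le
  have h6 := H.k_le
  have e1 : B.card - (k - 2) + q = B.card + q - (k - 2) := by omega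
  have e2 : n - (k - 2) - A.card = B.card - (k - 2) := by omega
  rw [e2] at h1
  rw [e1]
  omega

lemma choose_two_add (N q : ℕ) : N.choose 2 + q * N ≤ (N + q).choose 2 := by
  induction q with
  | zero => simp
  | succ q ih =>
    have h : (N + q + 1).choose 2 = N + q + (N + q).choose 2 := by
      rw [Nat.choose_succ_succ' (N + q) 1, Nat.choose_one_right]
    rw [← add_assoc, h, add_mul]
    omega

lemma pr_cons_le [Nonempty (Fin n)] {κ : Type*} [Fintype κ] (W : Finset (Fin n))
    (P : Fin n → (κ → Fin n) → Prop) {M : ℝ}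
    (hP : ∀ w ∈ W, pr κ (P w) ≤ M) :
    pr (Unit ⊕ κ) (fun z : Unit ⊕ κ → Fin n => z (Sum.inl ()) ∈ W ∧
      P (z (Sum.inl ())) (z ∘ Sum.inr)) ≤ W.card / n * M := by
  classical
  have h := pr_sum (V := Fin n) (ι := Unit) (κ := κ) (fun x y => x () ∈ W ∧ P (x ()) y)
  refine h.le.trans ?_
  simp only [Fintype.card_fin, Fintype.card_unit, pow_one]
  rw [div_mul_eq_mul_div]
  gcongr
  rw [Fintype.sum_equiv (Equiv.funUnique Unit (Fin n))
    (fun x => pr κ fun y => x () ∈ W ∧ P (x ()) y)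
    (fun w => pr κ (fun y => w ∈ W ∧ P w y)) (fun x => rfl)]
  calc _ ≤ ∑ w, (if w ∈ W then M else 0) := by
        refine sum_le_sum fun w _ => ?_
        split_ifs with hw
        · exact (pr_mono fun y hy => hy.2).trans (hP w hw)
        · rw [pr_congr (Q := fun _ => False) (by tauto)]; simp [pr]
    _ = _ := by simp

namespace Par

variable (H : Par k ℓ c n E A B τ η ζ)
include H

lemma η_le : η ≤ τ := by
  have h1 := H.hη'; have h2 := H.eps_le 0; have h3 := H.k3; have := H.hη
  nlinarith

lemma card_Bs_sdiff : 100 * k * ((Bs k ℓ τ E B \ B).card : ℝ) ≤ η * n := by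
  refine le_trans ?_ H.card_A_diff
  have := card_le_card H.B_sdiff_subset
  gcongr

lemma pr_link_le {κ : Type*} [Fintype κ] (hκ : Fintype.card κ + 1 = k) {w : Fin n}
    (hw : w ∈ Bs k ℓ τ E B) :
    pr κ (fun y : κ → Fin n => (∀ i, y i ∈ Bs k ℓ τ E B) ∧ {w} ∪ im y ∈ E) ≤ 2 * τ := by
  classical
  have := H.toCtx.nonempty
  have hn := H.npos'
  have hL : dB k E B {w} ≤ τ := (mem_Bs.1 hw).trans (H.eps_le _)
  rw [← dB_eq κ (by simpa using hκ)] at hL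
  have h1 := pr_exists_mem_le (ι := κ) (Bs k ℓ τ E B \ B)
  have h2 : (Fintype.card κ : ℝ) * ((Bs k ℓ τ E B \ B).card / Fintype.card (Fin n)) ≤ τ := by
    rw [Fintype.card_fin, ← mul_div_assoc, div_le_iff₀ hn]
    have h3 := H.card_Bs_sdiff
    have h4 : (Fintype.card κ : ℝ) ≤ k := by exact_mod_cast (by omega)
    have h5 : (Fintype.card κ : ℝ) * ((Bs k ℓ τ E B \ B).card : ℝ) ≤
      k * ((Bs k ℓ τ E B \ B).card : ℝ) := by gcongr
    have h6 : η * n ≤ τ * n := by gcongr; exact H.η_le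
    have h7 : (0 : ℝ) ≤ k * ((Bs k ℓ τ E B \ B).card : ℝ) := by positivity
    linarith
  refine (pr_mono (Q := fun y => ((∀ i, y i ∈ B) ∧ {w} ∪ im y ∈ E) ∨
    ∃ i, y i ∈ Bs k ℓ τ E B \ B) fun y hy => ?_).trans ((pr_or _ _).trans (by linarith))
  by_cases h : ∀ i, y i ∈ B
  · exact .inl ⟨h, hy.2⟩
  · push Not at h
    obtain ⟨i, hi⟩ := h
    exact .inr ⟨i, mem_sdiff.2 ⟨hy.1 i, hi⟩⟩

lemma pr_edge_hit_le {ι : Type*} [Fintype ι] [DecidableEq ι] (hι : Fintype.card ι = k) (i : ι)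
    (W : Finset (Fin n)) :
    pr ι (fun x : ι → Fin n => x i ∈ W ∧ (∀ i, x i ∈ Bs k ℓ τ E B) ∧ im x ∈ E) ≤
      W.card / n * (2 * τ) := by
  classical
  have := H.toCtx.nonempty
  have hn := H.npos'
  obtain ⟨e, he⟩ : ∃ e : Unit ⊕ Fin (k - 1) ≃ ι, e (Sum.inl ()) = i := by
    have hk := H.hk
    have e0 : Unit ⊕ Fin (k - 1) ≃ ι := Fintype.equivOfCardEq (by simp [hι]; omega)
    exact ⟨e0.trans (Equiv.swap (e0 (Sum.inl ())) i), by simp⟩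
  have hκ : Fintype.card (Fin (k - 1)) + 1 = k := by
    have := H.hk
    rw [Fintype.card_fin]
    omega
  have h1 := pr_cons_le (κ := Fin (k - 1)) (M := 2 * τ) (W ∩ Bs k ℓ τ E B) (fun w y =>
    (∀ j, y j ∈ Bs k ℓ τ E B) ∧ {w} ∪ im y ∈ E) fun w hw =>
      H.pr_link_le (κ := Fin (k - 1)) hκ (mem_inter.1 hw).2
  have hτ := H.hτ
  have key := pr_equiv (V := Fin n) e.symm
    (fun x : ι → Fin n => x i ∈ W ∧ (∀ i, x i ∈ Bs k ℓ τ E B) ∧ im x ∈ E)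
  rw [← key]
  have h0 : ((W ∩ Bs k ℓ τ E B).card : ℝ) / n * (2 * τ) ≤ W.card / n * (2 * τ) := by
    have : ((W ∩ Bs k ℓ τ E B).card : ℝ) ≤ W.card := by
      exact_mod_cast card_le_card inter_subset_left
    gcongr
  refine le_trans (pr_mono fun z hz => ?_) (h1.trans h0)
  obtain ⟨h2, h3, h4⟩ := hz
  rw [← he, Function.comp_apply, Equiv.symm_apply_apply] at h2
  have h5 : ∀ j, z j ∈ Bs k ℓ τ E B := fun j => by simpa using h3 (e j)
  have h6 : {z (Sum.inl ())} ∪ im (fun j => z (Sum.inr j)) = im z := by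
    ext v
    simp only [mem_union, mem_singleton, mem_im]
    constructor
    · rintro (h | ⟨j, h⟩)
      exacts [⟨_, h.symm⟩, ⟨_, h⟩]
    · rintro ⟨⟨⟩ | j, h⟩
      exacts [.inl h.symm, .inr ⟨j, h⟩]
  refine ⟨mem_inter.2 ⟨h2, h5 _⟩, fun j => h5 _, ?_⟩
  rw [im_comp_equiv] at h4
  exact h6 ▸ h4

lemma pr_edge_ge {q : ℕ} (hq : 1 ≤ q) (hB : (Bs k ℓ τ E B).card = B.card + q) :
    (1 / 2 : ℝ) ^ k * (q / n) ≤
      pr (Fin (k - 2) ⊕ Fin 2) (fun x : Fin (k - 2) ⊕ Fin 2 → Fin n =>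
        (∀ i, x i ∈ Bs k ℓ τ E B) ∧ im x ∈ E) := by
  classical
  have := H.toCtx.nonempty
  have hn := H.npos'
  have hk := H.hk
  have hb := H.B_ge
  have hkn : 1000 * (k : ℝ) ≤ n := by exact_mod_cast H.toCtx.k_le
  have hq' : (1 : ℝ) ≤ q := by exact_mod_cast hq
  have h1 := pr_markov (V := Fin n) (ι := Fin (k - 2)) (κ := Fin 2)
    (fun x y => (∀ i, x i ∈ Bs k ℓ τ E B) ∧ (∀ i, y i ∈ Bs k ℓ τ E B) ∧ im x ∪ im y ∈ E)
    (q / (2 * n))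
  have h2 : ∀ x : Fin (k - 2) → Fin n, (∀ i, x i ∈ Bs k ℓ τ E B) → Function.Injective x →
      (q / (2 * n) : ℝ) < pr (Fin 2) (fun y => (∀ i, x i ∈ Bs k ℓ τ E B) ∧
        (∀ i, y i ∈ Bs k ℓ τ E B) ∧ im x ∪ im y ∈ E) := by
    intro x hx hinj
    have c1 : (im x).card = k - 2 := by simpa using card_im_iff.2 hinj
    have c2 := H.toCtx.pairs_ge hB c1 (im_subset.2 hx)
    have c3 := choose_two_add (B.card - (k - 2)) q
    set F := (powersetCard 2 (Bs k ℓ τ E B \ im x)).filter fun P => im x ∪ P ∈ E with hF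
    have c4 : q * (B.card - (k - 2)) ≤ F.card := by omega
    have c5 : (2 * n / 3 : ℝ) < ((B.card - (k - 2) : ℕ) : ℝ) := by
      have : (B.card : ℝ) ≤ ((B.card - (k - 2) : ℕ) : ℝ) + k := by exact_mod_cast (by omega)
      linarith
    have c6 : (q : ℝ) * (2 * n / 3) < F.card := by
      refine lt_of_lt_of_le ?_ (by exact_mod_cast c4 : (q : ℝ) * ((B.card - (k - 2) : ℕ) : ℝ) ≤ _)
      gcongr
    have c7 : F.card ≤ {y : Fin 2 → Fin n | (∀ i, x i ∈ Bs k ℓ τ E B) ∧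
        (∀ i, y i ∈ Bs k ℓ τ E B) ∧ im x ∪ im y ∈ E}.ncard := by
      rw [← Set.ncard_coe_finset]
      refine (Set.ncard_le_ncard ?_ (Set.toFinite _)).trans
        (Set.ncard_image_le (f := fun y : Fin 2 → Fin n => im y) (Set.toFinite _))
      intro P hP
      simp only [hF, coe_filter, Set.mem_ofPred_eq, mem_powersetCard] at hP
      obtain ⟨⟨hP1, hP2⟩, hP3⟩ := hP
      obtain ⟨u, v, -, rfl⟩ := card_eq_two.1 hP2
      have him : im ![u, v] = {u, v} := by
        ext w; simp [eq_comm]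
      refine ⟨![u, v], ⟨hx, ?_, by simpa only [him] using hP3⟩, him⟩
      intro i
      have : ![u, v] i ∈ im ![u, v] := apply_mem_im _ _
      rw [him] at this
      exact (mem_sdiff.1 (hP1 this)).1
    unfold pr
    rw [Fintype.card_fin, Fintype.card_fin, div_lt_div_iff₀ (by positivity) (by positivity)]
    have c8 : (q : ℝ) * (2 * n / 3) < ({y : Fin 2 → Fin n | (∀ i, x i ∈ Bs k ℓ τ E B) ∧
        (∀ i, y i ∈ Bs k ℓ τ E B) ∧ im x ∪ im y ∈ E}.ncard : ℝ) :=
      lt_of_lt_of_le c6 (by exact_mod_cast c7)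
    have c9 : (q : ℝ) * n ^ 2 ≤ (q * (2 * n / 3)) * (2 * n) := by
      have : (0 : ℝ) ≤ q * n ^ 2 := by positivity
      nlinarith
    refine lt_of_le_of_lt c9 ?_
    gcongr
  have h3 : pr (Fin (k - 2)) (fun x : Fin (k - 2) → Fin n => (∀ i, x i ∈ Bs k ℓ τ E B)) -
      pr (Fin (k - 2)) (fun x : Fin (k - 2) → Fin n => ¬ Function.Injective x) ≤
      pr (Fin (k - 2)) (fun x : Fin (k - 2) → Fin n => (q / (2 * n) : ℝ) <
        pr (Fin 2) (fun y => (∀ i, x i ∈ Bs k ℓ τ E B) ∧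
        (∀ i, y i ∈ Bs k ℓ τ E B) ∧ im x ∪ im y ∈ E)) :=
    (pr_sub_le _ _).trans (pr_mono fun x hx => h2 x hx.1 (not_not.1 hx.2))
  have h4 : (1 / 2 : ℝ) ^ (k - 2) ≤
      pr (Fin (k - 2)) (fun x : Fin (k - 2) → Fin n => (∀ i, x i ∈ Bs k ℓ τ E B)) := by
    have h41 : (1 / 2 : ℝ) ≤ (Bs k ℓ τ E B).card / n := by
      rw [hB, le_div_iff₀ hn]; push_cast; linarith
    rw [pr_pi (ι := Fin (k - 2)) (fun _ => Bs k ℓ τ E B)]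
    simp only [prod_const, card_univ, Fintype.card_fin]
    gcongr
  have h5 : pr (Fin (k - 2)) (fun x : Fin (k - 2) → Fin n => ¬ Function.Injective x) ≤
      (1 / 2 : ℝ) ^ k := by
    refine pr_not_injective_le.trans ?_
    rw [Fintype.card_fin, Fintype.card_fin]
    have h51 : ((k - 2 : ℕ) : ℝ) ≤ k := by exact_mod_cast Nat.sub_le _ _
    calc ((k - 2 : ℕ) : ℝ) ^ 2 * (1 / n) ≤ (k : ℝ) ^ 2 * (1 / n) := by gcongr
      _ = (k : ℝ) ^ 2 / n := by ring
      _ ≤ τ := by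
        have := H.k_sq_div_le; have := H.ζ_le; have := H.eps_le 0; have := H.hζ
        linarith
      _ ≤ 64 * k * τ := by have := H.k3; have := H.hτ; nlinarith
      _ ≤ (1 / 2) ^ (2 * k) := H.hτ'
      _ ≤ _ := pow_le_pow_of_le_one (by norm_num) (by norm_num) (by omega)
  have h6 : (1 / 2 : ℝ) ^ (k - 2) = 4 * (1 / 2) ^ k := by
    conv_rhs => rw [show k = k - 2 + 2 by omega, pow_add]
    ring
  have h7 : pr (Fin (k - 2) ⊕ Fin 2) (fun z : Fin (k - 2) ⊕ Fin 2 → Fin n =>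
      (∀ i, (z ∘ Sum.inl) i ∈ Bs k ℓ τ E B) ∧ (∀ i, (z ∘ Sum.inr) i ∈ Bs k ℓ τ E B) ∧
        im (z ∘ Sum.inl) ∪ im (z ∘ Sum.inr) ∈ E) ≤
      pr (Fin (k - 2) ⊕ Fin 2) (fun x : Fin (k - 2) ⊕ Fin 2 → Fin n =>
        (∀ i, x i ∈ Bs k ℓ τ E B) ∧ im x ∈ E) := by
    refine pr_mono fun x hx => ?_
    rw [im_sum]
    exact ⟨fun i => i.casesOn hx.1 hx.2.1, hx.2.2⟩
  refine le_trans ?_ (h1.trans h7)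
  have h8 : (1 / 2 : ℝ) ^ k * (q / n) = 2 * (1 / 2 : ℝ) ^ k * (q / (2 * n)) := by field_simp
  rw [h8]
  gcongr
  have : (0 : ℝ) < (1 / 2) ^ k := by positivity
  linarith

lemma exists_edge_avoiding {q : ℕ} (hq : 1 ≤ q) (hB : (Bs k ℓ τ E B).card = B.card + q)
    {W : Finset (Fin n)} (hW : W.card ≤ 4 * k * q) :
    ∃ e ∈ E, e ⊆ Bs k ℓ τ E B ∧ Disjoint e W := by
  classical
  have := H.toCtx.nonempty
  have hn := H.npos'
  have hk := H.hk
  have hτ := H.hτ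
  have hq' : (1 : ℝ) ≤ q := by exact_mod_cast hq
  have h1 := H.pr_edge_ge hq hB
  have h2 : pr (Fin (k - 2) ⊕ Fin 2) (fun x : Fin (k - 2) ⊕ Fin 2 → Fin n =>
      ∃ i ∈ univ, x i ∈ W ∧ (∀ i, x i ∈ Bs k ℓ τ E B) ∧ im x ∈ E) ≤
      k * (W.card / n * (2 * τ)) := by
    refine (pr_exists univ _).trans ((sum_le_sum fun i _ =>
      H.pr_edge_hit_le (by simp; omega) i W).trans ?_)
    rw [sum_const, nsmul_eq_mul, card_univ]
    simp only [Fintype.card_sum, Fintype.card_fin]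
    rw [show k - 2 + 2 = k by omega]
  have h3 : k * (W.card / n * (2 * τ)) < (1 / 2 : ℝ) ^ k * (q / n) := by
    have hW' : (W.card : ℝ) ≤ 4 * k * q := by exact_mod_cast hW
    have e1 : (k : ℝ) ≤ 2 ^ k := by exact_mod_cast (Nat.lt_two_pow_self).le
    have e2 : 64 * k * τ * 2 ^ k ≤ (1 / 2) ^ k := by
      calc 64 * k * τ * 2 ^ k ≤ (1 / 2) ^ (2 * k) * 2 ^ k := by gcongr; exact H.hτ'
        _ = (1 / 2) ^ k := by
          rw [two_mul, pow_add, mul_assoc, ← mul_pow]; norm_num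
    have e3 : 8 * (k : ℝ) * k * τ < (1 / 2) ^ k := by
      refine lt_of_lt_of_le ?_ e2
      have : (0 : ℝ) < k * τ := by have := H.k3; positivity
      nlinarith [mul_le_mul_of_nonneg_left e1 this.le, mul_pos this (show (0 : ℝ) < 2 ^ k by positivity)]
    calc k * (W.card / n * (2 * τ)) ≤ k * (4 * k * q / n * (2 * τ)) := by gcongr
      _ = 8 * (k : ℝ) * k * τ * (q / n) := by ring
      _ < _ := by gcongr
  obtain ⟨x, ⟨hx1, hx2⟩, hx3⟩ := exists_of_pr_lt (lt_of_le_of_lt h2 (lt_of_lt_of_le h3 h1))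
  refine ⟨im x, hx2, im_subset.2 hx1, disjoint_left.2 fun v hv hvW => ?_⟩
  obtain ⟨i, rfl⟩ := mem_im.1 hv
  exact hx3 ⟨i, mem_univ _, hvW, hx1, hx2⟩

lemma exists_matching {q : ℕ} (hq : 1 ≤ q) (hB : (Bs k ℓ τ E B).card = B.card + q) (m : ℕ)
    (hm : m ≤ 4 * q + 1) :
    ∃ l : List (Finset (Fin n)), l.length = m ∧ (∀ e ∈ l, e ∈ E ∧ e ⊆ Bs k ℓ τ E B) ∧
      l.Pairwise Disjoint := by
  induction m with
  | zero => exact ⟨[], by simp⟩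
  | succ m ih =>
    obtain ⟨l, hl, hlE, hld⟩ := ih (by omega)
    have hc : (l.toFinset.biUnion id).card ≤ 4 * k * q := by
      refine (card_biUnion_le_card_mul _ _ k fun e he =>
        (H.unif e (hlE e (List.mem_toFinset.1 he)).1).le).trans ?_
      have := List.toFinset_card_le l
      calc _ ≤ (4 * q) * k := Nat.mul_le_mul_right _ (by omega)
        _ = _ := by ring
    obtain ⟨e, he, heB, hed⟩ := H.exists_edge_avoiding hq hB hc
    refine ⟨e :: l, by simp [hl], ?_, List.pairwise_cons.2 ⟨fun e' he' => ?_, hld⟩⟩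
    · rintro e' he'
      rcases List.mem_cons.1 he' with rfl | he'
      exacts [⟨he, heB⟩, hlE _ he']
    · exact hed.mono_right (subset_biUnion_of_mem id (List.mem_toFinset.2 he'))

end Par

end Matching

section Free

variable {V : Type*} [Fintype V] [DecidableEq V] {ι : Type*} [Fintype ι] [DecidableEq ι]

lemma exists_free [Nonempty V] (D : Finset V) (G : Finset V → Finset V) (hG : ∀ S, (G S).card ≤ 4)
    (hD : Fintype.card V ≤ 2 * D.card)
    (hV : (4 * Fintype.card ι * 2 ^ Fintype.card ι + Fintype.card ι ^ 2) * 2 ^ Fintype.card ι <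
      Fintype.card V) :
    ∃ x : ι → V, Function.Injective x ∧ (∀ i, x i ∈ D) ∧
      ∀ I : Finset ι, ∀ j ∉ I, x j ∉ G (I.image x) := by
  have hn : (0 : ℝ) < Fintype.card V := by exact_mod_cast Fintype.card_pos
  set N := Fintype.card ι with hN
  have h1 : pr ι (fun x : ι → V => ∃ p ∈ (univ : Finset (Finset ι × ι)),
      p.2 ∉ p.1 ∧ x p.2 ∈ G (p.1.image x)) ≤ 2 ^ N * N * (4 / Fintype.card V) := by
    refine (pr_exists univ _).trans ((sum_le_sum fun p _ => ?_).trans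
      (b := ∑ p : Finset ι × ι, (4 / Fintype.card V : ℝ)) ?_)
    · refine pr_coord p.2 _ (c := 4) fun z => ?_
      by_cases hp : p.2 ∈ p.1
      · simp [hp]
      refine le_trans (b := ((G (p.1.image z) : Finset V) : Set V).ncard) ?_
        (by rw [Set.ncard_coe_finset]; exact hG _)
      refine Set.ncard_le_ncard ?_ (Set.toFinite _)
      rintro v ⟨w, ⟨-, hw⟩, rfl, hwz⟩
      have : p.1.image w = p.1.image z :=
        image_congr fun i hi => hwz i fun h => hp (h ▸ hi)
      rw [this] at hw
      exact hw
    · simp [hN]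
  have h2 := pr_not_injective_le (V := V) (ι := ι)
  have h3 : (1 / 2 : ℝ) ^ N ≤ pr ι (fun x : ι → V => ∀ i, x i ∈ D) := by
    have h41 : (1 / 2 : ℝ) ≤ D.card / Fintype.card V := by
      have : (Fintype.card V : ℝ) ≤ 2 * D.card := by exact_mod_cast hD
      rw [le_div_iff₀ hn]; linarith
    rw [pr_pi (ι := ι) (fun _ => D)]
    simp only [prod_const, card_univ]
    gcongr
  have h4 : (2 : ℝ) ^ N * N * (4 / Fintype.card V) + N ^ 2 * (1 / Fintype.card V) <
      (1 / 2) ^ N := by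
    have : ((4 * N * 2 ^ N + N ^ 2) * 2 ^ N : ℝ) < Fintype.card V := by exact_mod_cast hV
    rw [one_div_pow, lt_div_iff₀ (by positivity)]
    calc _ = ((4 * N * 2 ^ N + N ^ 2) * 2 ^ N : ℝ) / Fintype.card V := by ring
      _ < 1 := by rwa [div_lt_one hn]
  have h5 := (pr_or (fun x : ι → V => ∃ p ∈ (univ : Finset (Finset ι × ι)),
      p.2 ∉ p.1 ∧ x p.2 ∈ G (p.1.image x)) (fun x => ¬ Function.Injective x))
  obtain ⟨x, hx, hx'⟩ := exists_of_pr_lt (lt_of_le_of_lt (h5.trans (add_le_add h1 h2))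
    (h4.trans_le h3))
  push Not at hx'
  exact ⟨x, hx'.2, hx, fun I j hj h => hx'.1 (I, j) (mem_univ _) hj h⟩

omit [Fintype V] [Fintype ι] in
lemma card_inter_of_free {x : ι → V} (hx : Function.Injective x) {I J : Finset ι}
    {P Q : Finset V} (hP : ∀ i, x i ∉ P) (hQ : ∀ i, x i ∉ Q) :
    ((I.image x ∪ P) ∩ (J.image x ∪ Q)).card = (I ∩ J).card + (P ∩ Q).card := by
  have h : (I.image x ∪ P) ∩ (J.image x ∪ Q) = (I ∩ J).image x ∪ (P ∩ Q) := by
    rw [image_inter _ _ hx]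
    ext v
    simp only [mem_inter, mem_union, mem_image]
    constructor
    · rintro ⟨⟨i, hi, rfl⟩ | h, ⟨j, hj, hij⟩ | h'⟩
      · exact .inl ⟨⟨i, hi, rfl⟩, ⟨j, hj, hij⟩⟩
      · exact absurd h' (hQ _)
      · exact absurd (hij ▸ h) (hP _)
      · exact .inr ⟨h, h'⟩
    · rintro (⟨h, h'⟩ | ⟨h, h'⟩)
      exacts [⟨.inl h, .inl h'⟩, ⟨.inr h, .inr h'⟩]
  rw [h, card_union_of_disjoint, card_image_of_injective _ hx]
  rw [disjoint_left]
  rintro v hv hv'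
  obtain ⟨i, -, rfl⟩ := mem_image.1 hv
  exact hP i (mem_inter.1 hv').1

end Free

section Pairs

variable {V : Type*} [DecidableEq V]

/-- The first `m` entries of row `r` in the grid `Fin 8 × Fin k`. -/
def row (k : ℕ) (r : Fin 8) (m : ℕ) : Finset (Fin 8 × Fin k) :=
  {r} ×ˢ univ.filter fun i : Fin k => (i : ℕ) < m

lemma mem_row {k m : ℕ} {r : Fin 8} {i : Fin 8 × Fin k} :
    i ∈ row k r m ↔ i.1 = r ∧ (i.2 : ℕ) < m := by
  rw [row, mem_product]
  simp

lemma card_row {k m : ℕ} (r : Fin 8) (hm : m ≤ k) : (row k r m).card = m := by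
  simp [row, Fin.card_filter_val_lt, hm]

lemma disjoint_row {k m m' : ℕ} {r r' : Fin 8} (h : r ≠ r') : Disjoint (row k r m) (row k r' m') := by
  rw [disjoint_left]
  intro i hi hi'
  exact h ((mem_row.1 hi).1.symm.trans (mem_row.1 hi').1)

lemma notMem_of_shared {P Q R : Finset V} (hP : P.card = 2) (hQ : Q.card = 2)
    (hR : R.card = 2) {x : V} (hxP : x ∈ P) (hxQ : x ∈ Q) (hPQ : (P ∩ Q).card ≠ 2)
    (h1 : (R ∩ P).card ≠ 1) (h2 : (R ∩ Q).card ≠ 1) : x ∉ R := by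
  intro hxR
  have key : ∀ {S : Finset V}, S.card = 2 → x ∈ S → (R ∩ S).card ≠ 1 → R = S := by
    intro S hS hxS h
    have h3 : 0 < (R ∩ S).card := card_pos.2 ⟨x, mem_inter.2 ⟨hxR, hxS⟩⟩
    have h4 := card_le_card (inter_subset_left : R ∩ S ⊆ R)
    have h5 : R ∩ S = R := eq_of_subset_of_card_le inter_subset_left (by omega)
    exact eq_of_subset_of_card_le (inter_eq_left.1 h5) (by omega)
  have e1 := key hP hxP h1
  have e2 := key hQ hxQ h2
  rw [← e1, ← e2, inter_self] at hPQ
  exact hPQ hR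

lemma exists_other_of_card_eq_two {P : Finset V} (hP : P.card = 2) {x : V} (hx : x ∈ P) :
    ∃ y, ∀ w ∈ P, w ≠ x → w = y := by
  obtain ⟨y, hy⟩ := card_eq_one.1 (show (P.erase x).card = 1 by rw [card_erase_of_mem hx, hP])
  refine ⟨y, fun w hw hwx => ?_⟩
  have : w ∈ P.erase x := mem_erase.2 ⟨hwx, hw⟩
  rwa [hy, mem_singleton] at this

set_option maxHeartbeats 1000000 in
lemma exists_inter_card {k ℓ : ℕ} (hl : 2 ≤ ℓ) (hlk : 2 * ℓ < k)
    (g : Finset (Fin 8 × Fin k) → Finset V) (hg : ∀ I, I.card = k - 2 → (g I).card = 2) :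
    ∃ I J, I.card = k - 2 ∧ J.card = k - 2 ∧
      ((I ∩ J).card + (g I ∩ g J).card = 0 ∨ (I ∩ J).card + (g I ∩ g J).card = ℓ) := by
  by_contra! hcon
  let z : Fin k := ⟨0, by omega⟩
  let o : Fin k := ⟨1, by omega⟩
  have hzo : z ≠ o := by simp [z, o]
  let C := row k 3 (ℓ - 2)
  let O := row k 7 (k - 2)
  let S : Fin 8 → Finset (Fin 8 × Fin k) := fun p => C ∪ row k p (k - ℓ)
  have hC : C.card = ℓ - 2 := card_row _ (by omega)
  have hO : O.card = k - 2 := card_row _ (by omega)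
  have hS : ∀ p, p ≠ 3 → (S p).card = k - 2 := by
    intro p hp
    rw [card_union_of_disjoint (disjoint_row hp.symm), hC, card_row _ (by omega)]
    omega
  have hmeet : ∀ I, I.card = k - 2 → Disjoint I O → ∃ x ∈ g O, x ∈ g I := by
    intro I hI hdis
    by_contra! h
    refine (hcon I O hI hO).1 ?_
    rw [disjoint_iff_inter_eq_empty.1 hdis, disjoint_iff_inter_eq_empty.1
      (disjoint_right.2 h)]
    rfl
  have hSO : ∀ p, p ≠ 7 → Disjoint (S p) O := fun p hp =>
    disjoint_union_left.2 ⟨disjoint_row (by decide), disjoint_row hp⟩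
  obtain ⟨x, y, hxy, hxy'⟩ := card_eq_two.1 (hg O hO)
  obtain ⟨p, q, hpq, hp, hq, x, hx, hxp, hxq⟩ : ∃ p q : Fin 8, p ≠ q ∧ (p : ℕ) < 3 ∧ (q : ℕ) < 3 ∧
      ∃ x ∈ g O, x ∈ g (S p) ∧ x ∈ g (S q) := by
    obtain ⟨x0, h0, h0'⟩ := hmeet (S 0) (hS _ (by decide)) (hSO _ (by decide))
    obtain ⟨x1, h1, h1'⟩ := hmeet (S 1) (hS _ (by decide)) (hSO _ (by decide))
    obtain ⟨x2, h2, h2'⟩ := hmeet (S 2) (hS _ (by decide)) (hSO _ (by decide))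
    by_cases e01 : x0 = x1
    · exact ⟨0, 1, by decide, by decide, by decide, x0, h0, h0', e01 ▸ h1'⟩
    by_cases e02 : x0 = x2
    · exact ⟨0, 2, by decide, by decide, by decide, x0, h0, h0', e02 ▸ h2'⟩
    by_cases e12 : x1 = x2
    · exact ⟨1, 2, by decide, by decide, by decide, x1, h1, h1', e12 ▸ h2'⟩
    exfalso
    rw [hxy'] at h0 h1 h2
    simp only [mem_insert, mem_singleton] at h0 h1 h2
    grind
  clear hxy hxy'
  let T : Fin k → Fin k → Fin 8 → Finset (Fin 8 × Fin k) := fun i j r =>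
    C ∪ ({(p, i), (q, j)} ∪ row k r (k - ℓ - 2))
  have hT : ∀ (i j : Fin k) (r : Fin 8), 3 < (r : ℕ) → (T i j r).card = k - 2 := by
    intro i j r hr
    have d1 : Disjoint ({(p, i), (q, j)} : Finset (Fin 8 × Fin k)) (row k r (k - ℓ - 2)) := by
      rw [disjoint_left]
      intro v hv hv'
      have := (mem_row.1 hv').1
      simp only [mem_insert, mem_singleton] at hv
      rcases hv with rfl | rfl <;> simp at this <;> omega
    have d2 : Disjoint C ({(p, i), (q, j)} ∪ row k r (k - ℓ - 2)) := by
      rw [disjoint_left]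
      intro v hv hv'
      have := (mem_row.1 hv).1
      simp only [mem_union, mem_insert, mem_singleton, mem_row] at hv'
      rcases hv' with (rfl | rfl) | h <;> simp at * <;> omega
    rw [card_union_of_disjoint d2, card_union_of_disjoint d1, hC, card_row _ (by omega),
      card_pair (by simp [hpq])]
    omega
  have hTO : ∀ (i j : Fin k) (r : Fin 8), 3 < (r : ℕ) → (r : ℕ) < 7 → Disjoint (T i j r) O := by
    intro i j r hr hr'
    rw [disjoint_left]
    intro v hv hv'
    have := (mem_row.1 hv').1
    simp only [T, C, mem_union, mem_insert, mem_singleton, mem_row] at hv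
    rcases hv with h | (rfl | rfl) | h <;> simp at * <;> omega
  have hins : ∀ a : Fin 8 × Fin k, a.1 ≠ 3 → (insert a C).card = ℓ - 1 := by
    intro a ha
    rw [card_insert_of_notMem fun h => ha (mem_row.1 h).1, hC]
    omega
  have hp3 : p ≠ 3 := by rintro rfl; simp at hp
  have hq3 : q ≠ 3 := by rintro rfl; simp at hq
  have hTSp : ∀ (i j : Fin k) (r : Fin 8), (i : ℕ) < 2 → 3 < (r : ℕ) → (T i j r ∩ S p).card = ℓ - 1 := by
    intro i j r hi hr
    rw [← hins (p, i) hp3]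
    congr 1
    ext v
    simp only [T, S, C, mem_inter, mem_union, mem_insert, mem_singleton, mem_row]
    grind
  have hTSq : ∀ (i j : Fin k) (r : Fin 8), (j : ℕ) < 2 → 3 < (r : ℕ) → (T i j r ∩ S q).card = ℓ - 1 := by
    intro i j r hi hr
    rw [← hins (q, j) hq3]
    congr 1
    ext v
    simp only [T, S, C, mem_inter, mem_union, mem_insert, mem_singleton, mem_row]
    grind
  have hSS : S p ∩ S q = C := by
    ext v
    simp only [S, C, mem_inter, mem_union, mem_row]
    grind
  have hTT : T z z 4 ∩ T o o 5 = C := by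
    ext v
    simp only [T, C, mem_inter, mem_union, mem_insert, mem_singleton, mem_row]
    grind
  have hT4 : T z o 6 ∩ T z z 4 = insert (p, z) C := by
    ext v
    simp only [T, C, mem_inter, mem_union, mem_insert, mem_singleton, mem_row]
    grind
  have hT5 : T z o 6 ∩ T o o 5 = insert (q, o) C := by
    ext v
    simp only [T, C, mem_inter, mem_union, mem_insert, mem_singleton, mem_row]
    grind
  have n2 : ∀ I J, I.card = k - 2 → J.card = k - 2 → I ∩ J = C → (g I ∩ g J).card ≠ 2 := by
    intro I J hI hJ h h'
    refine (hcon I J hI hJ).2 ?_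
    rw [h, h', hC]; omega
  have n1 : ∀ I J, I.card = k - 2 → J.card = k - 2 → (I ∩ J).card = ℓ - 1 →
      (g I ∩ g J).card ≠ 1 := by
    intro I J hI hJ h h'
    refine (hcon I J hI hJ).2 ?_
    rw [h, h']; omega
  have hSp := hS p hp3
  have hSq := hS q hq3
  have hz : (z : ℕ) < 2 := by simp [z]
  have ho : (o : ℕ) < 2 := by simp [o]
  have hx' : ∀ (i j : Fin k) (r : Fin 8), (i : ℕ) < 2 → (j : ℕ) < 2 → 3 < (r : ℕ) → x ∉ g (T i j r) := by
    intro i j r hi hj hr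
    have hTc := hT i j r hr
    exact notMem_of_shared (hg _ hSp) (hg _ hSq) (hg _ hTc) hxp hxq (n2 _ _ hSp hSq hSS)
      (n1 _ _ hTc hSp (hTSp _ _ _ hi hr)) (n1 _ _ hTc hSq (hTSq _ _ _ hj hr))
  obtain ⟨y, hy⟩ := exists_other_of_card_eq_two (hg O hO) hx
  have hmeet' : ∀ (i j : Fin k) (r : Fin 8), (i : ℕ) < 2 → (j : ℕ) < 2 → 3 < (r : ℕ) → (r : ℕ) < 7 →
      y ∈ g (T i j r) := by
    intro i j r hi hj hr hr'
    obtain ⟨w, hw, hw'⟩ := hmeet _ (hT i j r hr) (hTO i j r hr hr')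
    rwa [← hy w hw fun h => hx' i j r hi hj hr (h ▸ hw')]
  have c4 := hT z z 4 (by decide)
  have c5 := hT o o 5 (by decide)
  have c6 := hT z o 6 (by decide)
  exact notMem_of_shared (hg _ c4) (hg _ c5) (hg _ c6) (hmeet' z z 4 hz hz (by decide) (by decide))
    (hmeet' o o 5 ho ho (by decide) (by decide)) (n2 _ _ c4 c5 hTT)
    (n1 _ _ c6 c4 (by rw [hT4, hins _ hp3])) (n1 _ _ c6 c5 (by rw [hT5, hins _ hq3]))
    (hmeet' z o 6 hz ho (by decide) (by decide))

end Pairs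

variable {k ℓ c n : ℕ} {E : Finset (Finset (Fin n))} {A B R : Finset (Fin n)} {τ η ζ : ℝ}

/-- A size beyond which `exists_free` applies to the index set `Fin 8 × Fin k`. -/
def freeBound (k : ℕ) : ℕ := (4 * (8 * k) * 2 ^ (8 * k) + (8 * k) ^ 2) * 2 ^ (8 * k)

lemma Par.exists_edge_pair (H : Par k ℓ c n E A B τ η ζ) (hB : (Bs k ℓ τ E B).card = B.card)
    (hc : ℓ = 1 → c = 2) (hn : freeBound k < n) :
    ∃ e₀ ∈ E, ∃ e₁ ∈ E, e₀ ⊆ Bs k ℓ τ E B ∧ e₁ ⊆ Bs k ℓ τ E B ∧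
      (Disjoint e₀ e₁ ∨ (e₀ ∩ e₁).card = ℓ) := by
  have := H.toCtx.nonempty
  have hk := H.hk
  have hl := H.hl
  have hlk := H.hlk
  have hb := H.B_ge
  have hF : ∀ S : Finset (Fin n), ∃ P Q : Finset (Fin n), P.card = 2 ∧ Q.card = 2 ∧
      (S.card = k - 2 → S ⊆ Bs k ℓ τ E B → P ⊆ Bs k ℓ τ E B \ S ∧ Q ⊆ Bs k ℓ τ E B \ S ∧
        S ∪ P ∈ E ∧ S ∪ Q ∈ E ∧ (ℓ = 1 → P ≠ Q)) := by
    intro S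
    by_cases hS : S.card = k - 2 ∧ S ⊆ Bs k ℓ τ E B
    · have h := H.toCtx.pairs_ge (q := 0) hB hS.1 hS.2
      by_cases h1 : ℓ = 1
      · rw [if_pos ⟨hc h1, h1⟩] at h
        obtain ⟨P, hP, Q, hQ, hPQ⟩ := one_lt_card.1 (show 1 < ((powersetCard 2
          (Bs k ℓ τ E B \ S)).filter fun P => S ∪ P ∈ E).card by simp only [add_zero] at h; omega)
        simp only [mem_filter, mem_powersetCard] at hP hQ
        exact ⟨P, Q, hP.1.2, hQ.1.2, fun _ _ => ⟨hP.1.1, hQ.1.1, hP.2, hQ.2, fun _ => hPQ⟩⟩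
      · obtain ⟨P, hP⟩ := card_pos.1 (show 0 < ((powersetCard 2
          (Bs k ℓ τ E B \ S)).filter fun P => S ∪ P ∈ E).card by simp only [add_zero] at h; omega)
        simp only [mem_filter, mem_powersetCard] at hP
        exact ⟨P, P, hP.1.2, hP.1.2, fun _ _ => ⟨hP.1.1, hP.1.1, hP.2, hP.2, fun h => absurd h h1⟩⟩
    · obtain ⟨P, -, hP⟩ := exists_subset_card_eq (s := (univ : Finset (Fin n))) (n := 2) (by
        have := H.toCtx.k_le; simp; omega)
      exact ⟨P, P, hP, hP, fun h h' => absurd ⟨h, h'⟩ hS⟩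
  choose P Q hP hQ hPQ using hF
  obtain ⟨x, hx, hxB, hfree⟩ := exists_free (ι := Fin 8 × Fin k) (Bs k ℓ τ E B)
    (fun S => P S ∪ Q S)
    (fun S => (card_union_le _ _).trans (by rw [hP, hQ]))
    (by rw [Fintype.card_fin, hB]
        have : (n : ℝ) ≤ 2 * B.card := by
          have := Nat.cast_nonneg (α := ℝ) n
          linarith
        exact_mod_cast this)
    (by simpa [freeBound] using hn)
  have key : ∀ I : Finset (Fin 8 × Fin k), I.card = k - 2 →
      P (I.image x) ⊆ Bs k ℓ τ E B \ I.image x ∧ Q (I.image x) ⊆ Bs k ℓ τ E B \ I.image x ∧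
        I.image x ∪ P (I.image x) ∈ E ∧ I.image x ∪ Q (I.image x) ∈ E ∧
        (ℓ = 1 → P (I.image x) ≠ Q (I.image x)) := fun I hI =>
    hPQ _ (by rw [card_image_of_injective _ hx, hI]) (image_subset_iff.2 fun i _ => hxB i)
  have hsub : ∀ I : Finset (Fin 8 × Fin k), I.image x ⊆ Bs k ℓ τ E B := fun I =>
    image_subset_iff.2 fun i _ => hxB i
  have hPf : ∀ I : Finset (Fin 8 × Fin k), I.card = k - 2 → ∀ i, x i ∉ P (I.image x) := by
    intro I hI i hi
    by_cases h : i ∈ I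
    · exact (mem_sdiff.1 ((key I hI).1 hi)).2 (mem_image_of_mem _ h)
    · exact hfree I i h (mem_union_left _ hi)
  have hQf : ∀ I : Finset (Fin 8 × Fin k), I.card = k - 2 → ∀ i, x i ∉ Q (I.image x) := by
    intro I hI i hi
    by_cases h : i ∈ I
    · exact (mem_sdiff.1 ((key I hI).2.1 hi)).2 (mem_image_of_mem _ h)
    · exact hfree I i h (mem_union_right _ hi)
  have conc : ∀ {I J : Finset (Fin 8 × Fin k)} {X Y : Finset (Fin n)}, I.image x ∪ X ∈ E →
      J.image x ∪ Y ∈ E → X ⊆ Bs k ℓ τ E B \ I.image x → Y ⊆ Bs k ℓ τ E B \ J.image x →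
      (∀ i, x i ∉ X) → (∀ i, x i ∉ Y) →
      ((I ∩ J).card + (X ∩ Y).card = 0 ∨ (I ∩ J).card + (X ∩ Y).card = ℓ) →
      ∃ e₀ ∈ E, ∃ e₁ ∈ E, e₀ ⊆ Bs k ℓ τ E B ∧ e₁ ⊆ Bs k ℓ τ E B ∧
      (Disjoint e₀ e₁ ∨ (e₀ ∩ e₁).card = ℓ) := by
    intro I J X Y h0 h1 hX hY hX' hY' h
    refine ⟨_, h0, _, h1, union_subset (hsub I) (hX.trans sdiff_subset),
      union_subset (hsub J) (hY.trans sdiff_subset), ?_⟩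
    rw [disjoint_iff_inter_eq_empty, ← card_eq_zero, card_inter_of_free hx hX' hY']
    exact h
  by_cases h1 : ℓ = 1
  · by_contra hcon
    have hI : (row k 0 (k - 2)).card = k - 2 := card_row _ (by omega)
    have hJ : (row k 1 (k - 2)).card = k - 2 := card_row _ (by omega)
    have hIJ : (row k 0 (k - 2) ∩ row k 1 (k - 2)).card = 0 := by
      rw [card_eq_zero]
      exact disjoint_iff_inter_eq_empty.1 (disjoint_row (by decide))
    have heq : ∀ {X Y : Finset (Fin n)}, X.card = 2 → Y.card = 2 →
        ¬ ((X ∩ Y).card = 0 ∨ (X ∩ Y).card = ℓ) → X = Y := by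
      intro X Y hX hY h
      have := card_le_card (inter_subset_left : X ∩ Y ⊆ X)
      have h5 : X ∩ Y = X := eq_of_subset_of_card_le inter_subset_left (by omega)
      exact eq_of_subset_of_card_le (inter_eq_left.1 h5) (by omega)
    have k0 := key _ hI
    have k1 := key _ hJ
    refine k0.2.2.2.2 h1 ((heq (hP _) (hP _) fun h => hcon ?_).trans
      (heq (hQ _) (hP ((row k 1 (k - 2)).image x)) fun h => hcon ?_).symm)
    · exact conc k0.2.2.1 k1.2.2.1 k0.1 k1.1 (hPf _ hI) (hPf _ hJ) (by rwa [hIJ, zero_add])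
    · exact conc k0.2.2.2.1 k1.2.2.1 k0.2.1 k1.1 (hQf _ hI) (hPf _ hJ) (by rwa [hIJ, zero_add])
  · obtain ⟨I, J, hI, hJ, h⟩ := exists_inter_card (ℓ := ℓ) (k := k) (by omega) hlk
      (fun I => P (I.image x)) fun I _ => hP _
    exact conc (key I hI).2.2.1 (key J hJ).2.2.1 (key I hI).1 (key J hJ).1 (hPf I hI) (hPf J hJ) h

section Assembly

variable {k ℓ c n : ℕ} {E : Finset (Finset (Fin n))} {A B R : Finset (Fin n)} {τ η ζ : ℝ}

namespace Par

variable (H : Par k ℓ c n E A B τ η ζ)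
include H

lemma k_mul_η_le : 6400 * (k : ℝ) * η ≤ 1 := by
  have h1 := H.hη'; have h2 := H.eps_le 0; have h3 := H.τ_lt
  linarith

lemma n_le_card_As : (n : ℝ) ≤ 8 * k * ((As k ℓ τ E B).card : ℝ) := by
  have hn := H.npos'
  have h1 := H.card_A_diff
  have h2 : (n : ℝ) ≤ 4 * k * A.card := by exact_mod_cast H.toCtx.le_card
  have h3 : (A.card : ℝ) ≤ (A \ As k ℓ τ E B).card + (As k ℓ τ E B).card := by
    exact_mod_cast (card_le_card (show A ⊆ (A \ As k ℓ τ E B) ∪ As k ℓ τ E B by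
      rw [sdiff_union_self_eq_union]; exact subset_union_left)).trans (card_union_le _ _)
  have h4 := H.k_mul_η_le
  have h5 := H.k3
  have h6 : η * n ≤ n := by
    have := H.hη
    have : η ≤ 1 := by nlinarith
    nlinarith
  have h7 : 4 * (k : ℝ) * A.card ≤
      4 * k * ((A \ As k ℓ τ E B).card + (As k ℓ τ E B).card) := by gcongr
  linarith

lemma k_le_η : 100 * (k : ℝ) ^ 2 ≤ η * n := by
  have h1 := H.hnζ; have h2 := H.hζ'; have h3 := H.k3; have h4 := H.eps_le 0
  have h5 := H.τ_lt; have h6 := H.hη; have h7 := H.npos'; have h8 := H.hζ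
  have h9 : ζ ≤ η := by nlinarith
  have : ζ * n ≤ η * n := by gcongr
  nlinarith [sq_nonneg (k : ℝ)]

lemma pth_of_tasks (l : List (ℤ × Finset (Fin n)))
    (hl : ∀ p ∈ l, Task k ℓ τ η E B p.1 p.2 ∧ p.2.card ≤ 2 * k)
    (hp : l.Pairwise fun p q => Disjoint p.2 q.2)
    (hc : (4 * k * l.length + 2 * k : ℝ) ≤ η * n) :
    ∃ U, Pth k ℓ τ E B (l.map Prod.fst).sum U ∧ (U.card : ℝ) ≤ η * n ∧
      ∀ p ∈ l, p.2 \ Bs k ℓ τ E B ⊆ U := by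
  have h3 := H.k3
  have hn := H.npos'
  set Z := l.toFinset.biUnion Prod.snd with hZ
  have hZc : Z.card ≤ 2 * k * l.length := by
    refine (card_biUnion_le_card_mul _ _ (2 * k) fun q hq => ?_).trans ?_
    · exact (hl q (List.mem_toFinset.1 hq)).2
    · rw [mul_comm]; exact Nat.mul_le_mul_left _ (List.toFinset_card_le l)
  have hZc' : (Z.card : ℝ) ≤ 2 * k * l.length := by exact_mod_cast hZc
  have hZη : 2 * (Z.card : ℝ) ≤ η * n := by linarith
  obtain ⟨u, hu, huZ⟩ : ∃ u ∈ As k ℓ τ E B, u ∉ Z := by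
    by_contra! h
    have h1 : ((As k ℓ τ E B).card : ℝ) ≤ Z.card := by exact_mod_cast card_le_card h
    have h2 := H.n_le_card_As
    have h4 := H.k_mul_η_le
    have h5 : 8 * (k : ℝ) * (As k ℓ τ E B).card ≤ 8 * k * Z.card := by gcongr
    have h6 : 8 * (k : ℝ) * (2 * Z.card) ≤ 8 * k * (η * n) := by gcongr
    nlinarith
  have huB : u ∉ Bs k ℓ τ E B := disjoint_left.1 disjoint_As_Bs hu
  obtain ⟨U, hU, hUZ, hUc, -⟩ := H.task_vertex_cherry huB Z
    (by have := Nat.cast_nonneg (α := ℝ) Z.card; linarith) (disjoint_singleton_left.2 huZ)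
  have hUc' : (U.card : ℝ) ≤ 2 * k := by exact_mod_cast hUc
  obtain ⟨U', h1, h2, h4, h5⟩ := H.pth_chain l hl hp hU (fun p hp' =>
    (hUZ.mono_right (subset_biUnion_of_mem Prod.snd (List.mem_toFinset.2 hp'))).symm) (by linarith)
  refine ⟨U', by simpa using h1, ?_, h5⟩
  have : (U'.card : ℝ) ≤ U.card + 4 * k * l.length := by exact_mod_cast h4
  linarith

omit H in
lemma tasks_of_vertices {d : ℤ} {S : Finset (Fin n)}
    (hS : ∀ v ∈ S, Task k ℓ τ η E B d {v}) (hk : 1 ≤ k) :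
    ∃ l : List (ℤ × Finset (Fin n)), l.length = S.card ∧ (l.map Prod.fst).sum = S.card * d ∧
      (∀ p ∈ l, Task k ℓ τ η E B p.1 p.2 ∧ p.2.card ≤ 2 * k ∧ p.2 ⊆ S) ∧
      (∀ v ∈ S, ∃ p ∈ l, p.2 = {v}) ∧ l.Pairwise fun p q => Disjoint p.2 q.2 := by
  refine ⟨S.toList.map fun v => (d, {v}), by simp, by simp [Function.comp_def], ?_, by simp, ?_⟩
  · simp only [List.mem_map, mem_toList, forall_exists_index, and_imp, forall_apply_eq_imp_iff₂]
    exact fun v hv => ⟨hS v hv, by simp; omega, singleton_subset_iff.2 hv⟩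
  · rw [List.pairwise_map]
    exact (nodup_toList S).imp fun h => by simpa using h

lemma tasks_of_matching {l : List (Finset (Fin n))} (hE : ∀ e ∈ l, e ∈ E ∧ e ⊆ Bs k ℓ τ E B)
    (hd : l.Pairwise Disjoint) :
    ∃ l' : List (ℤ × Finset (Fin n)), l'.length = l.length ∧ (l'.map Prod.fst).sum = l.length ∧
      (∀ p ∈ l', Task k ℓ τ η E B p.1 p.2 ∧ p.2.card ≤ 2 * k ∧
        p.2 ⊆ As k ℓ τ E B ∪ Bs k ℓ τ E B) ∧
      l'.Pairwise fun p q => Disjoint p.2 q.2 := by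
  refine ⟨l.map fun e => (1, e), by simp, by simp [Function.comp_def], ?_, ?_⟩
  · simp only [List.mem_map, forall_exists_index, and_imp, forall_apply_eq_imp_iff₂]
    exact fun e he => ⟨H.task_edge (hE e he).1 (hE e he).2, by rw [H.unif e (hE e he).1]; omega,
      (hE e he).2.trans subset_union_right⟩
  · rwa [List.pairwise_map]

lemma exists_tasks (hn : freeBound k < n) :
    ∃ l : List (ℤ × Finset (Fin n)),
      (l.map Prod.fst).sum = c + 2 * ((Bs k ℓ τ E B).card : ℤ) - 2 * B.card ∧
      (100 * k * l.length : ℝ) ≤ 4 * (η * n) ∧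
      (∀ p ∈ l, Task k ℓ τ η E B p.1 p.2 ∧ p.2.card ≤ 2 * k ∧
        p.2 ⊆ As k ℓ τ E B ∪ Bs k ℓ τ E B) ∧
      l.Pairwise fun p q => Disjoint p.2 q.2 := by
  have hk3 := H.k3
  have hk := H.hk
  have hc2 := H.hc
  have hkη := H.k_le_η
  have hsmall : 100 * (k : ℝ) * 2 ≤ η * n := by nlinarith
  have hBd := H.card_B_diff
  have hBd' := H.card_Bs_sdiff
  have hη0 : 0 ≤ η * n := by linarith
  rcases lt_trichotomy (Bs k ℓ τ E B).card B.card with hlt | heq | hgt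
  · obtain ⟨r, hr⟩ : ∃ r, B.card = (Bs k ℓ τ E B).card + r := ⟨_, (Nat.add_sub_cancel' hlt.le).symm⟩
    have h1 : r ≤ (B \ Bs k ℓ τ E B).card := by
      have := le_card_sdiff (Bs k ℓ τ E B) B
      omega
    have h2 : 100 * (k : ℝ) * r ≤ η * n := by
      refine le_trans ?_ hBd
      gcongr
    have hAs := H.n_le_card_As
    obtain ⟨S, hS, hSc⟩ := exists_subset_card_eq (s := As k ℓ τ E B) (n := 2 * r - c) (by
      by_contra! h
      have h3 : ((As k ℓ τ E B).card : ℝ) ≤ 2 * r := by exact_mod_cast (by omega)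
      have h4 : 8 * (k : ℝ) * ((As k ℓ τ E B).card : ℝ) ≤ 8 * k * (2 * r) := by gcongr
      have h5 := H.k_mul_η_le
      have h6 := H.npos'
      have h7 := H.hη
      nlinarith)
    obtain ⟨l, hl1, hl2, hl3, -, hl4⟩ := tasks_of_vertices (k := k) (ℓ := ℓ) (τ := τ) (η := η)
      (E := E) (B := B) (d := -1) (S := S)
      (fun v hv => H.task_vertex_edge (disjoint_left.1 disjoint_As_Bs (hS hv))) (by omega)
    refine ⟨l, ?_, ?_, fun p hp => ⟨(hl3 p hp).1, (hl3 p hp).2.1,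
      (hl3 p hp).2.2.trans (hS.trans subset_union_left)⟩, hl4⟩
    · rw [hl2, hSc]; omega
    · have : (l.length : ℝ) ≤ 2 * r := by exact_mod_cast (by omega)
      have : 100 * (k : ℝ) * l.length ≤ 100 * k * (2 * r) := by gcongr
      linarith
  · by_cases hheavy : ∃ R ⊆ Bs k ℓ τ E B, 1 ≤ R.card ∧ R.card ≤ ℓ ∧ ¬ Light k ℓ τ E B R ∧ c = 2
    · obtain ⟨R, hR, h1, h2, h3, rfl⟩ := hheavy
      have h4 := H.task_cherry h1 h2 h3
      rw [sdiff_eq_empty_iff_subset.2 hR] at h4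
      refine ⟨[(2, R)], by simp [heq], by simp; linarith, ?_, by simp⟩
      simp only [List.mem_singleton, forall_eq]
      exact ⟨by simpa using h4, by have := H.hlk; omega, hR.trans subset_union_right⟩
    push Not at hheavy
    have hmat : ∀ l : List (Finset (Fin n)), (∀ e ∈ l, e ∈ E ∧ e ⊆ Bs k ℓ τ E B) →
        l.Pairwise Disjoint → l.length = c → ∃ l : List (ℤ × Finset (Fin n)),
      (l.map Prod.fst).sum = c + 2 * ((Bs k ℓ τ E B).card : ℤ) - 2 * B.card ∧
      (100 * k * l.length : ℝ) ≤ 4 * (η * n) ∧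
      (∀ p ∈ l, Task k ℓ τ η E B p.1 p.2 ∧ p.2.card ≤ 2 * k ∧
        p.2 ⊆ As k ℓ τ E B ∪ Bs k ℓ τ E B) ∧
      l.Pairwise fun p q => Disjoint p.2 q.2 := by
      intro l hE hd hlc
      obtain ⟨l', h1, h2, h3, h4⟩ := H.tasks_of_matching hE hd
      refine ⟨l', by rw [h2, hlc]; omega, ?_, h3, h4⟩
      have : (l'.length : ℝ) ≤ 2 := by exact_mod_cast (by omega)
      have : 100 * (k : ℝ) * l'.length ≤ 100 * k * 2 := by gcongr
      linarith
    rcases hc2 with rfl | rfl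
    · obtain ⟨S, hS, hSc⟩ := exists_subset_card_eq (s := Bs k ℓ τ E B) (n := k - 2) (by
        have h1 := H.toCtx.k_le; have h2 := H.toCtx.card_add; have h4 := H.toCtx.four_mul_card_le
        omega)
      have h := H.toCtx.pairs_ge (q := 0) heq hSc hS
      obtain ⟨P, hP⟩ := card_pos.1 (show 0 < ((powersetCard 2
          (Bs k ℓ τ E B \ S)).filter fun P => S ∪ P ∈ E).card by simp only [add_zero] at h; omega)
      simp only [mem_filter, mem_powersetCard] at hP
      exact hmat [S ∪ P] (by simpa using ⟨hP.2, union_subset hS (hP.1.1.trans sdiff_subset)⟩)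
        (by simp) rfl
    · obtain ⟨e₀, he₀, e₁, he₁, h₀, h₁, hd | hi⟩ := H.exists_edge_pair heq (fun _ => rfl) hn
      · exact hmat [e₀, e₁] (by simpa using ⟨⟨he₀, h₀⟩, he₁, h₁⟩) (by simpa using hd) rfl
      · have h4 := H.task_two_edges (fun R hR h1 h2 => by
          by_contra h3
          exact hheavy R hR h1 h2 h3 rfl) he₀ he₁ h₀ h₁ hi
        refine ⟨[(2, e₀ ∪ e₁)], by simp [heq], by simp; linarith, ?_, by simp⟩
        simp only [List.mem_singleton, forall_eq]
        exact ⟨h4, H.card_union_le_two_mul he₀ he₁,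
          (union_subset h₀ h₁).trans subset_union_right⟩
  · obtain ⟨q, hq⟩ : ∃ q, (Bs k ℓ τ E B).card = B.card + q := ⟨_, (Nat.add_sub_cancel' hgt.le).symm⟩
    have h1 : q ≤ (Bs k ℓ τ E B \ B).card := by
      have := le_card_sdiff B (Bs k ℓ τ E B)
      omega
    have h2 : 100 * (k : ℝ) * q ≤ η * n := by
      refine le_trans ?_ hBd'
      gcongr
    obtain ⟨l, hlc, hE, hd⟩ := H.exists_matching (q := q) (by omega) hq (c + 2 * q) (by omega)
    obtain ⟨l', h3, h4, h5, h6⟩ := H.tasks_of_matching hE hd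
    refine ⟨l', by rw [h4, hlc, hq]; push_cast; ring, ?_, h5, h6⟩
    have : (l'.length : ℝ) ≤ 2 + 2 * q := by exact_mod_cast (by omega)
    have : 100 * (k : ℝ) * l'.length ≤ 100 * k * (2 + 2 * q) := by gcongr
    linarith

lemma exists_path (hn : freeBound k < n) :
    ∃ U, Pth k ℓ τ E B (c + 2 * ((Bs k ℓ τ E B).card : ℤ) - 2 * B.card) U ∧
      (U.card : ℝ) ≤ η * n ∧ univ \ (As k ℓ τ E B ∪ Bs k ℓ τ E B) ⊆ U := by
  obtain ⟨l, h1, h2, h3, h4⟩ := H.exists_tasks hn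
  have hk := H.hk
  have hk3 := H.k3
  have hVB : ∀ v ∈ univ \ (As k ℓ τ E B ∪ Bs k ℓ τ E B), v ∉ Bs k ℓ τ E B := fun v hv hv' =>
    (mem_sdiff.1 hv).2 (mem_union_right _ hv')
  obtain ⟨m, m1, m2, m3, m4, m5⟩ := tasks_of_vertices (k := k) (ℓ := ℓ) (τ := τ) (η := η)
      (E := E) (B := B) (d := 0) (S := univ \ (As k ℓ τ E B ∪ Bs k ℓ τ E B))
      (fun v hv => H.task_vertex_cherry (hVB v hv)) (by omega)
  have hV : (univ \ (As k ℓ τ E B ∪ Bs k ℓ τ E B)).card ≤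
      (A \ As k ℓ τ E B).card + (B \ Bs k ℓ τ E B).card := by
    refine (card_le_card fun v hv => ?_).trans (card_union_le _ _)
    have : v ∈ A ∪ B := by simp [H.cover]
    simp only [mem_union, mem_sdiff, mem_univ, true_and] at this hv ⊢
    tauto
  have hV' : ((univ \ (As k ℓ τ E B ∪ Bs k ℓ τ E B)).card : ℝ) ≤
      (A \ As k ℓ τ E B).card + (B \ Bs k ℓ τ E B).card := by exact_mod_cast hV
  have hc1 := H.card_A_diff
  have hc2 := H.card_B_diff
  have hkη := H.k_le_η
  obtain ⟨U, hU, hUc, hUs⟩ := H.pth_of_tasks (m ++ l) (by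
      intro p hp
      rcases List.mem_append.1 hp with hp | hp
      exacts [⟨(m3 p hp).1, (m3 p hp).2.1⟩, ⟨(h3 p hp).1, (h3 p hp).2.1⟩]) (by
      rw [List.pairwise_append]
      refine ⟨m5, h4, fun p hp q hq => ?_⟩
      exact (disjoint_sdiff_self_left).mono (m3 p hp).2.2 (h3 q hq).2.2) (by
      rw [List.length_append, m1]
      push_cast
      have : 100 * (k : ℝ) * ((univ \ (As k ℓ τ E B ∪ Bs k ℓ τ E B)).card : ℝ) ≤
        100 * k * ((A \ As k ℓ τ E B).card + (B \ Bs k ℓ τ E B).card) := by gcongr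
      nlinarith)
  refine ⟨U, ?_, hUc, fun v hv => ?_⟩
  · rw [List.map_append, List.sum_append, m2, h1] at hU
    simpa using hU
  · obtain ⟨p, hp, hpv⟩ := m4 v hv
    refine hUs p (List.mem_append_left _ hp) (mem_sdiff.2 ⟨?_, hVB v hv⟩)
    rw [hpv]; exact mem_singleton_self v

end Par

end Assembly

section Counting

variable {n : ℕ} {E : Finset (Finset (Fin n))} {L X Y : Finset (Fin n)}

lemma card_le_pr {ι : Type*} [Fintype ι] [Nonempty (Fin n)] (T : Finset (Finset (Fin n)))
    (P : (ι → Fin n) → Prop) (h : ∀ t ∈ T, ∃ x : ι → Fin n, im x = t ∧ P x) :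
    (T.card : ℝ) ≤ (n : ℝ) ^ Fintype.card ι * pr ι P := by
  classical
  have hn : (n : ℝ) ≠ 0 := by
    have : 0 < Fintype.card (Fin n) := Fintype.card_pos
    rw [Fintype.card_fin] at this
    positivity
  rw [pr, Fintype.card_fin, mul_div_cancel₀ _ (pow_ne_zero _ hn), Set.ncard_eq_toFinset_card']
  norm_cast
  refine (card_le_card ?_).trans (card_image_le (f := im))
  intro t ht
  obtain ⟨x, hx, hP⟩ := h t ht
  exact mem_image.2 ⟨x, by simpa using hP, hx⟩

lemma card_le_degIn_add {ι : Type*} [Fintype ι] [Nonempty (Fin n)] {i j : ℕ}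
    (T : Finset (Finset (Fin n))) (P : (ι → Fin n) → Prop)
    (hT : ∀ t ∈ T, t ⊆ X ∪ Y ∧ (t ∩ X).card = i ∧ (t ∩ Y).card = j)
    (h : ∀ t ∈ T, ¬ (Disjoint L t ∧ L ∪ t ∈ E) → ∃ x : ι → Fin n, im x = t ∧ P x) :
    (T.card : ℝ) ≤ degIn E L X Y i j + (n : ℝ) ^ Fintype.card ι * pr ι P := by
  classical
  rw [← card_filter_add_card_filter_not (fun t => Disjoint L t ∧ L ∪ t ∈ E), Nat.cast_add]
  gcongr
  · unfold degIn
    refine card_le_card_of_injOn (fun t => L ∪ t) ?_ ?_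
    · intro t ht
      simp only [coe_filter, Set.mem_ofPred_eq] at ht
      have h1 : (L ∪ t) \ L = t := by
        rw [union_sdiff_left]; exact sdiff_eq_self_of_disjoint ht.2.1.symm
      simp only [coe_filter, Set.mem_ofPred_eq, h1]
      exact ⟨ht.2.2, subset_union_left, hT t ht.1⟩
    · intro t ht u hu htu
      simp only [coe_filter, Set.mem_ofPred_eq] at ht hu
      dsimp only at htu
      rw [← sdiff_eq_self_of_disjoint ht.2.1.symm, ← union_sdiff_left, htu, union_sdiff_left,
        sdiff_eq_self_of_disjoint hu.2.1.symm]
  · refine card_le_pr _ P fun t ht => ?_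
    rw [mem_filter] at ht
    exact h t ht.1 ht.2

lemma exists_im_eq (t : Finset (Fin n)) {j : ℕ} (ht : t.card = j) :
    ∃ x : Fin j → Fin n, im x = t := by
  refine ⟨fun i => (t.equivFinOfCardEq ht).symm i, ?_⟩
  ext v
  simp only [mem_im]
  constructor
  · rintro ⟨i, rfl⟩; exact ((t.equivFinOfCardEq ht).symm i).2
  · intro hv; exact ⟨t.equivFinOfCardEq ht ⟨v, hv⟩, by simp⟩

lemma choose_le_degIn_add [Nonempty (Fin n)] (j : ℕ) (hL : Disjoint L Y) :
    (Y.card.choose j : ℝ) ≤ degIn E L Y ∅ j 0 +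
      (n : ℝ) ^ j * pr (Fin j) (fun x => (∀ i, x i ∈ Y) ∧ L ∪ im x ∉ E) := by
  have := card_le_degIn_add (E := E) (L := L) (X := Y) (Y := ∅) (i := j) (j := 0)
    (powersetCard j Y) (fun x : Fin j → Fin n => (∀ i, x i ∈ Y) ∧ L ∪ im x ∉ E) ?_ ?_
  · simpa using this
  · intro t ht
    rw [mem_powersetCard] at ht
    rw [inter_eq_left.2 ht.1]
    exact ⟨ht.1.trans subset_union_left, ht.2, by simp⟩
  · intro t ht hb
    rw [mem_powersetCard] at ht
    obtain ⟨x, hx⟩ := exists_im_eq t ht.2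
    refine ⟨x, hx, im_subset.1 (hx ▸ ht.1), fun hE => hb ⟨hL.mono_right ht.1, hx ▸ hE⟩⟩

lemma mul_choose_le_degIn_add [Nonempty (Fin n)] (j : ℕ) (hXY : Disjoint X Y) :
    ((X.card * Y.card.choose j : ℕ) : ℝ) ≤ degIn E L X Y 1 j +
      (n : ℝ) ^ (1 + j) * pr (Unit ⊕ Fin j) (fun x => x (Sum.inl ()) ∈ X ∧
        (∀ i, x (Sum.inr i) ∈ Y) ∧ ((∃ i, x i ∈ L) ∨ L ∪ im x ∉ E)) := by
  classical
  have hnm : ∀ a ∈ X, ∀ t ⊆ Y, a ∉ t := fun a ha t ht h => disjoint_left.1 hXY ha (ht h)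
  have hcard : ((X ×ˢ powersetCard j Y).image (fun p => insert p.1 p.2)).card =
      X.card * Y.card.choose j := by
    rw [card_image_of_injOn, card_product, card_powersetCard]
    rintro ⟨a, t⟩ h ⟨b, u⟩ h' he
    simp only [coe_product, Set.mem_prod, mem_coe, mem_powersetCard] at h h' he
    have h1 : ∀ a ∈ X, ∀ t ⊆ Y, insert a t ∩ X = {a} := by
      intro a ha t ht
      rw [insert_inter_of_mem ha, disjoint_iff_inter_eq_empty.1 (hXY.symm.mono_left ht)]
      rfl
    have h2 : a = b := by
      have := congrArg (· ∩ X) he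
      simp only [h1 a h.1 t h.2.1, h1 b h'.1 u h'.2.1] at this
      exact singleton_injective this
    subst h2
    have := congrArg (erase · a) he
    simp only [erase_insert (hnm a h.1 t h.2.1), erase_insert (hnm a h.1 u h'.2.1)] at this
    rw [this]
  have := card_le_degIn_add (E := E) (L := L) (X := X) (Y := Y) (i := 1) (j := j)
    ((X ×ˢ powersetCard j Y).image (fun p => insert p.1 p.2))
    (fun x : Unit ⊕ Fin j → Fin n => x (Sum.inl ()) ∈ X ∧
        (∀ i, x (Sum.inr i) ∈ Y) ∧ ((∃ i, x i ∈ L) ∨ L ∪ im x ∉ E)) ?_ ?_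
  · rw [hcard] at this
    simpa using this
  · intro s hs
    obtain ⟨⟨a, t⟩, h, rfl⟩ := mem_image.1 hs
    simp only [mem_product, mem_powersetCard] at h
    have d1 := disjoint_iff_inter_eq_empty.1 (hXY.symm.mono_left h.2.1)
    dsimp only
    refine ⟨insert_subset (mem_union_left _ h.1) (h.2.1.trans subset_union_right), ?_, ?_⟩
    · rw [insert_inter_of_mem h.1, d1]; rfl
    · rw [insert_inter_of_notMem (disjoint_left.1 hXY h.1), inter_eq_left.2 h.2.1, h.2.2]
  · intro s hs hb
    obtain ⟨⟨a, t⟩, h, rfl⟩ := mem_image.1 hs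
    simp only [mem_product, mem_powersetCard] at h
    obtain ⟨x, hx⟩ := exists_im_eq t h.2.2
    have him : im (Sum.elim (fun _ : Unit => a) x) = insert a t := by
      rw [im_sum, Sum.elim_comp_inr, Sum.elim_comp_inl, hx, im_unit]; rfl
    refine ⟨_, him, h.1, im_subset.1 (hx ▸ h.2.1), ?_⟩
    rw [him]
    by_contra! hc
    refine hb ⟨disjoint_right.2 fun v hv hvL => ?_, hc.2⟩
    rw [← him, mem_im] at hv
    obtain ⟨i, rfl⟩ := hv
    exact hc.1 i hvL

end Counting

lemma pow_le_mul_choose {n k b j : ℕ} (hkn : 4 * k ≤ n) (hb : n ≤ 2 * b)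
    (hj : j ≤ k) : (n : ℝ) ^ j ≤ (4 * k : ℝ) ^ j * b.choose j := by
  have h1 := Nat.pow_le_choose (α := ℝ) j b
  have h2 : ((j.factorial : ℕ) : ℝ) ≤ (k : ℝ) ^ j := by
    exact_mod_cast (Nat.factorial_le_pow j).trans (Nat.pow_le_pow_left hj j)
  have h3 : (n : ℝ) ≤ 4 * ((b + 1 - j : ℕ) : ℝ) := by
    exact_mod_cast (by omega : n ≤ 4 * (b + 1 - j))
  rw [div_le_iff₀ (by positivity)] at h1
  calc (n : ℝ) ^ j ≤ (4 * ((b + 1 - j : ℕ) : ℝ)) ^ j := by gcongr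
    _ = 4 ^ j * ((b + 1 - j : ℕ) : ℝ) ^ j := mul_pow _ _ _
    _ ≤ 4 ^ j * (b.choose j * k ^ j) := by
        gcongr
        refine le_trans ?_ (h1.trans (by gcongr))
        rfl
    _ = _ := by rw [mul_pow]; ring

section Final

variable {k ℓ c n : ℕ} {E : Finset (Finset (Fin n))} {A B L X Y : Finset (Fin n)} {τ η ζ ρ : ℝ}

namespace Par

variable (H : Par k ℓ c n E A B τ η ζ)
include H

lemma τ_bounds : ζ ≤ τ / 300 ∧ η ≤ τ := by
  have := H.ζ_le; have := H.eps_le 0; have := H.η_le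
  constructor <;> linarith

lemma pr_switch_le {ι : Type*} [Fintype ι] (hι : Fintype.card ι ≤ k) :
    pr ι (fun x => ∃ i, x i ∈ (As k ℓ τ E B \ A) ∪ (Bs k ℓ τ E B \ B)) ≤ η / 50 := by
  classical
  have := H.toCtx.nonempty
  have hn := H.npos'
  have hk := H.k3
  refine (pr_exists_mem_le _).trans ?_
  rw [Fintype.card_fin]
  have h1 : (((As k ℓ τ E B \ A) ∪ (Bs k ℓ τ E B \ B)).card : ℝ) ≤
      (B \ Bs k ℓ τ E B).card + (Bs k ℓ τ E B \ B).card := by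
    exact_mod_cast (card_union_le _ _).trans
      (add_le_add_left (card_le_card H.A_sdiff_subset) _)
  have h2 := H.card_B_diff
  have h3 := H.card_Bs_sdiff
  have h4 : (Fintype.card ι : ℝ) ≤ k := by exact_mod_cast hι
  have h5 : (((As k ℓ τ E B \ A) ∪ (Bs k ℓ τ E B \ B)).card : ℝ) / n ≤ η / (50 * k) := by
    rw [div_le_div_iff₀ hn (by positivity)]
    nlinarith
  calc _ ≤ (k : ℝ) * (η / (50 * k)) := by gcongr
    _ = η / 50 := by field_simp

lemma pr_bad_pair_le {j : ℕ} (hL : Light k ℓ τ E B L) (hj : L.card + (1 + j) = k)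
    (hj1 : 1 ≤ j) (hX : X ⊆ As k ℓ τ E B) (hY : Y ⊆ Bs k ℓ τ E B) :
    pr (Unit ⊕ Fin j) (fun x => x (Sum.inl ()) ∈ X ∧
        (∀ i, x (Sum.inr i) ∈ Y) ∧ ((∃ i, x i ∈ L) ∨ L ∪ im x ∉ E)) ≤ 2 * τ := by
  classical
  have := H.toCtx.nonempty
  have hn := H.npos'
  have hk := H.k3
  have hc : Fintype.card (Unit ⊕ Fin j) = 1 + j := by simp
  have h1 := H.toCtx.missing_le (R := L) (ι := Unit ⊕ Fin j) (Sum.inl ()) (by omega) (by omega)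
  have h2 := H.pr_switch_le (ι := Unit ⊕ Fin j) (by omega)
  have h3 := pr_exists_mem_le (ι := Unit ⊕ Fin j) L
  have h4 : (Fintype.card (Unit ⊕ Fin j) : ℝ) * (L.card / Fintype.card (Fin n)) ≤ k ^ 2 / n := by
    rw [Fintype.card_fin, ← mul_div_assoc, sq]
    have h5 : (Fintype.card (Unit ⊕ Fin j) : ℝ) ≤ k := by exact_mod_cast (by omega)
    have h6 : (L.card : ℝ) ≤ k := by exact_mod_cast (by omega)
    gcongr
  have h5 : dB k E B L ≤ τ := le_trans hL (H.eps_le _)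
  have h6 := H.k_sq_div_le
  have h7 := H.three_le
  obtain ⟨h8, h9⟩ := H.τ_bounds
  have hτ := H.hτ
  have h10 : pr (Unit ⊕ Fin j) (fun x => x (Sum.inl ()) ∈ X ∧
        (∀ i, x (Sum.inr i) ∈ Y) ∧ ((∃ i, x i ∈ L) ∨ L ∪ im x ∉ E)) ≤
      pr (Unit ⊕ Fin j) (fun x => ((x (Sum.inl ()) ∈ A ∧ (∀ i, i ≠ Sum.inl () → x i ∈ B) ∧
        L ∪ im x ∉ E) ∨ ∃ i, x i ∈ (As k ℓ τ E B \ A) ∪ (Bs k ℓ τ E B \ B)) ∨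
        ∃ i, x i ∈ L) := by
    refine pr_mono fun x hx => ?_
    obtain ⟨hx1, hx2, hx3⟩ := hx
    rcases hx3 with hx3 | hx3
    · exact Or.inr hx3
    left
    by_cases hs : ∃ i, x i ∈ (As k ℓ τ E B \ A) ∪ (Bs k ℓ τ E B \ B)
    · exact Or.inr hs
    push Not at hs
    simp only [mem_union, mem_sdiff, not_or, not_and, not_not] at hs
    refine Or.inl ⟨(hs _).1 (hX hx1), ?_, hx3⟩
    rintro (i | i) hi
    · exact absurd rfl hi
    · exact (hs _).2 (hY (hx2 i))
  have h11 := h10.trans ((pr_or _ _).trans (add_le_add_left (pr_or _ _) _))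
  linarith

lemma pr_bad_set_le {v : Fin n} (hv : v ∈ As k ℓ τ E B) (hY : Y ⊆ Bs k ℓ τ E B) :
    pr (Fin (k - 1)) (fun x => (∀ i, x i ∈ Y) ∧ {v} ∪ im x ∉ E) ≤ 2 * τ := by
  classical
  have := H.toCtx.nonempty
  have h1 : nonB k E B v ≤ τ := (mem_As.1 hv).2
  have h2 := H.pr_switch_le (ι := Fin (k - 1)) (by simp)
  have hτ := H.hτ
  obtain ⟨-, h3⟩ := H.τ_bounds
  have h4 : pr (Fin (k - 1)) (fun x => (∀ i, x i ∈ Y) ∧ {v} ∪ im x ∉ E) ≤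
      pr (Fin (k - 1)) (fun x => ((∀ i, x i ∈ B) ∧ {v} ∪ im x ∉ E) ∨
        ∃ i, x i ∈ (As k ℓ τ E B \ A) ∪ (Bs k ℓ τ E B \ B)) := by
    refine pr_mono fun x hx => ?_
    by_cases hs : ∃ i, x i ∈ (As k ℓ τ E B \ A) ∪ (Bs k ℓ τ E B \ B)
    · exact Or.inr hs
    push Not at hs
    simp only [mem_union, mem_sdiff, not_or, not_and, not_not] at hs
    exact Or.inl ⟨fun i => (hs i).2 (hY (hx.1 i)), hx.2⟩
  have h5 := h4.trans (pr_or _ _)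
  unfold nonB at h1
  linarith

lemma pair_density (hρ : 64 * k * (4 * k) ^ k * τ ≤ ρ) {j : ℕ} (hL : Light k ℓ τ E B L)
    (hj : L.card + (1 + j) = k) (hj1 : 1 ≤ j) (hX : X ⊆ As k ℓ τ E B) (hY : Y ⊆ Bs k ℓ τ E B)
    (hXn : (n : ℝ) ≤ 16 * k * X.card) (hYn : n ≤ 2 * Y.card) :
    (1 - ρ) * ((X.card : ℝ) * (Y.card.choose j : ℝ)) ≤ (degIn E L X Y 1 j : ℝ) := by
  have := H.toCtx.nonempty
  have hk := H.k3
  have hk' := H.hk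
  have hτ := H.hτ
  have h1 := mul_choose_le_degIn_add (E := E) (L := L) j
    (disjoint_As_Bs.mono hX hY)
  have h2 := H.pr_bad_pair_le hL hj hj1 hX hY
  have h3 := pow_le_mul_choose (n := n) (k := k) (b := Y.card) (j := j)
    (by have := H.toCtx.k_le; omega) hYn (by omega)
  have h4 : (4 * k : ℝ) ^ j ≤ (4 * k) ^ k := pow_le_pow_right₀ (by linarith) (by omega)
  have h5 : (n : ℝ) ^ (1 + j) * pr (Unit ⊕ Fin j) (fun x => x (Sum.inl ()) ∈ X ∧
        (∀ i, x (Sum.inr i) ∈ Y) ∧ ((∃ i, x i ∈ L) ∨ L ∪ im x ∉ E)) ≤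
      ρ * ((X.card : ℝ) * (Y.card.choose j : ℝ)) := by
    calc _ ≤ (n : ℝ) ^ (1 + j) * (2 * τ) := by gcongr
      _ = n * n ^ j * (2 * τ) := by rw [pow_add, pow_one]
      _ ≤ (16 * k * X.card) * ((4 * k : ℝ) ^ k * Y.card.choose j) * (2 * τ) := by
          gcongr
          exact h3.trans (by gcongr)
      _ = (32 * k * (4 * k) ^ k * τ) * ((X.card : ℝ) * (Y.card.choose j : ℝ)) := by ring
      _ ≤ _ := by
          gcongr
          refine le_trans ?_ hρ
          have : 0 ≤ k * (4 * k : ℝ) ^ k * τ := by positivity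
          linarith
  push_cast at h1
  linarith

lemma set_density (hρ : 64 * k * (4 * k) ^ k * τ ≤ ρ) {v : Fin n} (hv : v ∈ As k ℓ τ E B)
    (hY : Y ⊆ Bs k ℓ τ E B) (hYn : n ≤ 2 * Y.card) :
    (1 - ρ) * (Y.card.choose (k - 1) : ℝ) ≤ (degIn E {v} Y ∅ (k - 1) 0 : ℝ) := by
  have := H.toCtx.nonempty
  have hk := H.k3
  have hk' := H.hk
  have hτ := H.hτ
  have h1 := choose_le_degIn_add (E := E) (L := {v}) (Y := Y) (k - 1)
    (disjoint_singleton_left.2 fun h => disjoint_left.1 disjoint_As_Bs hv (hY h))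
  have h2 := H.pr_bad_set_le hv hY
  have h3 := pow_le_mul_choose (n := n) (k := k) (b := Y.card) (j := k - 1)
    (by have := H.toCtx.k_le; omega) hYn (by omega)
  have h4 : (4 * k : ℝ) ^ (k - 1) ≤ (4 * k) ^ k := pow_le_pow_right₀ (by linarith) (by omega)
  have h5 : (n : ℝ) ^ (k - 1) * pr (Fin (k - 1)) (fun x => (∀ i, x i ∈ Y) ∧ {v} ∪ im x ∉ E) ≤
      ρ * (Y.card.choose (k - 1) : ℝ) := by
    calc _ ≤ (n : ℝ) ^ (k - 1) * (2 * τ) := by gcongr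
      _ ≤ ((4 * k : ℝ) ^ k * Y.card.choose (k - 1)) * (2 * τ) := by
          gcongr
          exact h3.trans (by gcongr)
      _ = (2 * (4 * k) ^ k * τ) * (Y.card.choose (k - 1) : ℝ) := by ring
      _ ≤ _ := by
          gcongr
          refine le_trans ?_ hρ
          have : 0 ≤ (4 * k : ℝ) ^ k * τ := by positivity
          nlinarith
  linarith

end Par

end Final

section Partition

variable {k ℓ c n : ℕ} {E : Finset (Finset (Fin n))} {A B : Finset (Fin n)} {τ η ζ ρ : ℝ}

lemma card_final {a b s q w t : ℕ} (k ℓ c n : ℕ) (hlk : 2 * ℓ < k)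
    (hn : n = (k - ℓ) * (2 * a + c)) (hab : a + b = n)
    (hd : (c : ℤ) + 2 * s - 2 * b = t - 2 * q) (hU : w + q = t * (k - ℓ) + ℓ) {x y : ℕ}
    (hx : x + q + s = n) (hy : y + w = s + 2 * ℓ) :
    y = (2 * k - 2 * ℓ - 1) * x + ℓ := by
  obtain ⟨m, rfl⟩ : ∃ m, k = m + ℓ := ⟨k - ℓ, by omega⟩
  have h1 : 2 * (m + ℓ) - 2 * ℓ - 1 = 2 * m - 1 := by omega
  rw [h1]
  obtain ⟨p, rfl⟩ : ∃ p, m = p + 1 := ⟨m - 1, by omega⟩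
  have h2 : 2 * (p + 1) - 1 = 2 * p + 1 := by omega
  rw [h2]
  have h3 : p + 1 + ℓ - ℓ = p + 1 := by omega
  rw [h3] at hn hU
  zify at *
  nlinarith

namespace Par

variable (H : Par k ℓ c n E A B τ η ζ)
include H

theorem exists_partition (hρ : 64 * k * (4 * k) ^ k * τ ≤ ρ) (hn : freeBound k < n) :
    ∃ t : ℕ, 1 ≤ t ∧ ∃ f : ℕ → Fin n, IsPath n k ℓ t E f ∧
      ∃ Astar Bstar : Finset (Fin n),
        Disjoint Astar Bstar ∧
        Astar ∪ Bstar =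
          (Finset.univ \ pathVerts n k ℓ t f) ∪ pathEnd0 n ℓ f ∪ pathEnd1 n k ℓ t f ∧
        pathEnd0 n ℓ f ⊆ Bstar ∧ pathEnd1 n k ℓ t f ⊆ Bstar ∧
        Bstar.card = (2 * k - 2 * ℓ - 1) * Astar.card + ℓ ∧
        (∀ v ∈ Astar,
          (1 - ρ) * (Bstar.card.choose (k - 1) : ℝ) ≤
            (degIn E {v} Bstar ∅ (k - 1) 0 : ℝ)) ∧
        (∀ v ∈ Bstar,
          (1 - ρ) * ((Astar.card : ℝ) * (Bstar.card.choose (k - 2) : ℝ)) ≤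
            (degIn E {v} Astar Bstar 1 (k - 2) : ℝ)) ∧
        (1 - ρ) * ((Astar.card : ℝ) * (Bstar.card.choose (k - ℓ - 1) : ℝ)) ≤
          (degIn E (pathEnd0 n ℓ f) Astar Bstar 1 (k - ℓ - 1) : ℝ) ∧
        (1 - ρ) * ((Astar.card : ℝ) * (Bstar.card.choose (k - ℓ - 1) : ℝ)) ≤
          (degIn E (pathEnd1 n k ℓ t f) Astar Bstar 1 (k - ℓ - 1) : ℝ) := by
  classical
  have hk := H.hk
  have hl := H.hl
  have hlk := H.hlk
  have hn0 := H.npos'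
  have hk3 := H.k3
  obtain ⟨U, ⟨t, L₀, L₁, ht, hP, e₀, e₁, hd⟩, hUn, hV⟩ := H.exists_path hn
  have hL := HasPath.disjoint (by omega) ht hP
  have hU := hP.card
  have s₀ := hP.sub₀
  have s₁ := hP.sub₁
  obtain ⟨f, hf, hfU, hf₀, hf₁⟩ := hP
  refine ⟨t, ht, f, hf, As k ℓ τ E B \ U, (Bs k ℓ τ E B \ U) ∪ (L₀ ∪ L₁), ?_⟩
  rw [hfU, hf₀, hf₁]
  have hAB : Disjoint (As k ℓ τ E B) (Bs k ℓ τ E B) := disjoint_As_Bs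
  have hLU : L₀ ∪ L₁ ⊆ U := union_subset s₀ s₁
  have hLB : L₀ ∪ L₁ ⊆ Bs k ℓ τ E B := union_subset e₀.sub e₁.sub
  have hXs : As k ℓ τ E B \ U ⊆ As k ℓ τ E B := sdiff_subset
  have hYs : (Bs k ℓ τ E B \ U) ∪ (L₀ ∪ L₁) ⊆ Bs k ℓ τ E B := union_subset sdiff_subset hLB
  have hcover : ∀ v, v ∉ U → v ∈ As k ℓ τ E B ∨ v ∈ Bs k ℓ τ E B := by
    intro v hv
    by_contra hc
    exact hv (hV (by simpa using hc))
  have c₀ : (L₀ ∪ L₁).card = 2 * ℓ := by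
    rw [card_union_of_disjoint hL, e₀.card, e₁.card]; omega
  have c₁ := card_inter_add_card_sdiff U (Bs k ℓ τ E B)
  have c₂ := card_inter_add_card_sdiff (Bs k ℓ τ E B) U
  rw [inter_comm] at c₂
  have c₃ : ((Bs k ℓ τ E B \ U) ∪ (L₀ ∪ L₁)).card = (Bs k ℓ τ E B \ U).card + 2 * ℓ := by
    rw [card_union_of_disjoint (disjoint_sdiff_self_left.mono_right hLU), c₀]
  have c₄ : (As k ℓ τ E B \ U).card + U.card + (Bs k ℓ τ E B \ U).card = n := by
    have : (univ : Finset (Fin n)) = (As k ℓ τ E B \ U) ∪ U ∪ (Bs k ℓ τ E B \ U) := by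
      ext v
      have := hcover v
      simp only [mem_univ, mem_union, mem_sdiff, true_iff]
      by_cases hv : v ∈ U
      · exact Or.inl (Or.inr hv)
      · rcases this hv with h | h
        · exact Or.inl (Or.inl ⟨h, hv⟩)
        · exact Or.inr ⟨h, hv⟩
    have h2 := congrArg card this
    rw [card_univ, Fintype.card_fin, card_union_of_disjoint, card_union_of_disjoint] at h2
    · exact h2.symm
    · exact disjoint_sdiff_self_left
    · rw [disjoint_union_left]
      exact ⟨hAB.mono sdiff_subset sdiff_subset, disjoint_sdiff_self_right⟩
  have hi := card_final k ℓ c n hlk H.hn H.card_add hd (w := (U ∩ Bs k ℓ τ E B).card)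
    (by omega) (x := (As k ℓ τ E B \ U).card) (y := ((Bs k ℓ τ E B \ U) ∪ (L₀ ∪ L₁)).card)
    (by omega) (by omega)
  have hη := H.k_mul_η_le
  have hUn' : 6400 * k * (U.card : ℝ) ≤ n := by
    have := mul_le_mul_of_nonneg_right hη hn0.le
    nlinarith
  have hXn : (n : ℝ) ≤ 16 * k * (As k ℓ τ E B \ U).card := by
    have h1 := H.n_le_card_As
    have h2 : ((As k ℓ τ E B).card : ℝ) ≤ (As k ℓ τ E B \ U).card + U.card := by
      exact_mod_cast (by
        have := card_le_card_sdiff_add_card (s := As k ℓ τ E B) (t := U); omega)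
    have h1' : (n : ℝ) ≤ 8 * k * (As k ℓ τ E B).card := by exact_mod_cast h1
    nlinarith
  have hYn : n ≤ 2 * ((Bs k ℓ τ E B \ U) ∪ (L₀ ∪ L₁)).card := by
    have h1 := H.B_ge
    have h2 := H.card_B_diff
    have h3 : (B.card : ℝ) ≤ (Bs k ℓ τ E B \ U).card + U.card + (B \ Bs k ℓ τ E B).card := by
      have h4 := card_le_card_sdiff_add_card (s := B) (t := Bs k ℓ τ E B)
      have h5 := card_le_card_sdiff_add_card (s := Bs k ℓ τ E B) (t := U)
      exact_mod_cast (by omega)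
    have h5 : (n : ℝ) ≤ 2 * (Bs k ℓ τ E B \ U).card := by
      have h6 : 100 * ((B \ Bs k ℓ τ E B).card : ℝ) ≤ n := by
        have : (0:ℝ) ≤ (B \ Bs k ℓ τ E B).card := by positivity
        have := H.hη
        have : η ≤ 1 := by nlinarith
        nlinarith
      have h7 : 6400 * (U.card : ℝ) ≤ n := by
        have : (0:ℝ) ≤ U.card := by positivity
        nlinarith
      linarith
    have h6 : n ≤ 2 * (Bs k ℓ τ E B \ U).card := by exact_mod_cast h5
    omega
  refine ⟨hAB.mono hXs hYs, ?_, ?_, ?_, hi, ?_, ?_, ?_, ?_⟩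
  · ext v
    have := hcover v
    simp only [mem_union, mem_sdiff, mem_univ, true_and]
    constructor
    · rintro (h | h | h | h)
      exacts [Or.inl (Or.inl h.2), Or.inl (Or.inl h.2), Or.inl (Or.inr h), Or.inr h]
    · rintro ((h | h) | h)
      · rcases this h with h' | h'
        · exact Or.inl ⟨h', h⟩
        · exact Or.inr (Or.inl ⟨h', h⟩)
      · exact Or.inr (Or.inr (Or.inl h))
      · exact Or.inr (Or.inr (Or.inr h))
  · exact subset_union_left.trans subset_union_right
  · exact subset_union_right.trans subset_union_right
  · exact fun v hv => H.set_density hρ (hXs hv) hYs hYn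
  · exact fun v hv => H.pair_density hρ (mem_Bs.1 (hYs hv))
      (by rw [card_singleton]; omega) (by omega) hXs hYs hXn hYn
  · exact H.pair_density hρ e₀.light (by rw [e₀.card]; omega) (by omega) hXs hYs hXn hYn
  · exact H.pair_density hρ e₁.light (by rw [e₁.card]; omega) (by omega) hXs hYs hXn hYn

end Par

end Partition

section Extremal

variable {k ℓ n : ℕ} {E X : Finset (Finset (Fin n))} {A B S W : Finset (Fin n)}

lemma choose_le_deg (hX : Uniform n k X) (hk : 2 ≤ k) (hS : S.card = k - 2)
    (hA : ∀ e : Finset (Fin n), e.card = k → ¬ Disjoint e A → e ∈ X) :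
    (n - (k - 2)).choose 2 ≤ deg X S + (n - (k - 2) - A.card).choose 2 ∧
    (A.card + 2 ≤ n - (k - 2) → W.card ≤ 2 → Disjoint W A →
      (∀ e : Finset (Fin n), e.card = k → Disjoint e A → W ⊆ e → e ∈ X) →
      (n - (k - 2)).choose 2 + 1 ≤ deg X S + (n - (k - 2) - A.card).choose 2) := by
  classical
  have hSc : Sᶜ.card = n - (k - 2) := by rw [card_compl, Fintype.card_fin, hS]
  have hun : ∀ P ∈ powersetCard 2 Sᶜ, (S ∪ P).card = k := by
    intro P hP
    rw [mem_powersetCard] at hP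
    rw [card_union_of_disjoint (disjoint_compl_right.mono_right hP.1), hS, hP.2]
    omega
  have h0 : deg X S + ((powersetCard 2 Sᶜ).filter fun P => S ∪ P ∉ X).card =
      (n - (k - 2)).choose 2 := by
    rw [deg_eq_card_pairs hX hk hS, card_filter_add_card_filter_not, card_powersetCard, hSc]
  by_cases hSA : Disjoint S A
  · have hc : (Sᶜ \ A).card = n - (k - 2) - A.card := by
      rw [card_sdiff_of_subset (subset_compl_iff_disjoint_left.2 hSA), hSc]
    have hsub : ((powersetCard 2 Sᶜ).filter fun P => S ∪ P ∉ X) ⊆ powersetCard 2 (Sᶜ \ A) := by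
      intro P hP
      rw [mem_filter] at hP
      have h1 := mem_powersetCard.1 hP.1
      refine mem_powersetCard.2 ⟨subset_sdiff.2 ⟨h1.1, ?_⟩, h1.2⟩
      by_contra hd
      exact hP.2 (hA _ (hun P hP.1) fun h => hd (h.mono_left subset_union_right))
    refine ⟨?_, fun hcard hW hWA hWX => ?_⟩
    · have := card_le_card hsub
      rw [card_powersetCard, hc] at this
      omega
    · obtain ⟨P, hP1, hP2, hP3⟩ := exists_subsuperset_card_eq (s := W \ S) (t := Sᶜ \ A) (n := 2)
        (subset_sdiff.2 ⟨fun v hv => by simpa using (mem_sdiff.1 hv).2,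
          hWA.mono_left sdiff_subset⟩)
        ((card_le_card sdiff_subset).trans hW) (by omega)
      have hP : P ∈ powersetCard 2 (Sᶜ \ A) := mem_powersetCard.2 ⟨hP2, hP3⟩
      have hP' : P ∈ powersetCard 2 Sᶜ := mem_powersetCard.2 ⟨hP2.trans sdiff_subset, hP3⟩
      have hPX : S ∪ P ∈ X := by
        refine hWX _ (hun P hP') (disjoint_union_left.2 ⟨hSA, (subset_sdiff.1 hP2).2⟩) ?_
        intro v hv
        by_cases h : v ∈ S
        · exact mem_union_left _ h
        · exact mem_union_right _ (hP1 (mem_sdiff.2 ⟨hv, h⟩))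
      have := card_lt_card (Finset.ssubset_iff_subset_ne.2 ⟨hsub, fun h => by
        have := h ▸ hP
        exact (mem_filter.1 this).2 hPX⟩)
      rw [card_powersetCard, hc] at this
      omega
  · have hM : ((powersetCard 2 Sᶜ).filter fun P => S ∪ P ∉ X) = ∅ := by
      rw [filter_eq_empty_iff]
      intro P hP hn
      exact hn (hA _ (hun P hP) fun h => hSA (h.mono_left subset_union_left))
    rw [hM, card_empty] at h0
    refine ⟨by omega, fun hcard _ _ _ => ?_⟩
    have : 0 < (n - (k - 2) - A.card).choose 2 := Nat.choose_pos (by omega)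
    omega

lemma exists_minDeg_eq (E : Finset (Finset (Fin n))) {s : ℕ} (hs : s ≤ n) :
    ∃ S : Finset (Fin n), S.card = s ∧ deg E S = minDeg n E s := by
  obtain ⟨S, -, hS⟩ := exists_subset_card_eq (s := (univ : Finset (Fin n))) (n := s) (by simpa)
  exact Nat.sInf_mem (s := {d | ∃ S : Finset (Fin n), S.card = s ∧ deg E S = d}) ⟨_, S, hS, rfl⟩

lemma uniform_Xedges : Uniform n k (Xedges n k ℓ) := by
  intro e he
  unfold Xedges at he
  split_ifs at he <;> exact (mem_powersetCard.1 (mem_filter.1 he).1).2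

lemma card_filter_val_lt {a : ℕ} (h : a ≤ n) :
    (univ.filter fun v : Fin n => (v : ℕ) < a).card = a := by
  rw [Fin.card_filter_val_lt]; omega

/-- Lower bound for the minimum `(k-2)`-degree of the extremal hypergraph. -/
lemma choose_le_minDeg_Xedges {m c : ℕ} (hk : 3 ≤ k) (hl : 1 ≤ ℓ) (hlk : 2 * ℓ < k)
    (hc : c = 1 ∨ c = 2) (hn : n = (k - ℓ) * (2 * m + c)) (hkn : 4 * k ≤ n) :
    (n - (k - 2)).choose 2 + (if c = 2 ∧ ℓ = 1 then 1 else 0) ≤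
      minDeg n (Xedges n k ℓ) (k - 2) + (n - (k - 2) - m).choose 2 := by
  classical
  obtain ⟨S, hS, hd⟩ := exists_minDeg_eq (Xedges n k ℓ) (s := k - 2) (by omega)
  rw [← hd]
  have hkl : 2 ≤ k - ℓ := by omega
  have hN : n / (k - ℓ) = 2 * m + c := by
    rw [hn]; exact Nat.mul_div_cancel_left _ (by omega)
  have hN2 : n / (2 * (k - ℓ)) = (2 * m + c) / 2 := by
    rw [mul_comm, ← Nat.div_div_eq_div_mul, hN]
  have hmn : 4 * m + 2 * c ≤ n := by
    have := Nat.mul_le_mul_right (2 * m + c) hkl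
    omega
  have hAc := card_filter_val_lt (n := n) (a := m) (by omega)
  have hX : ∀ e : Finset (Fin n), e.card = k →
      ¬ Disjoint e (univ.filter fun v : Fin n => (v : ℕ) < m) → e ∈ Xedges n k ℓ := by
    intro e he hd
    rw [not_disjoint_iff] at hd
    obtain ⟨v, hv, hv'⟩ := hd
    rw [mem_filter] at hv'
    have he' : e ∈ powersetCard k (univ : Finset (Fin n)) := mem_powersetCard.2 ⟨subset_univ _, he⟩
    unfold Xedges
    split_ifs with h
    · rw [hN2]
      exact mem_filter.2 ⟨he', v, hv, by omega⟩
    · rw [hN, Nat.odd_iff] at h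
      rw [hN2]
      exact mem_filter.2 ⟨he', Or.inl ⟨v, hv, by omega⟩⟩
  have key := choose_le_deg (W := univ.filter fun v : Fin n => m ≤ (v : ℕ) ∧ (v : ℕ) < m + 2)
    uniform_Xedges (by omega) hS hX
  rw [hAc] at key
  split_ifs with h
  · obtain ⟨h2, rfl⟩ := h
    refine key.2 (by omega) ?_ ?_ ?_
    · rw [← card_image_of_injective _ (Fin.val_injective)]
      refine (card_le_card (t := Ico m (m + 2)) ?_).trans (by simp)
      intro i hi
      obtain ⟨v, hv, rfl⟩ := mem_image.1 hi
      exact mem_Ico.2 (mem_filter.1 hv).2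
    · refine disjoint_left.2 fun v hv hv' => ?_
      have := (mem_filter.1 hv).2; have := (mem_filter.1 hv').2
      omega
    · intro e he hd hW
      have he' : e ∈ powersetCard k (univ : Finset (Fin n)) :=
        mem_powersetCard.2 ⟨subset_univ _, he⟩
      unfold Xedges
      rw [if_neg (by rw [hN, Nat.odd_iff]; omega), hN2]
      refine mem_filter.2 ⟨he', Or.inr ⟨fun v hv => ?_, fun w h1 h2 => hW ?_⟩⟩
      · by_contra hlt
        exact disjoint_left.1 hd hv (mem_filter.2 ⟨mem_univ _, by omega⟩)
      · exact mem_filter.2 ⟨mem_univ _, by omega, by omega⟩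
  · exact key.1

lemma dB_empty_le {ξ : ℝ} (hn : 0 < n) (hE : Uniform n k E)
    (h : (edgesIn E B : ℝ) ≤ ξ * n.choose k) (hξ : 0 ≤ ξ) : dB k E B ∅ ≤ k ^ k * ξ := by
  classical
  rw [← dB_eq (Fin k) (by simp), pr, Fintype.card_fin, Fintype.card_fin,
    div_le_iff₀ (by positivity), Set.ncard_eq_toFinset_card']
  have h1 : ({x : Fin k → Fin n | (∀ i, x i ∈ B) ∧ ∅ ∪ im x ∈ E}.toFinset).card ≤
      k ^ k * edgesIn E B := by
    refine card_le_mul_card_image_of_maps_to (f := im) ?_ _ ?_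
    · intro x hx
      simp only [Set.mem_toFinset, Set.mem_ofPred_eq, empty_union] at hx
      exact mem_filter.2 ⟨hx.2, im_subset.2 hx.1⟩
    · intro e he
      have hc := hE e (mem_filter.1 he).1
      calc _ ≤ (Fintype.piFinset (fun _ : Fin k => e)).card := by
            refine card_le_card fun x hx => ?_
            rw [Fintype.mem_piFinset]
            rw [mem_filter] at hx
            exact im_subset.1 hx.2.subset
        _ = k ^ k := by simp [hc]
  have h2 : (n.choose k : ℝ) ≤ (n : ℝ) ^ k := by exact_mod_cast Nat.choose_le_pow n k
  calc _ ≤ ((k ^ k * edgesIn E B : ℕ) : ℝ) := by exact_mod_cast h1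
    _ = (k : ℝ) ^ k * edgesIn E B := by push_cast; rfl
    _ ≤ (k : ℝ) ^ k * (ξ * (n : ℝ) ^ k) := by
        gcongr
        exact h.trans (by gcongr)
    _ = _ := by ring

lemma exists_eq_mul_of_ceil {d a : ℕ} (hd : 0 < d) (hn : 0 < n) (hdn : d ∣ n)
    (ha : a = ⌈(n : ℝ) / (2 * (d : ℝ))⌉₊ - 1) : ∃ c, (c = 1 ∨ c = 2) ∧ n = d * (2 * a + c) := by
  obtain ⟨N, rfl⟩ := hdn
  have hN : 0 < N := Nat.pos_of_mul_pos_left hn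
  have hd' : (d : ℝ) ≠ 0 := by positivity
  have h1 : ((d * N : ℕ) : ℝ) / (2 * (d : ℝ)) = N / 2 := by
    push_cast; field_simp
  have h2 : ⌈(N : ℝ) / 2⌉₊ = (N + 1) / 2 := by
    rw [Nat.ceil_eq_iff (by omega)]
    have h3 : 2 * ((N + 1) / 2 - 1) < N := by omega
    have h4 : N ≤ 2 * ((N + 1) / 2) := by omega
    have h5 : 2 * (((N + 1) / 2 - 1 : ℕ) : ℝ) < N := by exact_mod_cast h3
    have h6 : (N : ℝ) ≤ 2 * (((N + 1) / 2 : ℕ) : ℝ) := by exact_mod_cast h4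
    constructor <;> linarith
  rw [h1, h2] at ha
  rcases Nat.even_or_odd' N with ⟨m, rfl | rfl⟩
  · exact ⟨2, Or.inr rfl, by congr 1; omega⟩
  · exact ⟨1, Or.inl rfl, by congr 1; omega⟩

end Extremal

end ExtremalPath

/-- Main Lemma. For any `ρ > 0` and all integers `k ≥ 3` and
`1 ≤ ℓ < k/2` there exists `ξ > 0` such that for sufficiently large `n` divisible by
`k-ℓ`: if `H` is an `(ℓ,ξ)`-extremal `k`-uniform hypergraph on `n` vertices with
`δ_{k-2}(H) > δ_{k-2}(X_{k,ℓ}(n))`, then there is a non-empty ℓ-path `Q` in `H` with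
ends `L₀`, `L₁` and a partition `A* ∪ B*` of `(V ∖ V(Q)) ∪ L₀ ∪ L₁` with `L₀, L₁ ⊆ B*`
satisfying (i)–(iv). -/
theorem statement5 (ρ : ℝ) (hρ : 0 < ρ) (k ℓ : ℕ) (hk : 3 ≤ k) (hl : 1 ≤ ℓ)
    (hlk : 2 * ℓ < k) :
    ∃ ξ : ℝ, 0 < ξ ∧ ∃ n₀ : ℕ, ∀ n : ℕ, n₀ ≤ n → (k - ℓ) ∣ n →
      ∀ E : Finset (Finset (Fin n)), Uniform n k E →
        IsExtremal n k ℓ E ξ →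
        minDeg n (Xedges n k ℓ) (k - 2) < minDeg n E (k - 2) →
        ∃ t : ℕ, 1 ≤ t ∧ ∃ f : ℕ → Fin n, IsPath n k ℓ t E f ∧
          ∃ Astar Bstar : Finset (Fin n),
            Disjoint Astar Bstar ∧
            Astar ∪ Bstar =
              (Finset.univ \ pathVerts n k ℓ t f) ∪ pathEnd0 n ℓ f ∪ pathEnd1 n k ℓ t f ∧
            pathEnd0 n ℓ f ⊆ Bstar ∧ pathEnd1 n k ℓ t f ⊆ Bstar ∧
            -- (i)
            Bstar.card = (2 * k - 2 * ℓ - 1) * Astar.card + ℓ ∧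
            -- (ii)
            (∀ v ∈ Astar,
              (1 - ρ) * (Bstar.card.choose (k - 1) : ℝ) ≤
                (degIn E {v} Bstar ∅ (k - 1) 0 : ℝ)) ∧
            -- (iii)
            (∀ v ∈ Bstar,
              (1 - ρ) * ((Astar.card : ℝ) * (Bstar.card.choose (k - 2) : ℝ)) ≤
                (degIn E {v} Astar Bstar 1 (k - 2) : ℝ)) ∧
            -- (iv)
            (1 - ρ) * ((Astar.card : ℝ) * (Bstar.card.choose (k - ℓ - 1) : ℝ)) ≤
              (degIn E (pathEnd0 n ℓ f) Astar Bstar 1 (k - ℓ - 1) : ℝ) ∧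
            (1 - ρ) * ((Astar.card : ℝ) * (Bstar.card.choose (k - ℓ - 1) : ℝ)) ≤
              (degIn E (pathEnd1 n k ℓ t f) Astar Bstar 1 (k - ℓ - 1) : ℝ) := by
  have hk3 : (3 : ℝ) ≤ k := by exact_mod_cast hk
  obtain ⟨τ, hτ, hτ', hτρ⟩ : ∃ τ : ℝ, 0 < τ ∧ 64 * k * τ ≤ (1 / 2) ^ (2 * k) ∧
      64 * k * (4 * k) ^ k * τ ≤ ρ := by
    refine ⟨min ((1 / 2) ^ (2 * k) / (64 * k)) (ρ / (64 * k * (4 * k) ^ k)), by positivity, ?_, ?_⟩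
    · rw [mul_comm, ← le_div_iff₀ (by positivity)]
      exact min_le_left _ _
    · rw [mul_comm, ← le_div_iff₀ (by positivity)]
      exact min_le_right _ _
  have he : 0 < ExtremalPath.eps τ ℓ 0 := by unfold ExtremalPath.eps; positivity
  obtain ⟨η, hη, hη'⟩ : ∃ η : ℝ, 0 < η ∧ 100 * k * η ≤ ExtremalPath.eps τ ℓ 0 :=
    ⟨ExtremalPath.eps τ ℓ 0 / (100 * k), by positivity, (mul_div_cancel₀ _ (by positivity)).le⟩
  obtain ⟨ζ, hζ, hζ'⟩ : ∃ ζ : ℝ, 0 < ζ ∧ 100 * k * ζ ≤ η * ExtremalPath.eps τ ℓ 0 :=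
    ⟨η * ExtremalPath.eps τ ℓ 0 / (100 * k), by positivity,
      (mul_div_cancel₀ _ (by positivity)).le⟩
  obtain ⟨N, hN⟩ := exists_nat_ge (1000 * (k : ℝ) ^ 3 / ζ)
  refine ⟨ζ / k ^ k, by positivity,
    max N (max (1000 * k ^ 3) (ExtremalPath.freeBound k + 1)), ?_⟩
  intro n hn hdvd E hE hext hdeg
  obtain ⟨A, B, hd, hcov, hA, -, hB⟩ := hext
  obtain ⟨hn1, hn2, hn3⟩ : N ≤ n ∧ 1000 * k ^ 3 ≤ n ∧ ExtremalPath.freeBound k + 1 ≤ n := by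
    simpa using hn
  have hkn : 4 * k ≤ n := by
    have : k * 1 ≤ k * k ^ 2 := Nat.mul_le_mul_left _ (Nat.one_le_pow _ _ (by omega))
    nlinarith
  obtain ⟨c, hc, hnc⟩ := ExtremalPath.exists_eq_mul_of_ceil (by omega) (by omega) hdvd hA
  have hX := ExtremalPath.choose_le_minDeg_Xedges hk hl hlk hc hnc hkn
  refine ExtremalPath.Par.exists_partition (c := c) (A := A) (B := B) (τ := τ) (η := η) (ζ := ζ)
    ?_ hτρ (by omega)
  exact
    { hk := hk, hl := hl, hlk := hlk, unif := hE, disj := hd, cover := hcov, hc := hc, hn := hnc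
      hbig := hn2
      hdeg := fun S hS => by
        have : minDeg n E (k - 2) ≤ deg E S := Nat.sInf_le ⟨S, hS, rfl⟩
        omega
      hτ := hτ, hτ' := hτ', hη := hη, hη' := hη', hζ := hζ, hζ' := hζ'
      hdB := by
        refine (ExtremalPath.dB_empty_le (by omega) hE hB (by positivity)).trans ?_
        rw [mul_div_cancel₀ _ (by positivity)]
      hnζ := by
        rw [div_le_iff₀ hζ] at hN
        have : (N : ℝ) ≤ n := by exact_mod_cast hn1
        nlinarith }
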